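/- Fix an integer n ≥ 1. There exist constants C(n), c(n) > 0 such that the following holds: for every finitely generated multiplicative subgroup Γ ⊆ ℂ^* of rank r, every finite set A ⊆ ℂ with #A = m, and all nonzero integers a_1,…,a_n, the number of n-tuples (x_1,…,x_n) with x_i ∈ Γ ∩ A for all i satisfying a_1x_1 + ⋯ + a_nx_n = 0 is at most C(n)·(m^{⌊n/2⌋} + exp(c(n)·r)·m^{⌊(n−1)/2⌋}). -/

import Mathlib

section Auxiliary

open Finset

/-- Finitely many absolute values of a field, archimedean or not, together with a ring of elements
all of whose nonzero members have total absolute value at least one. -/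
structure AbsSystem (K : Type*) [Field K] (P : Type*) [Fintype P] where
  /-- the absolute values -/
  v : P → AbsoluteValue K ℝ
  /-- the archimedean places -/
  arch : Finset P
  /-- the ring of integral elements -/
  integers : Subring K
  isNonarchimedean : ∀ p ∉ arch, IsNonarchimedean (v p)
  arch_nonempty : arch.Nonempty
  map_natCast : ∀ p ∈ arch, ∀ n : ℕ, v p n = n
  one_le_prod : ∀ x ∈ integers, x ≠ 0 → 1 ≤ ∏ p, v p x

namespace AbsSystem

section Basic

variable {K P : Type*} [Field K] [Fintype P] (S : AbsSystem K P)

/-- The number of archimedean places, as a real number. -/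
noncomputable def deg : ℝ := S.arch.card

theorem one_le_deg : 1 ≤ S.deg := by
  have := S.arch_nonempty.card_pos
  unfold deg
  exact_mod_cast this

/-- The logarithmic embedding, with values in an `ℓ¹` space. -/
noncomputable def L (x : K) : PiLp 1 (fun _ : P => ℝ) := WithLp.toLp 1 fun p => Real.log (S.v p x)

/-- Invertible elements of the ring of integral elements. -/
def IsSUnit (x : K) : Prop := x ≠ 0 ∧ x ∈ S.integers ∧ x⁻¹ ∈ S.integers

variable {S} {x y : K}

theorem L_apply (p : P) : S.L x p = Real.log (S.v p x) := rfl

theorem exp_L (hx : x ≠ 0) (p : P) : Real.exp (S.L x p) = S.v p x :=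
  Real.exp_log ((S.v p).pos hx)

theorem L_mul (hx : x ≠ 0) (hy : y ≠ 0) : S.L (x * y) = S.L x + S.L y := by
  ext p
  simp [L_apply, Real.log_mul, hx, hy]

theorem L_inv : S.L x⁻¹ = -S.L x := by
  ext p
  simp [L_apply]

theorem L_div (hx : x ≠ 0) (hy : y ≠ 0) : S.L (x / y) = S.L x - S.L y := by
  rw [div_eq_mul_inv, L_mul hx (inv_ne_zero hy), L_inv, sub_eq_add_neg]

theorem L_neg : S.L (-x) = S.L x := by
  ext p
  simp [L_apply]

theorem L_one : S.L (1 : K) = 0 := by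
  ext p
  simp [L_apply]

theorem L_pow (n : ℕ) : S.L (x ^ n) = (n : ℝ) • S.L x := by
  ext p
  simp [L_apply]

theorem L_zpow (n : ℤ) : S.L (x ^ n) = (n : ℝ) • S.L x := by
  ext p
  simp [L_apply]

theorem L_prod {ι : Type*} (s : Finset ι) (f : ι → K) (hf : ∀ i ∈ s, f i ≠ 0) :
    S.L (∏ i ∈ s, f i) = ∑ i ∈ s, S.L (f i) := by
  classical
  induction s using Finset.induction_on with
  | empty => simpa using L_one
  | insert a s ha ih =>
    rw [prod_insert ha, sum_insert ha, L_mul (hf a (mem_insert_self _ _)) (prod_ne_zero_iff.2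
      fun i hi => hf i (mem_insert_of_mem hi)), ih fun i hi => hf i (mem_insert_of_mem hi)]

theorem norm_eq_sum (f : PiLp 1 (fun _ : P => ℝ)) : ‖f‖ = ∑ p, |f p| := by
  simp [PiLp.norm_eq_of_L1]

namespace IsSUnit

theorem mul (hx : S.IsSUnit x) (hy : S.IsSUnit y) : S.IsSUnit (x * y) :=
  ⟨mul_ne_zero hx.1 hy.1, mul_mem hx.2.1 hy.2.1, by rw [mul_inv]; exact mul_mem hx.2.2 hy.2.2⟩

theorem inv (hx : S.IsSUnit x) : S.IsSUnit x⁻¹ :=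
  ⟨inv_ne_zero hx.1, hx.2.2, by rw [inv_inv]; exact hx.2.1⟩

theorem div (hx : S.IsSUnit x) (hy : S.IsSUnit y) : S.IsSUnit (x / y) := by
  rw [div_eq_mul_inv]; exact hx.mul hy.inv

theorem neg (hx : S.IsSUnit x) : S.IsSUnit (-x) :=
  ⟨neg_ne_zero.2 hx.1, neg_mem hx.2.1, by rw [inv_neg]; exact neg_mem hx.2.2⟩

theorem one : S.IsSUnit (1 : K) := ⟨one_ne_zero, one_mem _, by rw [inv_one]; exact one_mem _⟩

theorem prod {ι : Type*} {s : Finset ι} {f : ι → K} (hf : ∀ i ∈ s, S.IsSUnit (f i)) :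
    S.IsSUnit (∏ i ∈ s, f i) :=
  prod_induction f S.IsSUnit (fun _ _ => mul) one hf

theorem sum_L (hx : S.IsSUnit x) : ∑ p, S.L x p = 0 := by
  have key : ∀ y : K, y ≠ 0 → y ∈ S.integers → 0 ≤ ∑ p, S.L y p := by
    intro y h1 h2
    simp only [L_apply]
    rw [← Real.log_prod fun p _ => (S.v p).ne_zero h1]
    exact Real.log_nonneg (S.one_le_prod y h2 h1)
  refine le_antisymm ?_ (key x hx.1 hx.2.1)
  have := key _ hx.inv.1 hx.2.2
  rw [L_inv] at this
  simpa using this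

end IsSUnit

variable (S) in
open scoped Classical in
/-- The function with value `c` at the archimedean places and `0` elsewhere. -/
noncomputable def archConst (c : ℝ) (p : P) : ℝ := if p ∈ S.arch then c else 0

theorem sum_archConst (c : ℝ) : ∑ p, S.archConst c p = S.deg * c := by
  classical
  simp only [archConst]
  rw [← sum_filter, sum_const, filter_mem_eq_inter, univ_inter, nsmul_eq_mul, deg]

/-- The size of a sum of at most `N` terms. -/
theorem v_sum_le {ι : Type*} {s : Finset ι} (f : ι → K) (p : P) {M N : ℝ}
    (h : ∀ i ∈ s, S.v p (f i) ≤ Real.exp M) (hN : (s.card : ℝ) ≤ N) (hN1 : 1 ≤ N) :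
    S.v p (∑ i ∈ s, f i) ≤ Real.exp (S.archConst (Real.log N) p + M) := by
  classical
  have hM := Real.exp_pos M
  simp only [archConst]
  split_ifs with hp
  · refine ((S.v p).sum_le s f).trans ?_
    rw [Real.exp_add, Real.exp_log (by linarith)]
    refine (sum_le_card_nsmul s _ _ h).trans ?_
    rw [nsmul_eq_mul]
    gcongr
  · rw [zero_add]
    have hna := S.isNonarchimedean p hp
    clear hp hN
    induction s using Finset.induction_on with
    | empty => simpa using hM.le
    | insert a s ha ih =>
      rw [sum_insert ha]
      exact (hna _ _).trans (max_le (h a (mem_insert_self _ _))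
        (ih fun i hi => h i (mem_insert_of_mem hi)))

theorem v_intCast_le (p : P) {n : ℤ} {N : ℝ} (hN1 : 1 ≤ N) (hn : |(n : ℝ)| ≤ N) :
    S.v p n ≤ Real.exp (S.archConst (Real.log N) p) := by
  have h : S.v p (n : K) = S.v p (n.natAbs : K) := by
    rcases Int.natAbs_eq n with h | h
    · conv_lhs => rw [h]
      rw [Int.cast_natCast]
    · conv_lhs => rw [h]
      rw [Int.cast_neg, Int.cast_natCast, AbsoluteValue.map_neg]
  have := v_sum_le (S := S) (s := range n.natAbs) (fun _ => (1 : K)) p (M := 0) (N := N) (by simp)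
    (by rw [card_range, Nat.cast_natAbs, Int.cast_abs]; exact hn) hN1
  rw [h]
  simpa using this

/-- The fundamental inequality: a nonzero integral element is not small everywhere. -/
theorem nonneg_of_v_le {z : K} (hz : z ∈ S.integers) (hz0 : z ≠ 0) (g : P → ℝ)
    (h : ∀ p, S.v p z ≤ Real.exp (g p)) : 0 ≤ ∑ p, g p := by
  have h1 := S.one_le_prod z hz hz0
  have h2 : ∏ p, S.v p z ≤ ∏ p, Real.exp (g p) :=
    prod_le_prod (fun p _ => (S.v p).nonneg _) fun p _ => h p
  rw [← Real.exp_sum] at h2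
  exact Real.one_le_exp_iff.1 (h1.trans h2)

end Basic

section NumberField

open NumberField

theorem exists_of_numberField (K : Type) [Field K] [NumberField K] (F : Finset K)
    (hF : ∀ x ∈ F, x ≠ 0) :
    ∃ (P : Type) (_ : Fintype P) (S : AbsSystem K P), ∀ x ∈ F, S.IsSUnit x := by
  classical
  have hfin : {w : FinitePlace K | ∃ f ∈ F, w f ≠ 1}.Finite := by
    have : {w : FinitePlace K | ∃ f ∈ F, w f ≠ 1} =
        ⋃ f ∈ F, Function.mulSupport fun w : FinitePlace K => w f := by
      ext w; simp
    rw [this]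
    exact F.finite_toSet.biUnion fun f hf => FinitePlace.hasFiniteMulSupport (hF f hf)
  set T : Finset (FinitePlace K) := hfin.toFinset with hT
  have hTF : ∀ w ∉ T, ∀ f ∈ F, w f = 1 := by
    intro w hw f hf
    by_contra h
    exact hw (hfin.mem_toFinset.2 ⟨f, hf, h⟩)
  let P := (Σ w : InfinitePlace K, Fin w.mult) ⊕ T
  let O : Subring K :=
    { carrier := {x | ∀ w : FinitePlace K, w ∉ T → w x ≤ 1}
      mul_mem' := fun {a b} ha hb w hw => by
        rw [map_mul]; exact mul_le_one₀ (ha w hw) (apply_nonneg _ _) (hb w hw)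
      one_mem' := fun w _ => by simp
      add_mem' := fun {a b} ha hb w hw => (w.add_le a b).trans (max_le (ha w hw) (hb w hw))
      zero_mem' := fun w _ => by simp
      neg_mem' := fun {a} ha w hw => by
        have : w (-a) = w a := by
          rw [FinitePlace.coe_apply, FinitePlace.coe_apply, AbsoluteValue.map_neg]
        exact this.trans_le (ha w hw) }
  refine ⟨P, inferInstance,
    { v := Sum.elim (fun w => w.1.1) fun w => w.1.1
      arch := univ.map ⟨Sum.inl, Sum.inl_injective⟩
      integers := O
      isNonarchimedean := ?_
      arch_nonempty := ?_
      map_natCast := ?_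
      one_le_prod := ?_ }, ?_⟩
  · rintro (p | p) hp
    · simp at hp
    · intro x y
      exact p.1.add_le x y
  · obtain ⟨w⟩ := show Nonempty (InfinitePlace K) from inferInstance
    exact ⟨Sum.inl ⟨w, ⟨0, w.mult_pos⟩⟩, by simp⟩
  · rintro (p | p) hp n
    · change p.1 (n : K) = n
      rw [← p.1.norm_embedding_eq]
      simp
    · simp at hp
  · intro x hx hx0
    have h1 := prod_abs_eq_one (K := K) hx0
    have hsupp := FinitePlace.hasFiniteMulSupport (K := K) hx0
    have hs : (Function.mulSupport fun w : FinitePlace K => w x) ⊆ ↑(T ∪ hsupp.toFinset) := by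
      intro w hw
      simp only [coe_union, Set.mem_union]
      right
      exact hsupp.mem_toFinset.2 hw
    rw [finprod_eq_prod_of_mulSupport_subset _ hs, ← sdiff_union_of_subset (subset_union_left
      (s₁ := T) (s₂ := hsupp.toFinset)), prod_union sdiff_disjoint] at h1
    have h2 : ∏ w ∈ (T ∪ hsupp.toFinset) \ T, w x ≤ 1 :=
      prod_le_one (fun w _ => apply_nonneg _ _) fun w hw => hx w (mem_sdiff.1 hw).2
    rw [Fintype.prod_sum_type]
    simp only [Sum.elim_inl, Sum.elim_inr]
    rw [Fintype.prod_sigma]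
    have h3 : ∏ w : T, w.1.1 x = ∏ w ∈ T, w x := prod_coe_sort T fun w => w x
    rw [h3]
    have h4 : ∀ w : InfinitePlace K, ∏ _i : Fin w.mult, w.1 x = w x ^ w.mult := by
      intro w; simp; rfl
    simp only [h4]
    have h5 : 0 ≤ (∏ w : InfinitePlace K, w x ^ w.mult) * ∏ w ∈ T, w x :=
      mul_nonneg (prod_nonneg fun w _ => pow_nonneg (apply_nonneg _ _) _)
        (prod_nonneg fun w _ => apply_nonneg _ _)
    nlinarith
  · intro x hx
    refine ⟨hF x hx, fun w hw => (hTF w hw x hx).le, fun w hw => ?_⟩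
    rw [map_inv₀, hTF w hw x hx, inv_one]

end NumberField

end AbsSystem

section LinearAlgebra

variable {K ι : Type*} [Field K] [Fintype ι] [DecidableEq ι]

/-- A set of vectors with zero coordinate sum either satisfies a second linear equation or contains
all but one row of an invertible matrix. -/
theorem exists_relation_or_rows (i₀ : ι) (T : Set (ι → K)) (hT : T.Nonempty)
    (hsum : ∀ y ∈ T, ∑ i, y i = 0) :
    (∃ b : ι → K, (∃ i j, b i ≠ b j) ∧ ∀ y ∈ T, ∑ i, b i * y i = 0) ∨
    ∃ Y : Matrix ι ι K, Y i₀ = Pi.single i₀ 1 ∧ (∀ j ≠ i₀, Y j ∈ T) ∧ Y.det ≠ 0 := by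
  obtain ⟨t₀, ht₀⟩ := hT
  by_cases hno : ∃ b : ι → K, (∃ i j, b i ≠ b j) ∧ ∀ y ∈ T, ∑ i, b i * y i = 0
  · exact Or.inl hno
  right
  push Not at hno
  obtain ⟨f, hfT, hspan, -⟩ := Submodule.exists_fun_fin_finrank_span_eq K T
  have hd : Module.finrank K (Submodule.span K T) ≤ Fintype.card {j : ι // j ≠ i₀} := by
    have hlt : Submodule.span K T < ⊤ := by
      refine lt_top_iff_ne_top.2 fun htop => ?_
      have hle : Submodule.span K T ≤ LinearMap.ker (∑ i : ι, LinearMap.proj (R := K)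
          (φ := fun _ : ι => K) i) := by
        refine Submodule.span_le.2 fun y hy => ?_
        simpa using hsum y hy
      have hmem : (Pi.single i₀ 1 : ι → K) ∈ Submodule.span K T := by rw [htop]; trivial
      have := hle hmem
      simp at this
    have := Submodule.finrank_lt hlt.ne
    rw [Module.finrank_fintype_fun_eq_card] at this
    rw [Fintype.card_subtype_compl, Fintype.card_subtype_eq]
    omega
  let e := Fintype.equivFin {j : ι // j ≠ i₀}
  let Y : Matrix ι ι K := fun j => if h : j = i₀ then Pi.single i₀ 1 else
    if h' : (e ⟨j, h⟩ : ℕ) < Module.finrank K (Submodule.span K T) then f ⟨e ⟨j, h⟩, h'⟩ else t₀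
  have hY0 : Y i₀ = Pi.single i₀ 1 := by simp [Y]
  have hYT : ∀ j ≠ i₀, Y j ∈ T := by
    intro j hj
    simp only [Y, dif_neg hj]
    split_ifs
    · exact hfT _
    · exact ht₀
  refine ⟨Y, hY0, hYT, fun hdet => ?_⟩
  obtain ⟨w, hw0, hw⟩ := Matrix.exists_mulVec_eq_zero_iff.2 hdet
  have hrow : ∀ j, ∑ i, Y j i * w i = 0 := fun j => congrFun hw j
  have hwi : w i₀ = 0 := by
    have := hrow i₀
    rw [hY0] at this
    simpa [Pi.single_apply] using this
  have hf : ∀ k, ∑ i, w i * f k i = 0 := by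
    intro k
    let j := e.symm (Fin.castLE hd k)
    have hj : Y j.1 = f k := by
      have : (e ⟨j.1, j.2⟩ : ℕ) = k := by simp [j]
      simp only [Y, dif_neg j.2, this, k.2, dif_pos]
    have := hrow j.1
    rw [hj] at this
    simpa [mul_comm] using this
  have hker : Submodule.span K T ≤ LinearMap.ker (∑ i : ι, w i • LinearMap.proj (R := K)
      (φ := fun _ : ι => K) i) := by
    rw [← hspan]
    refine Submodule.span_le.2 ?_
    rintro _ ⟨k, rfl⟩
    simpa using hf k
  have hwT : ∀ y ∈ T, ∑ i, w i * y i = 0 := by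
    intro y hy
    simpa using hker (Submodule.subset_span hy)
  by_cases hc : ∃ i j, w i ≠ w j
  · obtain ⟨y, hy, hne⟩ := hno w hc
    exact hne (hwT y hy)
  · push Not at hc
    exact hw0 (funext fun i => (hc i i₀).trans hwi)

end LinearAlgebra

namespace AbsSystem

variable {K P ι : Type*} [Field K] [Fintype P] [Fintype ι] {S : AbsSystem K P}

variable (S) in
/-- Solutions in units of the equation with all coefficients one. -/
structure IsSol (y : ι → K) : Prop where
  unit : ∀ i, S.IsSUnit (y i)
  sum : ∑ i, y i = 0

theorem sum_max {x y : K} (hx : S.IsSUnit x) (hy : S.IsSUnit y) :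
    ∑ p, max (S.L x p) (S.L y p) = ‖S.L x - S.L y‖ / 2 := by
  rw [norm_eq_sum]
  have h : ∀ p, max (S.L x p) (S.L y p) =
      (S.L x p + S.L y p + |(S.L x - S.L y) p|) / 2 := by
    intro p
    rw [PiLp.sub_apply]
    rcases le_total (S.L x p) (S.L y p) with h | h
    · rw [max_eq_right h, abs_of_nonpos (by linarith)]; ring
    · rw [max_eq_left h, abs_of_nonneg (by linarith)]; ring
  simp only [h]
  rw [← sum_div, sum_add_distrib, sum_add_distrib, hx.sum_L, hy.sum_L]
  ring

variable [DecidableEq ι]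

theorem v_det_le (M : Matrix ι ι K) (p : P) (c : ι → ℝ)
    (h : ∀ j i, S.v p (M j i) ≤ Real.exp (c j)) :
    S.v p M.det ≤
      Real.exp (S.archConst (Real.log (Fintype.card ι).factorial) p + ∑ j, c j) := by
  rw [Matrix.det_apply]
  refine v_sum_le _ p ?_ ?_ ?_
  · intro σ _
    have h1 : S.v p (Equiv.Perm.sign σ • ∏ i, M (σ i) i) = ∏ i, S.v p (M (σ i) i) := by
      rw [← map_prod]
      rcases Int.units_eq_one_or (Equiv.Perm.sign σ) with h | h <;> simp [h]
    rw [h1, ← Equiv.sum_comp σ c, Real.exp_sum]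
    exact prod_le_prod (fun i _ => (S.v p).nonneg _) fun i _ => h _ _
  · rw [card_univ, Fintype.card_perm]
  · exact_mod_cast Nat.one_le_iff_ne_zero.2 (Nat.factorial_ne_zero _)

theorem det_mem_integers {M : Matrix ι ι K} (h : ∀ j i, M j i ∈ S.integers) :
    M.det ∈ S.integers := by
  rw [Matrix.det_apply]
  refine sum_mem fun σ _ => ?_
  have : ∏ i, M (σ i) i ∈ S.integers := prod_mem fun i _ => h _ _
  rcases Int.units_eq_one_or (Equiv.Perm.sign σ) with h | h
  · simpa [h] using this
  · simpa [h] using neg_mem this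

/-- The gap principle: solutions that are close to each other compared to their height satisfy a
second linear equation. -/
theorem exists_relation_of_close {T : Set (ι → K)} (hT : ∀ y ∈ T, S.IsSol y) {η : ℝ}
    (hη : ∀ y ∈ T, ∀ y' ∈ T, ∀ i, ‖S.L (y i) - S.L (y' i)‖ ≤ η) {x : ι → K} (hx : x ∈ T) {i₁ i₂ : ι}
    (hd : 2 * (S.deg * Real.log (Fintype.card ι).factorial + (Fintype.card ι : ℝ) ^ 2 * η) <
      ‖S.L (x i₁) - S.L (x i₂)‖) :
    ∃ b : ι → K, (∃ i j, b i ≠ b j) ∧ ∀ y ∈ T, ∑ i, b i * y i = 0 := by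
  rcases exists_relation_or_rows i₁ T ⟨x, hx⟩ fun y hy => (hT y hy).sum with h | ⟨Y, hY0, hYT, hdet⟩
  · exact h
  exfalso
  have hη0 : 0 ≤ η := by simpa using hη x hx x hx i₁
  have hxu := (hT x hx).unit
  have hx0 : ∀ i, x i ≠ 0 := fun i => (hxu i).1
  let Z : Matrix ι ι K := fun j i => Y j i / x i
  let W : Matrix ι ι K := fun j i => if j = i₁ then 1 else Y j i / x i
  have hWu : ∀ j i, S.IsSUnit (W j i) := by
    intro j i
    simp only [W]
    split_ifs with h
    · exact IsSUnit.one
    · exact ((hT _ (hYT j h)).unit i).div (hxu i)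
  have hWη : ∀ j i, ‖S.L (W j i)‖ ≤ η := by
    intro j i
    simp only [W]
    split_ifs with h
    · rw [L_one, norm_zero]; exact hη0
    · rw [L_div ((hT _ (hYT j h)).unit i).1 (hx0 i)]
      exact hη _ (hYT j h) _ hx i
  let a : ι → K := fun i => (W.updateRow i₁ (Pi.single i 1)).det
  have hZW : ∀ i, (Z.updateRow i₁ (Pi.single i 1)).det = a i := by
    intro i
    congr 1
    ext j k
    by_cases h : j = i₁
    · subst h; simp
    · rw [Matrix.updateRow_ne h, Matrix.updateRow_ne h]; simp [Z, W, h]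
  have hZx : Z.mulVec x = Pi.single i₁ 1 := by
    funext j
    have h1 : ∀ i, Z j i * x i = Y j i := fun i => div_mul_cancel₀ _ (hx0 i)
    simp only [Matrix.mulVec, dotProduct, h1]
    by_cases h : j = i₁
    · subst h; rw [hY0]; simp
    · rw [Pi.single_eq_of_ne h]; exact (hT _ (hYT j h)).sum
  have hcr : ∀ i, x i * Z.det = a i := by
    intro i
    have h2 : Z.adjugate.mulVec (Z.mulVec x) = Z.det • x := by
      rw [Matrix.mulVec_mulVec, Matrix.adjugate_mul, Matrix.smul_mulVec, Matrix.one_mulVec]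
    rw [hZx] at h2
    have h3 := congrFun h2 i
    rw [Matrix.mulVec_single_one] at h3
    simp only [Matrix.col_apply, Matrix.adjugate_apply, Pi.smul_apply, smul_eq_mul] at h3
    rw [mul_comm, ← h3]
    exact hZW i
  have hZdet : Z.det ≠ 0 := by
    have : Y = Z * Matrix.diagonal x := by
      ext j i
      rw [Matrix.mul_diagonal]
      exact (div_mul_cancel₀ _ (hx0 i)).symm
    intro h
    rw [this, Matrix.det_mul, h, zero_mul] at hdet
    exact hdet rfl
  have ha0 : a i₁ ≠ 0 := by rw [← hcr]; exact mul_ne_zero (hx0 _) hZdet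
  let c : P → ι → ℝ := fun p j => ∑ i, |S.L (W j i) p|
  have hva : ∀ i p, S.v p (a i) ≤
      Real.exp (S.archConst (Real.log (Fintype.card ι).factorial) p + ∑ j, c p j) := by
    intro i p
    refine v_det_le _ p (c p) fun j k => ?_
    have hc0 : ∀ j, 0 ≤ c p j := fun j => sum_nonneg fun _ _ => abs_nonneg _
    by_cases h : j = i₁
    · subst h
      rw [Matrix.updateRow_self, Pi.single_apply]
      have := Real.one_le_exp (hc0 j)
      split_ifs
      · simpa using this
      · simpa using (Real.exp_pos _).le
    · rw [Matrix.updateRow_ne h, ← exp_L (hWu j k).1]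
      refine Real.exp_le_exp.2 ((le_abs_self _).trans ?_)
      exact single_le_sum (f := fun k => |S.L (W j k) p|) (fun _ _ => abs_nonneg _) (mem_univ k)
  have hmain := nonneg_of_v_le (S := S) (z := a i₁) ?_ ha0
    (fun p => S.archConst (Real.log (Fintype.card ι).factorial) p + ∑ j, c p j
      - max (S.L (x i₁) p) (S.L (x i₂) p) + S.L (x i₁) p) ?_
  · rw [sum_add_distrib, sum_sub_distrib, sum_add_distrib, sum_archConst, sum_max (hxu _) (hxu _),
      (hxu i₁).sum_L] at hmain
    have hc : ∑ p, ∑ j, c p j ≤ (Fintype.card ι : ℝ) ^ 2 * η := by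
      rw [sum_comm]
      calc ∑ j, ∑ p, c p j = ∑ j, ∑ i, ‖S.L (W j i)‖ := by
            refine sum_congr rfl fun j _ => ?_
            simp only [c, norm_eq_sum]
            rw [sum_comm]
        _ ≤ ∑ _j : ι, ∑ _i : ι, η := by gcongr; exact hWη _ _
        _ = _ := by simp; ring
    linarith
  · refine det_mem_integers fun j i => ?_
    by_cases h : j = i₁
    · subst h
      rw [Matrix.updateRow_self, Pi.single_apply]
      split_ifs
      · exact one_mem _
      · exact zero_mem _
    · rw [Matrix.updateRow_ne h]; exact (hWu j i).2.1
  · intro p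
    have key : ∀ i, S.v p (a i₁) ≤ Real.exp (S.archConst (Real.log (Fintype.card ι).factorial) p +
        ∑ j, c p j - S.L (x i) p + S.L (x i₁) p) := by
      intro i
      have h4 : a i₁ = a i / x i * x i₁ := by
        rw [← hcr, ← hcr]
        field_simp [hx0 i]
      rw [h4, map_mul, map_div₀, Real.exp_add, Real.exp_sub, exp_L (hx0 _), exp_L (hx0 _)]
      gcongr
      exact hva i p
    rcases max_choice (S.L (x i₁) p) (S.L (x i₂) p) with h | h <;> rw [h] <;> exact key _

end AbsSystem

namespace AbsSystem

section PowerSums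

variable {K P : Type*} [Field K] [Fintype P] {S : AbsSystem K P}

variable (S) in
/-- The positive integers up to `E` are units. -/
def HasNat (E : ℕ) : Prop := ∀ k : ℕ, 1 ≤ k → k ≤ E → S.IsSUnit (k : K)

/-- The Frobenius congruence at a nonarchimedean place. -/
theorem v_sum_pow_sub_le {p : P} (hp : p ∉ S.arch) {ι : Type*} (s : Finset ι) (w : ι → K) {M : ℝ}
    (hM : 0 ≤ M) (hw : ∀ i ∈ s, S.v p (w i) ≤ M) {q : ℕ} (hq : q.Prime) :
    S.v p (∑ i ∈ s, w i) ≤ M ∧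
      S.v p ((∑ i ∈ s, w i) ^ q - ∑ i ∈ s, w i ^ q) ≤ S.v p q * M ^ q := by
  classical
  have hna := S.isNonarchimedean p hp
  have hnat : ∀ n : ℕ, S.v p n ≤ 1 := by
    intro n
    induction n with
    | zero => simp
    | succ k ih =>
      rw [Nat.cast_succ]
      exact (hna _ _).trans (max_le ih (by simp))
  have hsum : ∀ (t : Finset ℕ) (f : ℕ → K) (B : ℝ), 0 ≤ B → (∀ k ∈ t, S.v p (f k) ≤ B) →
      S.v p (∑ k ∈ t, f k) ≤ B := by
    intro t f B hB hf
    induction t using Finset.induction_on with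
    | empty => simpa using hB
    | insert a s ha ih =>
      rw [sum_insert ha]
      exact (hna _ _).trans (max_le (hf a (mem_insert_self _ _))
        (ih fun i hi => hf i (mem_insert_of_mem hi)))
  induction s using Finset.induction_on with
  | empty => simp [hM, hq.ne_zero, mul_nonneg, (S.v p).nonneg]
  | insert a s ha ih =>
    obtain ⟨h1, h2⟩ := ih fun i hi => hw i (mem_insert_of_mem hi)
    have ha' := hw a (mem_insert_self _ _)
    refine ⟨?_, ?_⟩
    · rw [sum_insert ha]
      exact (hna _ _).trans (max_le ha' h1)
    · set b := ∑ i ∈ s, w i with hb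
      have : (∑ i ∈ insert a s, w i) ^ q - ∑ i ∈ insert a s, w i ^ q =
          q * (∑ k ∈ Ioo 0 q, w a ^ k * b ^ (q - k) * ((q.choose k / q : ℕ) : K)) +
            (b ^ q - ∑ i ∈ s, w i ^ q) := by
        rw [sum_insert ha, sum_insert ha, ← hb, (Commute.all _ _).add_pow_prime_eq' hq]
        ring
      rw [this]
      refine (hna _ _).trans (max_le ?_ h2)
      rw [map_mul]
      refine mul_le_mul_of_nonneg_left (hsum _ _ _ (by positivity) fun k hk => ?_)
        ((S.v p).nonneg _)
      rw [map_mul, map_mul, map_pow, map_pow]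
      have hk' : M ^ k * M ^ (q - k) = M ^ q := by
        rw [← pow_add, Nat.add_sub_cancel' (mem_Ioo.1 hk).2.le]
      have h3 : S.v p (w a) ^ k * S.v p b ^ (q - k) ≤ M ^ q := by
        rw [← hk']
        gcongr
      exact (mul_le_mul h3 (hnat _) ((S.v p).nonneg _) (by positivity)).trans_eq (mul_one _)

theorem sum_pow_eq_zero {ι : Type*} [Fintype ι] {u : ι → K} (hu : ∀ i, S.IsSUnit (u i))
    (h0 : ∑ i, u i = 0) {N E : ℕ} (hN : Fintype.card ι ≤ N) (hN1 : 1 ≤ N) {δ : ℝ}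
    (hδ : ∀ i j, ‖S.L (u i) - S.L (u j)‖ ≤ δ * S.deg)
    (hδ' : E * (N * δ) < Real.log (N + 1) - Real.log N) (hE : S.HasNat E) (e : ℕ) (he : 1 ≤ e)
    (heE : e ≤ E) (hpr : ∀ q : ℕ, q.Prime → q ∣ e → N < q) : ∑ i, u i ^ e = 0 := by
  classical
  induction e using Nat.strong_induction_on with
  | _ e ih =>
  rcases eq_or_ne e 1 with rfl | he1
  · simpa using h0
  by_contra hne
  obtain ⟨i₀⟩ : Nonempty ι := by
    by_contra h
    rw [not_nonempty_iff] at h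
    simp at hne
  set q := e.minFac with hqdef
  have hq : q.Prime := Nat.minFac_prime he1
  obtain ⟨e', he'⟩ := Nat.minFac_dvd e
  rw [← hqdef] at he'
  have hqN : N < q := hpr q hq (Nat.minFac_dvd e)
  have he'1 : 1 ≤ e' := by
    rcases Nat.eq_zero_or_pos e' with h | h
    · rw [h] at he'; omega
    · exact h
  have hlt : e' < e := by
    rw [he']; exact lt_mul_of_one_lt_left (by omega) hq.one_lt
  have hprev := ih e' hlt he'1 (by omega) fun r hr hd => hpr r hr (hd.trans ⟨q, by rw [he']; ring⟩)
  have hqE : q ≤ E := (Nat.le_of_dvd (by omega) (Nat.minFac_dvd e)).trans heE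
  have hqu : S.IsSUnit (q : K) := hE q hq.one_le hqE
  let d : P → ℝ := fun p => ∑ i, |(S.L (u i) - S.L (u i₀)) p|
  have hd0 : ∀ p, 0 ≤ d p := fun p => sum_nonneg fun _ _ => abs_nonneg _
  have hud : ∀ i p, S.v p (u i) ≤ Real.exp (S.L (u i₀) p + d p) := by
    intro i p
    rw [← exp_L (hu i).1]
    refine Real.exp_le_exp.2 ?_
    have h1 := single_le_sum (f := fun i => |(S.L (u i) - S.L (u i₀)) p|)
      (fun _ _ => abs_nonneg _) (mem_univ i)
    have h2 := le_abs_self ((S.L (u i) - S.L (u i₀)) p)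
    rw [PiLp.sub_apply] at h1 h2
    simp only [d, PiLp.sub_apply] at h1 ⊢
    linarith
  have hmain := nonneg_of_v_le (S := S) (z := ∑ i, u i ^ e)
    (sum_mem fun i _ => pow_mem (hu i).2.1 _) hne
    (fun p => S.L (q : K) p + S.archConst (Real.log N - Real.log q) p +
      e * (S.L (u i₀) p + d p)) ?_
  · rw [sum_add_distrib, sum_add_distrib, hqu.sum_L, sum_archConst, ← mul_sum, sum_add_distrib,
      (hu i₀).sum_L] at hmain
    have hd : ∑ p, d p ≤ N * (δ * S.deg) := by
      simp only [d]
      rw [sum_comm]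
      calc ∑ i, ∑ p, |(S.L (u i) - S.L (u i₀)) p| = ∑ i, ‖S.L (u i) - S.L (u i₀)‖ := by
            simp only [norm_eq_sum]
        _ ≤ ∑ _i : ι, δ * S.deg := by gcongr; exact hδ _ _
        _ = Fintype.card ι * (δ * S.deg) := by simp
        _ ≤ _ := by
            have : 0 ≤ δ * S.deg := (norm_nonneg _).trans (hδ i₀ i₀)
            gcongr
    have hdeg := S.one_le_deg
    have hδ0 : 0 ≤ δ := by
      have : 0 ≤ δ * S.deg := (norm_nonneg _).trans (hδ i₀ i₀)
      exact nonneg_of_mul_nonneg_left this (by linarith)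
    have h1 : (e : ℝ) * (∑ p, d p) ≤ E * (N * (δ * S.deg)) := by
      have : (0 : ℝ) ≤ ∑ p, d p := sum_nonneg fun p _ => hd0 p
      gcongr
    have h2 : Real.log (N + 1) ≤ Real.log q :=
      Real.log_le_log (by positivity) (by exact_mod_cast hqN)
    have h3 : 0 < S.deg * (Real.log q - Real.log N - E * (N * δ)) :=
      mul_pos (by linarith) (by linarith)
    nlinarith
  · intro p
    set B := Real.exp (S.L (u i₀) p + d p) with hB
    have hB0 : 0 ≤ B := (Real.exp_pos _).le
    have hexp : Real.exp (e * (S.L (u i₀) p + d p)) = (B ^ e') ^ q := by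
      rw [← pow_mul, mul_comm e' q, ← he', hB, ← Real.exp_nat_mul]
    rw [Real.exp_add, Real.exp_add, hexp, exp_L hqu.1]
    have hw : ∀ i, S.v p (u i ^ e') ≤ B ^ e' := fun i => by
      rw [map_pow]
      exact pow_le_pow_left₀ ((S.v p).nonneg _) (hud i p) _
    have hue : ∀ i, u i ^ e = (u i ^ e') ^ q := fun i => by
      rw [← pow_mul, mul_comm e' q, ← he']
    simp only [hue]
    by_cases hp : p ∈ S.arch
    · have hN0 : (0 : ℝ) < N := by exact_mod_cast hN1
      have hq0 : (0 : ℝ) < q := by exact_mod_cast hq.pos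
      rw [archConst, if_pos hp, Real.exp_sub, Real.exp_log hN0, Real.exp_log hq0,
        S.map_natCast p hp, mul_div_cancel₀ _ hq0.ne']
      refine ((S.v p).sum_le _ _).trans ?_
      refine (sum_le_card_nsmul univ _ ((B ^ e') ^ q) fun i _ => ?_).trans ?_
      · rw [map_pow]
        exact pow_le_pow_left₀ ((S.v p).nonneg _) (hw i) _
      · rw [nsmul_eq_mul, card_univ]
        have : (Fintype.card ι : ℝ) ≤ N := by exact_mod_cast hN
        gcongr
    · rw [archConst, if_neg hp, Real.exp_zero, mul_one]
      have h := (v_sum_pow_sub_le (S := S) hp univ (fun i => u i ^ e') (pow_nonneg hB0 e')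
        (fun i _ => hw i) hq).2
      rw [hprev, zero_pow hq.ne_zero, zero_sub, AbsoluteValue.map_neg] at h
      exact h

/-- A vanishing sum of units that are very close to each other splits into vanishing subsums of
terms that agree up to a root of unity. -/
theorem sum_filter_pow_eq_zero [DecidableEq K] {ι : Type*} [Fintype ι] {u : ι → K}
    (hu : ∀ i, S.IsSUnit (u i)) (h0 : ∑ i, u i = 0) {N E : ℕ} (hN : Fintype.card ι ≤ N)
    (hN1 : 1 ≤ N) {δ : ℝ} (hδ : ∀ i j, ‖S.L (u i) - S.L (u j)‖ ≤ δ * S.deg)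
    (hδ' : E * (N * δ) < Real.log (N + 1) - Real.log N) (hE : S.HasNat E)
    (hEN : 1 + N.factorial * N ≤ E) (w : K) :
    ∑ i with u i ^ N.factorial = w, u i = 0 := by
  classical
  set M := N.factorial with hM
  by_cases hw : ∃ i, u i ^ M = w
  swap
  · push Not at hw
    rw [filter_false_of_mem fun i _ => hw i, sum_empty]
  obtain ⟨i₀, hi₀⟩ := hw
  have hpow : ∀ t ≤ N, ∑ i, u i * (u i ^ M) ^ t = 0 := by
    intro t ht
    have := sum_pow_eq_zero hu h0 hN hN1 hδ hδ' hE (1 + M * t) (by omega)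
      (le_trans (by gcongr) hEN) ?_
    · simpa [pow_add, pow_mul] using this
    · intro q hq hd
      by_contra hle
      have h1 : q ∣ M := hq.dvd_factorial.2 (by omega)
      have h2 : q ∣ 1 := (Nat.dvd_add_left (h1.mul_right t)).1 hd
      exact hq.one_lt.ne' (Nat.dvd_one.1 h2)
  let W : Finset K := (univ.image fun i => u i ^ M).erase w
  let f : Polynomial K := ∏ w' ∈ W, (Polynomial.X - Polynomial.C w')
  have hdeg : f.natDegree < N + 1 := by
    have h1 : f.natDegree = W.card := by
      simp only [f]
      rw [Polynomial.natDegree_prod_of_monic _ _ fun i _ => Polynomial.monic_X_sub_C i]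
      simp
    have h2 : W.card ≤ N := (card_erase_le.trans card_image_le).trans (by simpa using hN)
    omega
  have hf : ∑ i, u i * f.eval (u i ^ M) = 0 := by
    simp only [Polynomial.eval_eq_sum_range' hdeg, mul_sum]
    rw [sum_comm]
    refine sum_eq_zero fun t ht => ?_
    have := hpow t (by simpa [Nat.lt_succ_iff] using ht)
    rw [← mul_zero (f.coeff t), ← this, mul_sum]
    exact sum_congr rfl fun i _ => by ring
  have hfw : f.eval w ≠ 0 := by
    simp only [f, Polynomial.eval_prod, Polynomial.eval_sub, Polynomial.eval_X, Polynomial.eval_C]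
    refine prod_ne_zero_iff.2 fun w' hw' => sub_ne_zero.2 ?_
    exact (mem_erase.1 hw').1.symm
  have hfw' : ∀ i, u i ^ M ≠ w → f.eval (u i ^ M) = 0 := by
    intro i hi
    simp only [f, Polynomial.eval_prod, Polynomial.eval_sub, Polynomial.eval_X, Polynomial.eval_C]
    exact prod_eq_zero (i := u i ^ M) (mem_erase.2 ⟨hi, mem_image_of_mem _ (mem_univ i)⟩)
      (sub_self _)
  have hsplit : ∑ i, u i * f.eval (u i ^ M) = (∑ i with u i ^ M = w, u i) * f.eval w := by
    rw [sum_mul, sum_filter]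
    refine sum_congr rfl fun i _ => ?_
    split_ifs with h
    · rw [h]
    · rw [hfw' i h, mul_zero]
  rw [hsplit] at hf
  exact (mul_eq_zero.1 hf).resolve_right hfw

end PowerSums

section Small

variable {K P ι : Type*} [Field K] [Fintype P] [Fintype ι] [DecidableEq ι] {S : AbsSystem K P}

/-- Solutions that are very close to each other satisfy one of boundedly many further linear
equations. -/
theorem exists_relations_of_very_close {T : Set (ι → K)} (hT : ∀ y ∈ T, S.IsSol y)
    (hcard : 3 ≤ Fintype.card ι) {N E : ℕ} (hN : N = (Fintype.card ι).factorial) {δ : ℝ}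
    (hδ : ∀ y ∈ T, ∀ y' ∈ T, ∀ i, ‖S.L (y i) - S.L (y' i)‖ ≤ δ * S.deg)
    (hδ' : E * (N * (2 * Fintype.card ι * δ)) < Real.log (N + 1) - Real.log N)
    (hE : S.HasNat E) (hEN : 1 + N.factorial * N ≤ E) :
    ∃ B : Finset (ι → K), B.card ≤ N ^ 2 * N.factorial ∧ (∀ b ∈ B, ∃ i j, b i ≠ b j) ∧
      ∀ y ∈ T, ∃ b ∈ B, ∑ i, b i * y i = 0 := by
  classical
  rcases T.eq_empty_or_nonempty with rfl | hTne
  · exact ⟨∅, by simp, by simp, by simp⟩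
  have hN1 : 1 ≤ N := hN ▸ Nat.one_le_iff_ne_zero.2 (Nat.factorial_ne_zero _)
  set M := N.factorial with hM
  have hM1 : 1 ≤ M := Nat.one_le_iff_ne_zero.2 (Nat.factorial_ne_zero _)
  obtain ⟨i₀⟩ : Nonempty ι := Fintype.card_pos_iff.1 (by omega)
  obtain ⟨x, hx⟩ := hTne
  rcases exists_relation_or_rows i₀ T ⟨x, hx⟩ fun y hy => (hT y hy).sum with
    ⟨b, hb, hbT⟩ | ⟨Y, hY0, hYT, hdet⟩
  · refine ⟨{b}, ?_, by simpa using hb, fun y hy => ⟨b, by simp, hbT y hy⟩⟩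
    rw [card_singleton]
    exact Nat.one_le_iff_ne_zero.2 (by positivity)
  let r : Equiv.Perm ι → K := fun σ => Equiv.Perm.sign σ • ∏ j ∈ univ.erase i₀, Y j (σ j)
  let rel : ι → ι → K → ι → K := fun i i' c => Pi.single i 1 - Pi.single i' c
  let pairs : Finset (Equiv.Perm ι × Equiv.Perm ι) := univ.filter fun s => s.1 i₀ ≠ s.2 i₀
  let B : Finset (ι → K) := pairs.biUnion fun s =>
    (Polynomial.nthRoots M ((r s.2 / r s.1) ^ M)).toFinset.image (rel (s.1 i₀) (s.2 i₀))
  refine ⟨B, ?_, ?_, ?_⟩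
  · refine card_biUnion_le.trans ((sum_le_card_nsmul _ _ M fun s _ => ?_).trans ?_)
    · exact card_image_le.trans ((Multiset.toFinset_card_le _).trans (Polynomial.card_nthRoots _ _))
    · rw [smul_eq_mul]
      gcongr
      refine (card_filter_le _ _).trans ?_
      rw [card_univ, Fintype.card_prod, Fintype.card_perm, ← hN, sq]
  · intro b hb
    obtain ⟨s, hs, hb⟩ := mem_biUnion.1 hb
    obtain ⟨c, -, rfl⟩ := mem_image.1 hb
    have hs' : s.1 i₀ ≠ s.2 i₀ := (mem_filter.1 hs).2
    obtain ⟨k, hk⟩ : ∃ k, k ∉ ({s.1 i₀, s.2 i₀} : Finset ι) := by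
      by_contra h
      push Not at h
      have : Fintype.card ι ≤ ({s.1 i₀, s.2 i₀} : Finset ι).card := by
        rw [← card_univ]; exact card_le_card fun k _ => h k
      have := this.trans (card_le_two)
      omega
    simp only [mem_insert, mem_singleton, not_or] at hk
    refine ⟨s.1 i₀, k, ?_⟩
    simp [rel, hs', hk.1, hk.2]
  · intro y hy
    let Y' : Matrix ι ι K := Y.updateRow i₀ y
    have hY'T : ∀ j, Y' j ∈ T := by
      intro j
      by_cases h : j = i₀
      · subst h; simpa [Y'] using hy
      · simpa [Y', Matrix.updateRow_ne h] using hYT j h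
    let u : Equiv.Perm ι → K := fun σ => Equiv.Perm.sign σ • ∏ j, Y' j (σ j)
    have hsm : ∀ (σ : Equiv.Perm ι) (z : K),
        Equiv.Perm.sign σ • z = z ∨ Equiv.Perm.sign σ • z = -z := by
      intro σ z
      rcases Int.units_eq_one_or (Equiv.Perm.sign σ) with h | h <;> simp [h]
    have hpu : ∀ σ : Equiv.Perm ι, S.IsSUnit (∏ j, Y' j (σ j)) := fun σ =>
      IsSUnit.prod fun j _ => (hT _ (hY'T j)).unit _
    have huu : ∀ σ, S.IsSUnit (u σ) := by
      intro σ
      rcases hsm σ (∏ j, Y' j (σ j)) with h | h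
      · simp only [u]; rw [h]; exact hpu σ
      · simp only [u]; rw [h]; exact (hpu σ).neg
    have hLu : ∀ σ, S.L (u σ) = ∑ j, S.L (Y' j (σ j)) := by
      intro σ
      have : S.L (u σ) = S.L (∏ j, Y' j (σ j)) := by
        rcases hsm σ (∏ j, Y' j (σ j)) with h | h
        · simp only [u]; rw [h]
        · simp only [u]; rw [h, L_neg]
      rw [this, L_prod _ _ fun j _ => ((hT _ (hY'T j)).unit _).1]
    have hux : ∀ σ, ‖S.L (u σ) - ∑ i, S.L (x i)‖ ≤ Fintype.card ι * (δ * S.deg) := by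
      intro σ
      rw [hLu, ← Equiv.sum_comp σ fun i => S.L (x i), ← sum_sub_distrib]
      refine (norm_sum_le _ _).trans ?_
      refine (sum_le_card_nsmul _ _ (δ * S.deg) fun j _ => hδ _ (hY'T j) _ hx _).trans ?_
      rw [nsmul_eq_mul, card_univ]
    have hclose : ∀ σ τ, ‖S.L (u σ) - S.L (u τ)‖ ≤ 2 * Fintype.card ι * δ * S.deg := by
      intro σ τ
      have h1 := hux σ
      have h2 := hux τ
      have h3 := norm_sub_le_norm_sub_add_norm_sub (S.L (u σ)) (∑ i, S.L (x i)) (S.L (u τ))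
      rw [norm_sub_rev (∑ i, S.L (x i))] at h3
      linarith
    have hsum0 : ∑ σ, u σ = 0 := by
      have h1 : Y'.det = 0 := by
        refine Matrix.exists_mulVec_eq_zero_iff.1 ⟨fun _ => 1, ?_, ?_⟩
        · intro h
          exact one_ne_zero (congrFun h i₀)
        · funext j
          simpa [Matrix.mulVec, dotProduct] using (hT _ (hY'T j)).sum
      rw [← Matrix.det_transpose, Matrix.det_apply] at h1
      exact h1
    have hclass := sum_filter_pow_eq_zero huu hsum0 (N := N)
      (by rw [Fintype.card_perm, hN]) hN1 hclose hδ' hE hEN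
    have hur : ∀ σ, u σ = y (σ i₀) * r σ := by
      intro σ
      have h1 : ∏ j, Y' j (σ j) = y (σ i₀) * ∏ j ∈ univ.erase i₀, Y j (σ j) := by
        rw [← mul_prod_erase _ _ (mem_univ i₀)]
        congr 1
        · simp [Y']
        · refine prod_congr rfl fun j hj => ?_
          simp [Y', Matrix.updateRow_ne (mem_erase.1 hj).1]
      simp only [u, r]
      rw [h1, mul_smul_comm]
    have hex : ∃ σ τ, σ i₀ ≠ τ i₀ ∧ u σ ^ M = u τ ^ M := by
      by_contra hcon
      push Not at hcon
      have h1 : ∑ σ with σ i₀ = i₀, u σ = 0 := by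
        rw [← sum_fiberwise_of_maps_to (t := (univ.filter fun σ : Equiv.Perm ι => σ i₀ = i₀).image
          fun σ => u σ ^ M) (g := fun σ => u σ ^ M) fun σ hσ => mem_image_of_mem _ hσ]
        refine sum_eq_zero fun w hw => ?_
        obtain ⟨τ, hτ, rfl⟩ := mem_image.1 hw
        rw [← hclass (u τ ^ M), filter_filter]
        refine sum_congr (filter_congr fun σ _ => ?_) fun _ _ => rfl
        refine ⟨fun h => h.2, fun h => ⟨?_, h⟩⟩
        by_contra hne
        refine hcon σ τ ?_ h
        rw [(mem_filter.1 hτ).2]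
        exact hne
      have h2 : ∑ σ with σ i₀ = i₀, u σ = y i₀ * Y.det := by
        rw [← Matrix.det_transpose, Matrix.det_apply, mul_sum, sum_filter]
        refine sum_congr rfl fun σ _ => ?_
        have h3 : ∏ j, Y.transpose (σ j) j = (if σ i₀ = i₀ then 1 else 0) *
            ∏ j ∈ univ.erase i₀, Y j (σ j) := by
          rw [← mul_prod_erase _ _ (mem_univ i₀)]
          congr 1
          rw [Matrix.transpose_apply, hY0, Pi.single_apply]
        rw [h3]
        split_ifs with h
        · rw [hur, h, one_mul]
        · simp
      rw [h2] at h1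
      exact mul_ne_zero ((hT y hy).unit i₀).1 hdet h1
    obtain ⟨σ, τ, hne, heq⟩ := hex
    have hr0 : ∀ σ, r σ ≠ 0 := fun σ h => by
      have := (huu σ).1
      rw [hur, h, mul_zero] at this
      exact this rfl
    have hy0 : y (τ i₀) ≠ 0 := ((hT y hy).unit _).1
    refine ⟨rel (σ i₀) (τ i₀) (y (σ i₀) / y (τ i₀)), ?_, ?_⟩
    · refine mem_biUnion.2 ⟨(σ, τ), by simpa [pairs] using hne, mem_image_of_mem _ ?_⟩
      rw [Multiset.mem_toFinset, Polynomial.mem_nthRoots hM1]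
      rw [hur, hur, mul_pow, mul_pow] at heq
      rw [div_pow, div_pow, div_eq_div_iff (pow_ne_zero _ hy0) (pow_ne_zero _ (hr0 _)), heq]
      ring
    · have h5 : ∀ i, rel (σ i₀) (τ i₀) (y (σ i₀) / y (τ i₀)) i * y i =
          (Pi.single (σ i₀) 1 : ι → K) i * y i -
            (Pi.single (τ i₀) (y (σ i₀) / y (τ i₀)) : ι → K) i * y i := by
        intro i; simp only [rel, Pi.sub_apply]; ring
      simp only [h5, sum_sub_distrib]
      simp [Pi.single_apply, hy0]

end Small

end AbsSystem

section Pade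

open Polynomial

/-- The cofactor polynomial of the Padé approximations to powers of `1 - X`. -/
noncomputable def padeCofactor (a b c : ℕ) : ℤ[X] :=
  ∑ k ∈ range (c + 1), C ((-1) ^ k * ((a + k).choose k * (a + b + c + 1).choose (c - k) : ℕ) : ℤ) *
    X ^ k

theorem padeCofactor_coeff (a b c k : ℕ) : (padeCofactor a b c).coeff k =
    if k ≤ c then (-1 : ℤ) ^ k * (((a + k).choose k * (a + b + c + 1).choose (c - k) : ℕ) : ℤ)
      else 0 := by
  simp only [padeCofactor, finsetSum_coeff, coeff_C_mul, coeff_X_pow]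
  simp

theorem padeCofactor_natDegree (a b c : ℕ) : (padeCofactor a b c).natDegree ≤ c := by
  rw [natDegree_le_iff_coeff_eq_zero]
  intro k hk
  rw [padeCofactor_coeff, if_neg (by omega)]

theorem abs_padeCofactor_coeff_le (a b c k : ℕ) :
    |(padeCofactor a b c).coeff k| ≤ (2 : ℤ) ^ (a + c + (a + b + c + 1)) := by
  rw [padeCofactor_coeff]
  split_ifs with h
  · rw [abs_mul, abs_pow, abs_neg, abs_one, one_pow, one_mul, Nat.abs_cast]
    have h1 : (a + k).choose k * (a + b + c + 1).choose (c - k) ≤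
        2 ^ (a + c + (a + b + c + 1)) := by
      rw [pow_add]
      refine Nat.mul_le_mul ((Nat.choose_le_two_pow _ _).trans ?_) (Nat.choose_le_two_pow _ _)
      exact Nat.pow_le_pow_right two_pos (by omega)
    exact_mod_cast h1
  · simp

theorem pade_choose_identity {a b c k : ℕ} (hk : k ≤ c) :
    a.factorial * c.factorial * ((a + k).choose k * (a + b + c + 1).choose (c - k)) *
      (a + b + 1 + k).descFactorial (b + 1) = (a + b + c + 1).factorial * c.choose k := by
  have h1 : (a + k).choose k * k.factorial * a.factorial = (a + k).factorial := by
    have := Nat.choose_mul_factorial_mul_factorial (Nat.le_add_left k a)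
    rwa [Nat.add_sub_cancel] at this
  have h2 : (a + b + c + 1).choose (c - k) * (c - k).factorial * (a + b + 1 + k).factorial =
      (a + b + c + 1).factorial := by
    have := Nat.choose_mul_factorial_mul_factorial (show c - k ≤ a + b + c + 1 by omega)
    rwa [show a + b + c + 1 - (c - k) = a + b + 1 + k by omega] at this
  have h3 : (a + k).factorial * (a + b + 1 + k).descFactorial (b + 1) =
      (a + b + 1 + k).factorial := by
    have := Nat.factorial_mul_descFactorial (show b + 1 ≤ a + b + 1 + k by omega)
    rwa [show a + b + 1 + k - (b + 1) = a + k by omega] at this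
  have h4 := Nat.choose_mul_factorial_mul_factorial hk
  have hpos : 0 < k.factorial * (c - k).factorial := by positivity
  refine Nat.eq_of_mul_eq_mul_right hpos ?_
  calc _ = c.factorial * (((a + k).choose k * k.factorial * a.factorial) *
        (a + b + 1 + k).descFactorial (b + 1)) *
        ((a + b + c + 1).choose (c - k) * (c - k).factorial) := by ring
    _ = c.factorial * ((a + b + c + 1).choose (c - k) * (c - k).factorial *
        (a + b + 1 + k).factorial) := by rw [h1, h3]; ring
    _ = (a + b + c + 1).factorial * (c.choose k * k.factorial * (c - k).factorial) := by
        rw [h2, h4]; ring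
    _ = _ := by ring

theorem iterate_derivative_padeCofactor (a b c : ℕ) :
    C ((a.factorial * c.factorial : ℕ) : ℤ) *
      derivative^[b + 1] (X ^ (a + b + 1) * padeCofactor a b c) =
    C ((a + b + c + 1).factorial : ℤ) * (X ^ a * (1 - X) ^ c) := by
  have h1 : X ^ (a + b + 1) * padeCofactor a b c = ∑ k ∈ range (c + 1),
      C ((-1) ^ k * ((a + k).choose k * (a + b + c + 1).choose (c - k) : ℕ) : ℤ) *
        X ^ (a + b + 1 + k) := by
    rw [padeCofactor, mul_sum]
    refine sum_congr rfl fun k _ => ?_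
    rw [pow_add X (a + b + 1) k]
    ring
  have h2 : ((1 - X) ^ c : ℤ[X]) = ∑ k ∈ range (c + 1), C ((-1) ^ k * (c.choose k : ℤ)) * X ^ k := by
    rw [sub_eq_neg_add, add_pow]
    refine sum_congr rfl fun k _ => ?_
    rw [neg_pow, one_pow, C_mul, C_pow, C_neg, C_1]
    simp
    ring
  rw [h1, iterate_derivative_sum, h2]
  simp only [mul_sum]
  refine sum_congr rfl fun k hk => ?_
  have hk' : k ≤ c := by simpa [Nat.lt_succ_iff] using hk
  rw [iterate_derivative_C_mul, iterate_derivative_X_pow_eq_C_mul,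
    show a + b + 1 + k - (b + 1) = a + k by omega]
  have := congrArg (fun n : ℕ => (n : ℤ)) (pade_choose_identity (a := a) (b := b) hk')
  push_cast at this
  have h5 : (((a.factorial * c.factorial : ℕ) : ℤ) *
      ((-1) ^ k * ((a + k).choose k * (a + b + c + 1).choose (c - k) : ℕ)) *
      ((a + b + 1 + k).descFactorial (b + 1) : ℕ)) =
      (a + b + c + 1).factorial * ((-1) ^ k * (c.choose k : ℤ)) := by
    push_cast
    linear_combination (-1) ^ k * this
  calc _ = C (((a.factorial * c.factorial : ℕ) : ℤ) *
      ((-1) ^ k * ((a + k).choose k * (a + b + c + 1).choose (c - k) : ℕ)) *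
      ((a + b + 1 + k).descFactorial (b + 1) : ℕ)) * X ^ (a + k) := by
        simp only [C_mul]; ring
    _ = _ := by
        rw [h5]; simp only [C_mul]; rw [pow_add]; ring

/-- The remainder polynomial of the Padé approximation. -/
noncomputable def padeRemainder (a b c : ℕ) : ℤ[X] :=
  X ^ (a + b + 1) * padeCofactor a b c +
    (-1) ^ b * (X ^ (c + b + 1) * padeCofactor c b a).comp (1 - X)

theorem padeRemainder_natDegree (a b c : ℕ) : (padeRemainder a b c).natDegree ≤ b := by
  have hder : C ((a.factorial * c.factorial : ℕ) : ℤ) *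
      derivative^[b + 1] (padeRemainder a b c) = 0 := by
    have h1 := iterate_derivative_padeCofactor a b c
    have h2 := congrArg (fun f : ℤ[X] => f.comp (1 - X)) (iterate_derivative_padeCofactor c b a)
    simp only [mul_comp, pow_comp, C_comp, X_comp, sub_comp, one_comp] at h2
    have h3 : derivative^[b + 1] ((-1) ^ b * (X ^ (c + b + 1) * padeCofactor c b a).comp (1 - X))
        = (-1) ^ b * derivative^[b + 1] ((X ^ (c + b + 1) * padeCofactor c b a).comp (1 - X)) := by
      have : ((-1) ^ b : ℤ[X]) = C ((-1) ^ b : ℤ) := by simp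
      rw [this, iterate_derivative_C_mul]
    rw [padeRemainder, iterate_map_add, h3, iterate_derivative_comp_one_sub_X, mul_add, h1]
    have h4 : ((-1 : ℤ[X]) ^ b) * ((-1) ^ (b + 1)) = -1 := by
      rw [← pow_add, show b + (b + 1) = 2 * b + 1 by ring, pow_succ, pow_mul]; simp
    have h5 : C ((a.factorial * c.factorial : ℕ) : ℤ) *
        (derivative^[b + 1] (X ^ (c + b + 1) * padeCofactor c b a)).comp (1 - X) =
        C ((a + b + c + 1).factorial : ℤ) * (X ^ a * (1 - X) ^ c) := by
      rw [mul_comm a.factorial, h2, show c + b + a + 1 = a + b + c + 1 by ring]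
      ring
    linear_combination C ((a.factorial * c.factorial : ℕ) : ℤ) *
        (derivative^[b + 1] (X ^ (c + b + 1) * padeCofactor c b a)).comp (1 - X) * h4 - h5
  have hne : C ((a.factorial * c.factorial : ℕ) : ℤ) ≠ 0 := by
    rw [C_ne_zero]
    exact_mod_cast (by positivity : 0 < a.factorial * c.factorial).ne'
  have hder' := (mul_eq_zero.1 hder).resolve_left hne
  rw [natDegree_le_iff_coeff_eq_zero]
  intro k hk
  obtain ⟨m, rfl⟩ : ∃ m, k = m + (b + 1) := ⟨k - (b + 1), by omega⟩
  have := congrArg (fun f : ℤ[X] => f.coeff m) hder'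
  simp only [coeff_iterate_derivative, coeff_zero, nsmul_eq_mul] at this
  refine (mul_eq_zero.1 this).resolve_left ?_
  exact_mod_cast (Nat.descFactorial_pos.2 (by omega)).ne'

theorem abs_padeRemainder_coeff_le (a b c k : ℕ) :
    |(padeRemainder a b c).coeff k| ≤ (a + 1) * 2 ^ (2 * (a + c + (a + b + c + 1))) := by
  rcases lt_or_ge b k with hk | hk
  · rw [coeff_eq_zero_of_natDegree_lt ((padeRemainder_natDegree a b c).trans_lt hk), abs_zero]
    positivity
  have h0 : (X ^ (a + b + 1) * padeCofactor a b c).coeff k = 0 := by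
    rw [coeff_X_pow_mul', if_neg (by omega)]
  have h1 : ((-1) ^ b * (X ^ (c + b + 1) * padeCofactor c b a).comp (1 - X) : ℤ[X]) =
      ∑ j ∈ range (a + 1), C ((-1) ^ b * (padeCofactor c b a).coeff j) *
        (1 - X) ^ (c + b + 1 + j) := by
    rw [mul_comp, pow_comp, X_comp, comp, eval₂_eq_sum_range' _
      (Nat.lt_succ_of_le (padeCofactor_natDegree c b a)), mul_sum, mul_sum]
    refine sum_congr rfl fun j _ => ?_
    simp only [C_mul, C_pow, C_neg, C_1]
    ring
  have h2 : ∀ n, |((1 - X) ^ n : ℤ[X]).coeff k| ≤ 2 ^ n := by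
    intro n
    have h3 : ((1 - X) ^ n : ℤ[X]) = C ((-1) ^ n) * (X + C (-1)) ^ n := by
      rw [C_pow, ← mul_pow]; congr 1; simp [sub_eq_add_neg]
    rw [h3, coeff_C_mul, coeff_X_add_C_pow, abs_mul, abs_mul, abs_pow, abs_pow]
    simp only [abs_neg, abs_one, one_pow, one_mul]
    rw [Nat.abs_cast]
    exact_mod_cast Nat.choose_le_two_pow n k
  rw [padeRemainder, coeff_add, h0, zero_add, h1, finsetSum_coeff]
  refine (abs_sum_le_sum_abs _ _).trans ((sum_le_card_nsmul _ _
    (2 ^ (2 * (a + c + (a + b + c + 1)))) fun j hj => ?_).trans ?_)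
  · have hj' : j ≤ a := by simpa [Nat.lt_succ_iff] using hj
    rw [coeff_C_mul, abs_mul, abs_mul, abs_pow, abs_neg, abs_one, one_pow, one_mul]
    have h6 := abs_padeCofactor_coeff_le c b a j
    rw [show c + a + (c + b + a + 1) = a + c + (a + b + c + 1) by ring] at h6
    have h7 := (h2 (c + b + 1 + j)).trans (pow_le_pow_right₀ (by norm_num : (1 : ℤ) ≤ 2)
      (show c + b + 1 + j ≤ a + c + (a + b + c + 1) by omega))
    exact (mul_le_mul h6 h7 (abs_nonneg _) (by positivity)).trans_eq (by rw [← pow_add, ← two_mul])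
  · rw [card_range, nsmul_eq_mul]
    push_cast
    exact le_rfl

theorem padeCofactor_eval_one (a b c : ℕ) :
    (padeCofactor a b c).eval 1 = ((b + c).choose c : ℕ) := by
  have h1 : (padeCofactor a b c).eval 1 = ∑ ij ∈ antidiagonal c,
      Ring.choose (-(a + 1 : ℤ)) ij.1 * Ring.choose ((a + b + c + 1 : ℕ) : ℤ) ij.2 := by
    rw [Nat.sum_antidiagonal_eq_sum_range_succ_mk, padeCofactor, eval_finsetSum]
    refine sum_congr rfl fun k _ => ?_
    simp only [eval_mul, eval_C, eval_pow, eval_X, one_pow, mul_one]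
    rw [Ring.choose_neg, Ring.choose_natCast,
      show ((a : ℤ) + 1 + k - 1) = ((a + k : ℕ) : ℤ) by push_cast; ring, Ring.choose_natCast,
      Int.negOnePow_def, Units.smul_def, smul_eq_mul]
    push_cast
    simp
    ring
  rw [h1, ← Ring.add_choose_eq _ (Commute.all _ _),
    show (-(a + 1 : ℤ) + ((a + b + c + 1 : ℕ) : ℤ)) = ((b + c : ℕ) : ℤ) by push_cast; ring,
    Ring.choose_natCast]

/-- Two independent families of Padé approximations with controlled degrees and coefficients. -/
theorem exists_pade (N : ℕ) : ∃ A B R : Bool → ℤ[X],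
    (∀ i, (A i).natDegree ≤ N + 1 ∧ (B i).natDegree ≤ N + 1 ∧ (R i).natDegree ≤ N + 1) ∧
    (∀ i k, |(A i).coeff k| ≤ 2 ^ (12 * (N + 1)) ∧ |(B i).coeff k| ≤ 2 ^ (12 * (N + 1)) ∧
      |(R i).coeff k| ≤ 2 ^ (12 * (N + 1))) ∧
    (∀ i, X ^ (2 * N + 1) * A i + (1 - X) ^ (2 * N + 1) * (B i).comp (1 - X) = R i) ∧
    ∃ κ : ℤ, κ ≠ 0 ∧ A false * R true - A true * R false = C κ * (1 - X) ^ (2 * N + 1) := by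
  let A : Bool → ℤ[X] := fun i => if i then X * padeCofactor (N + 1) N N else padeCofactor N N N
  let B : Bool → ℤ[X] := fun i =>
    (-1) ^ N * if i then padeCofactor N N (N + 1) else padeCofactor N N N
  let R : Bool → ℤ[X] := fun i => if i then padeRemainder (N + 1) N N else padeRemainder N N N
  have hpow : ∀ e, e ≤ 12 * (N + 1) → (2 : ℤ) ^ e ≤ 2 ^ (12 * (N + 1)) := fun e he =>
    pow_le_pow_right₀ (by norm_num) he
  have hA : ∀ i, (A i).natDegree ≤ N + 1 := by
    rintro (_ | _)
    · exact (padeCofactor_natDegree N N N).trans (Nat.le_succ N)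
    · refine natDegree_mul_le.trans ?_
      rw [natDegree_X, add_comm]
      exact Nat.add_le_add_right (padeCofactor_natDegree (N + 1) N N) 1
  have hC : ∀ f : ℤ[X], (-1) ^ N * f = C ((-1) ^ N) * f := fun f => by simp
  have hR : ∀ i, (R i).natDegree ≤ N := by
    rintro (_ | _)
    · exact padeRemainder_natDegree N N N
    · exact padeRemainder_natDegree (N + 1) N N
  have hid : ∀ i, X ^ (2 * N + 1) * A i + (1 - X) ^ (2 * N + 1) * (B i).comp (1 - X) = R i := by
    have e1 : N + N + 1 = 2 * N + 1 := by ring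
    have e2 : N + 1 + N + 1 = 2 * N + 1 + 1 := by ring
    have e3 : ((-1) ^ N : ℤ[X]).comp (1 - X) = (-1) ^ N := by simp
    rintro (_ | _)
    · simp only [A, B, R, padeRemainder, if_false, Bool.false_eq_true, mul_comp, e1, e3,
        pow_comp, X_comp]
      ring
    · simp only [A, B, R, padeRemainder, if_true, mul_comp, e1, e2, e3, pow_comp, X_comp]
      ring
  refine ⟨A, B, R, fun i => ⟨hA i, ?_, (hR i).trans (Nat.le_succ N)⟩, fun i k => ⟨?_, ?_, ?_⟩, hid, ?_⟩
  · simp only [B, hC]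
    refine (natDegree_C_mul_le _ _).trans ?_
    split_ifs
    · exact padeCofactor_natDegree _ _ _
    · exact (padeCofactor_natDegree _ _ _).trans (Nat.le_succ N)
  · cases i
    · exact (abs_padeCofactor_coeff_le N N N k).trans (hpow _ (by omega))
    · cases k with
      | zero => simp [A]
      | succ k =>
        simp only [A, if_true, coeff_X_mul]
        exact (abs_padeCofactor_coeff_le (N + 1) N N k).trans (hpow _ (by omega))
  · simp only [B, hC, coeff_C_mul, abs_mul, abs_pow, abs_neg, abs_one, one_pow, one_mul]
    cases i
    · exact (abs_padeCofactor_coeff_le N N N k).trans (hpow _ (by omega))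
    · exact (abs_padeCofactor_coeff_le N N (N + 1) k).trans (hpow _ (by omega))
  · have hlin : ∀ n : ℕ, (n : ℤ) + 1 ≤ 2 ^ n := fun n => by exact_mod_cast Nat.lt_two_pow_self
    cases i
    · refine (abs_padeRemainder_coeff_le N N N k).trans ?_
      calc ((N : ℤ) + 1) * 2 ^ (2 * (N + N + (N + N + N + 1)))
          ≤ 2 ^ N * 2 ^ (2 * (N + N + (N + N + N + 1))) := by
            have := hlin N
            gcongr
        _ ≤ _ := by rw [← pow_add]; exact hpow _ (by omega)
    · refine (abs_padeRemainder_coeff_le (N + 1) N N k).trans ?_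
      calc (((N + 1 : ℕ) : ℤ) + 1) * 2 ^ (2 * (N + 1 + N + (N + 1 + N + N + 1)))
          ≤ 2 ^ (N + 1) * 2 ^ (2 * (N + 1 + N + (N + 1 + N + N + 1))) := by
            have := hlin (N + 1)
            gcongr
        _ ≤ _ := by rw [← pow_add]; exact hpow _ (by omega)
  · set G : ℤ[X] := A false * (B true).comp (1 - X) - A true * (B false).comp (1 - X) with hG
    have h1 : A false * R true - A true * R false = G * (1 - X) ^ (2 * N + 1) := by
      rw [← hid true, ← hid false, hG]; ring
    have hne : A false * R true - A true * R false ≠ 0 := by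
      intro h
      have h0 := congrArg (eval 0) h
      have hA0 : (A false).eval 0 ≠ 0 := by
        simp only [A, Bool.false_eq_true, if_false, ← coeff_zero_eq_eval_zero, padeCofactor_coeff]
        simp only [zero_le, if_true, pow_zero, one_mul, Nat.cast_ne_zero]
        simp only [add_zero, Nat.choose_zero_right, one_mul, Nat.sub_zero]
        exact (Nat.choose_pos (by omega)).ne'
      have hA1 : (A true).eval 0 = 0 := by simp [A]
      have hR0 : (R true).eval 0 ≠ 0 := by
        simp only [R, if_true, padeRemainder, eval_add, eval_mul, eval_comp, eval_pow, eval_X,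
          eval_sub, eval_one, sub_zero, padeCofactor_eval_one]
        simp only [ne_eq, Nat.add_eq_zero_iff, one_ne_zero, and_false, not_false_eq_true, zero_pow,
          zero_mul, zero_add, one_pow, one_mul, eval_neg, eval_one]
        refine mul_ne_zero (pow_ne_zero _ (by norm_num)) ?_
        exact_mod_cast (Nat.choose_pos (by omega)).ne'
      rw [eval_sub, eval_mul, eval_mul, hA1, zero_mul, sub_zero, eval_zero] at h0
      exact mul_ne_zero hA0 hR0 h0
    have h1X : (1 - X : ℤ[X]).natDegree = 1 := by
      rw [← natDegree_neg, neg_sub, ← C_1, natDegree_X_sub_C]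
    have hG0 : G ≠ 0 := by
      rintro h
      exact hne (by rw [h1, h, zero_mul])
    have h1X0 : (1 - X : ℤ[X]) ≠ 0 := by
      intro h
      rw [h] at h1X
      simp at h1X
    have hdeg : (A false * R true - A true * R false).natDegree ≤ 2 * N + 1 := by
      refine (natDegree_sub_le _ _).trans (max_le ?_ ?_) <;>
      · refine natDegree_mul_le.trans ?_
        have := hA false
        have := hA true
        have := hR true
        have := hR false
        omega
    rw [h1, natDegree_mul hG0 (pow_ne_zero _ h1X0), natDegree_pow, h1X] at hdeg
    have hG1 : G = C (G.coeff 0) := eq_C_of_natDegree_eq_zero (by omega)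
    refine ⟨G.coeff 0, fun h => hG0 (by rw [hG1, h, C_0]), ?_⟩
    rw [h1, ← hG1]

end Pade

namespace AbsSystem

section Thue

open Polynomial

variable {K P : Type*} [Field K] [Fintype P] {S : AbsSystem K P}

theorem archConst_add (c d : ℝ) (p : P) :
    S.archConst c p + S.archConst d p = S.archConst (c + d) p := by
  unfold archConst
  split_ifs <;> simp

theorem v_sub_le {x y : K} {p : P} {M : ℝ} (hx : S.v p x ≤ Real.exp M) (hy : S.v p y ≤ Real.exp M) :
    S.v p (x - y) ≤ Real.exp (S.archConst (Real.log 2) p + M) := by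
  have := v_sum_le (S := S) (s := univ) ![x, -y] p (M := M) (N := 2)
    (by simp [Fin.forall_fin_two, hx, hy]) (by simp) (by norm_num)
  simpa [Fin.sum_univ_two, ← sub_eq_add_neg] using this

theorem v_aeval_le {f : ℤ[X]} {d : ℕ} (hd : f.natDegree ≤ d) {R : ℝ} (hR1 : 1 ≤ R)
    (hR : ∀ k, |(f.coeff k : ℝ)| ≤ R) {x : K} {p : P} {μ : ℝ} (hμ : 0 ≤ μ)
    (hx : S.v p x ≤ Real.exp μ) :
    S.v p (aeval x f) ≤ Real.exp (S.archConst (Real.log ((d + 1) * R)) p + d * μ) := by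
  rw [aeval_eq_sum_range' (Nat.lt_succ_of_le hd), Real.log_mul (by positivity) (by positivity),
    ← archConst_add, add_assoc]
  refine v_sum_le _ p (fun k hk => ?_) (by simp) (by linarith [(Nat.cast_nonneg d : (0 : ℝ) ≤ d)])
  have hk' : (k : ℝ) ≤ d := by
    have : k ≤ d := by simpa [Nat.lt_succ_iff] using hk
    exact_mod_cast this
  rw [zsmul_eq_mul, map_mul, map_pow, Real.exp_add]
  refine mul_le_mul (v_intCast_le p hR1 (hR k)) ?_ (by positivity) (by positivity)
  calc S.v p x ^ k ≤ Real.exp μ ^ k := by gcongr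
    _ = Real.exp (k * μ) := by rw [Real.exp_nat_mul]
    _ ≤ _ := by gcongr

theorem aeval_mem_integers (f : ℤ[X]) {x : K} (hx : x ∈ S.integers) : aeval x f ∈ S.integers := by
  rw [aeval_eq_sum_range]
  exact sum_mem fun k _ => zsmul_mem (pow_mem hx k) _

/-- Two solutions of the unit equation cannot lie in a common narrow cone unless their heights are
comparable or small. -/
theorem false_of_cone [CharZero K] {t s : K} (ht : S.IsSUnit t) (ht' : S.IsSUnit (1 - t))
    (hs : S.IsSUnit s) (hs' : S.IsSUnit (1 - s)) {T lam : ℝ} (hT : 1000 * S.deg ≤ T)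
    (hlam : 100 ≤ lam) (htT : T ≤ ‖S.L t‖ ∨ T ≤ ‖S.L (1 - t)‖) (htT1 : ‖S.L t‖ ≤ T)
    (htT2 : ‖S.L (1 - t)‖ ≤ T) (h1 : ‖S.L s - lam • S.L t‖ ≤ lam * T / 20)
    (h2 : ‖S.L (1 - s) - lam • S.L (1 - t)‖ ≤ lam * T / 20) : False := by
  set N : ℕ := ⌊(lam - 1) / 2⌋₊ with hN
  have hN1 : (N : ℝ) ≤ (lam - 1) / 2 := Nat.floor_le (by linarith)
  have hN2 : (lam - 1) / 2 < N + 1 := Nat.lt_floor_add_one _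
  set m := 2 * N + 1 with hm
  have hmR : (m : ℝ) = 2 * N + 1 := by rw [hm]; push_cast; ring
  have hD := S.one_le_deg
  have hT0 : 0 < T := by linarith
  obtain ⟨A, B, R, hdeg, hcoeff, hid, κ, hκ, hdet⟩ := exists_pade N
  have ht0 := ht.1
  have ht0' := ht'.1
  obtain ⟨i, hi⟩ : ∃ i, s * aeval t (R i) - t ^ m * aeval t (A i) ≠ 0 := by
    by_contra! h
    have e1 := h false
    have e2 := h true
    have e3 := congrArg (aeval t) hdet
    simp only [map_mul, map_sub, map_pow, aeval_C, aeval_X, map_one] at e3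
    have e4 : s * ((algebraMap ℤ K κ) * (1 - t) ^ m) = 0 := by
      rw [← e3]
      linear_combination aeval t (A false) * e2 - aeval t (A true) * e1
    refine mul_ne_zero hs.1 (mul_ne_zero ?_ (pow_ne_zero _ ht0')) e4
    simpa using hκ
  set z := s * aeval t (R i) - t ^ m * aeval t (A i) with hz
  have hid' : t ^ m * aeval t (A i) + (1 - t) ^ m * aeval (1 - t) (B i) = aeval t (R i) := by
    have := congrArg (aeval t) (hid i)
    simpa [aeval_comp] using this
  set w := s / t ^ m with hw
  set w' := (1 - s) / (1 - t) ^ m with hw'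
  have hws : s = t ^ m * w := by rw [hw]; field_simp
  have hws' : 1 - s = (1 - t) ^ m * w' := by rw [hw']; field_simp
  have hz1 : z = t ^ m * w * aeval t (R i) - t ^ m * aeval t (A i) := by rw [hz, ← hws]
  have hz2 : z = (1 - t) ^ m * aeval (1 - t) (B i) - (1 - t) ^ m * w' * aeval t (R i) := by
    rw [hz, ← hws']; linear_combination - hid'
  have hz3 : z = t ^ m * w * ((1 - t) ^ m * aeval (1 - t) (B i)) -
      (1 - t) ^ m * w' * (t ^ m * aeval t (A i)) := by
    rw [hz, ← hws', ← hws]; linear_combination - s * hid'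
  have hzint : z ∈ S.integers := by
    refine sub_mem (mul_mem hs.2.1 (aeval_mem_integers _ ht.2.1))
      (mul_mem (pow_mem ht.2.1 m) (aeval_mem_integers _ ht.2.1))
  have hw0 : w ≠ 0 := div_ne_zero hs.1 (pow_ne_zero _ ht0)
  have hw0' : w' ≠ 0 := div_ne_zero hs'.1 (pow_ne_zero _ ht0')
  set μ : P → ℝ := fun p => max 0 (max (S.L t p) (S.L (1 - t) p)) with hμ
  set ω : P → ℝ := fun p => max 0 (max (S.L w p) (S.L w' p)) with hω
  set c : ℝ := Real.log (((N + 1 : ℕ) + 1) * 2 ^ (12 * (N + 1))) with hc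
  have hpow1 : (1 : ℝ) ≤ 2 ^ (12 * (N + 1)) := one_le_pow₀ (by norm_num)
  have hcast : ∀ {q : ℤ}, |q| ≤ 2 ^ (12 * (N + 1)) → |(q : ℝ)| ≤ 2 ^ (12 * (N + 1)) := by
    intro q hq
    exact_mod_cast hq
  have hμ0 : ∀ p, 0 ≤ μ p := fun p => le_max_left _ _
  have hω0 : ∀ p, 0 ≤ ω p := fun p => le_max_left _ _
  have hbt : ∀ p, S.v p t ≤ Real.exp (μ p) := fun p => by
    rw [← exp_L ht0]
    exact Real.exp_le_exp.2 ((le_max_left _ _).trans (le_max_right _ _))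
  have hbt' : ∀ p, S.v p (1 - t) ≤ Real.exp (μ p) := fun p => by
    rw [← exp_L ht0']
    exact Real.exp_le_exp.2 ((le_max_right _ _).trans (le_max_right _ _))
  have hbw : ∀ p, S.v p w ≤ Real.exp (ω p) := fun p => by
    rw [← exp_L hw0]
    exact Real.exp_le_exp.2 ((le_max_left _ _).trans (le_max_right _ _))
  have hbw' : ∀ p, S.v p w' ≤ Real.exp (ω p) := fun p => by
    rw [← exp_L hw0']
    exact Real.exp_le_exp.2 ((le_max_right _ _).trans (le_max_right _ _))
  have hpt : ∀ p, S.v p (t ^ m) = Real.exp (m * S.L t p) := fun p => by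
    rw [map_pow, ← exp_L ht0, Real.exp_nat_mul]
  have hpt' : ∀ p, S.v p ((1 - t) ^ m) = Real.exp (m * S.L (1 - t) p) := fun p => by
    rw [map_pow, ← exp_L ht0', Real.exp_nat_mul]
  set e : P → ℝ := fun p => S.archConst c p + (N + 1 : ℕ) * μ p with he
  have hbR : ∀ p, S.v p (aeval t (R i)) ≤ Real.exp (e p) := fun p =>
    v_aeval_le (hdeg i).2.2 hpow1 (fun k => hcast (hcoeff i k).2.2) (hμ0 p) (hbt p)
  have hbA : ∀ p, S.v p (aeval t (A i)) ≤ Real.exp (e p) := fun p =>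
    v_aeval_le (hdeg i).1 hpow1 (fun k => hcast (hcoeff i k).1) (hμ0 p) (hbt p)
  have hbB : ∀ p, S.v p (aeval (1 - t) (B i)) ≤ Real.exp (e p) := fun p =>
    v_aeval_le (hdeg i).2.1 hpow1 (fun k => hcast (hcoeff i k).2.1) (hμ0 p) (hbt' p)
  have hbe : ∀ p, Real.exp (e p) ≤ Real.exp (ω p + e p) := fun p =>
    Real.exp_le_exp.2 (by linarith [hω0 p])
  have hmul : ∀ {p : P} {x y : K} {a b : ℝ}, S.v p x ≤ Real.exp a → S.v p y ≤ Real.exp b →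
      S.v p (x * y) ≤ Real.exp (a + b) := by
    intro p x y a b hx hy
    rw [map_mul, Real.exp_add]
    exact mul_le_mul hx hy ((S.v p).nonneg _) (Real.exp_pos _).le
  have hfin : ∀ p, S.v p z ≤ Real.exp (S.archConst (Real.log 2) p +
      (ω p + e p + m * (S.L t p + S.L (1 - t) p - μ p))) := by
    intro p
    have hcase : μ p = 0 ∨ μ p = S.L t p ∨ μ p = S.L (1 - t) p := by
      simp only [hμ]
      rcases max_cases 0 (max (S.L t p) (S.L (1 - t) p)) with h | h
      · exact Or.inl h.1
      · rcases max_cases (S.L t p) (S.L (1 - t) p) with h' | h'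
        · exact Or.inr (Or.inl (h.1.trans h'.1))
        · exact Or.inr (Or.inr (h.1.trans h'.1))
    rcases hcase with h | h | h
    · rw [hz3, h]
      refine v_sub_le ?_ ?_
      · refine (hmul (hmul (hpt p).le (hbw p)) (hmul (hpt' p).le (hbB p))).trans_eq ?_
        congr 1; ring
      · refine (hmul (hmul (hpt' p).le (hbw' p)) (hmul (hpt p).le (hbA p))).trans_eq ?_
        congr 1; ring
    · rw [hz2, h]
      refine v_sub_le ?_ ?_
      · refine (hmul (hpt' p).le ((hbB p).trans (hbe p))).trans_eq ?_
        congr 1; ring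
      · refine (hmul (hmul (hpt' p).le (hbw' p)) (hbR p)).trans_eq ?_
        congr 1; ring
    · rw [hz1, h]
      refine v_sub_le ?_ ?_
      · refine (hmul (hmul (hpt p).le (hbw p)) (hbR p)).trans_eq ?_
        congr 1; ring
      · refine (hmul (hpt p).le ((hbA p).trans (hbe p))).trans_eq ?_
        congr 1; ring
  have hmain := nonneg_of_v_le hzint hi _ hfin
  simp only [he, sum_add_distrib, ← mul_sum, sum_sub_distrib, sum_archConst, ht.sum_L,
    ht'.sum_L] at hmain
  set H := ∑ p, μ p with hH
  have hHT : T ≤ 2 * H := by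
    have hpart : ∀ {x : K}, S.IsSUnit x → (∀ p, max 0 (S.L x p) ≤ μ p) → ‖S.L x‖ ≤ 2 * H := by
      intro x hx hle
      have := sum_max (S := S) IsSUnit.one hx
      rw [L_one, zero_sub, norm_neg] at this
      have h3 : ∑ p, max ((0 : PiLp 1 fun _ : P => ℝ) p) (S.L x p) ≤ H := sum_le_sum fun p _ => hle p
      linarith
    rcases htT with h | h
    · exact h.trans (hpart ht fun p => max_le_max le_rfl (le_max_left _ _))
    · exact h.trans (hpart ht' fun p => max_le_max le_rfl (le_max_right _ _))
  have hωsum : ∑ p, ω p ≤ ‖S.L w‖ + ‖S.L w'‖ := by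
    rw [norm_eq_sum, norm_eq_sum, ← sum_add_distrib]
    refine sum_le_sum fun p _ => max_le (by positivity) (max_le ?_ ?_)
    · exact (le_abs_self _).trans (le_add_of_nonneg_right (abs_nonneg _))
    · exact (le_abs_self _).trans (le_add_of_nonneg_left (abs_nonneg _))
  have hmlam : |lam - m| ≤ 2 := by rw [hmR, abs_le]; constructor <;> linarith
  have hclose : ∀ {x y : K}, x ≠ 0 → y ≠ 0 → ‖S.L y‖ ≤ T → ‖S.L x - lam • S.L y‖ ≤ lam * T / 20 →
      ‖S.L (x / y ^ m)‖ ≤ lam * T / 20 + 2 * T := by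
    intro x y hx hy hyT hxy
    rw [L_div hx (pow_ne_zero _ hy), L_pow]
    have e5 : S.L x - (m : ℝ) • S.L y = (S.L x - lam • S.L y) + (lam - m) • S.L y := by
      rw [sub_smul]; abel
    rw [e5]
    refine (norm_add_le _ _).trans (add_le_add hxy ?_)
    rw [norm_smul, Real.norm_eq_abs]
    calc |lam - m| * ‖S.L y‖ ≤ 2 * ‖S.L y‖ := by gcongr
      _ ≤ 2 * T := by linarith
  have hw1 := hclose hs.1 ht0 htT1 h1
  have hw2 := hclose hs'.1 ht0' htT2 h2
  have hclog : Real.log 2 + c ≤ 11 * (N + 1) := by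
    have hl2 := Real.log_two_lt_d9
    have hl2' := Real.log_two_gt_d9
    rw [hc, Real.log_mul (by positivity) (by positivity), Real.log_pow]
    have := Real.log_le_sub_one_of_pos (show (0 : ℝ) < (N + 1 : ℕ) + 1 by positivity)
    push_cast at this ⊢
    have hN0 : (0 : ℝ) ≤ N := N.cast_nonneg
    nlinarith
  have hDc : S.deg * (Real.log 2 + c) ≤ T / 1000 * (11 * (N + 1)) := by
    refine mul_le_mul (by linarith) hclog ?_ (by positivity)
    have := Real.log_two_gt_d9
    have : 0 ≤ c := Real.log_nonneg (by push_cast; nlinarith [(Nat.cast_nonneg N : (0 : ℝ) ≤ N)])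
    linarith
  rw [hmR] at hmain
  push_cast at hmain
  have hNH : N * H ≤ T / 1000 * (11 * (N + 1)) + 2 * (lam * T / 20 + 2 * T) := by
    nlinarith
  have hNH2 : (N : ℝ) * (T / 2) ≤ N * H := mul_le_mul_of_nonneg_left (by linarith) N.cast_nonneg
  nlinarith [mul_le_mul_of_nonneg_right hN1 hT0.le, mul_lt_mul_of_pos_right hN2 hT0,
    mul_le_mul_of_nonneg_right hlam hT0.le]

end Thue

end AbsSystem

section Cover

/-- A set of points in a ball of a finite dimensional space is bounded in terms of the number of
points close to each other. -/
theorem card_le_of_norm_sub_le {E α : Type*} [NormedAddCommGroup E] [NormedSpace ℝ E]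
    [FiniteDimensional ℝ E] {η : ℝ} (hη : 0 < η) (f : α → E) {B : ℕ} (j : ℕ) (x₀ : E)
    (T : Finset α) (hT : ∀ x ∈ T, ‖f x - x₀‖ ≤ 2 ^ j * η)
    (hB : ∀ T' ⊆ T, (∀ x ∈ T', ∀ y ∈ T', ‖f x - f y‖ ≤ 2 * η) → T'.card ≤ B) :
    T.card ≤ (5 ^ Module.finrank ℝ E) ^ j * B := by
  classical
  induction j generalizing x₀ T with
  | zero =>
    simp only [pow_zero, one_mul] at hT ⊢
    refine hB T (Subset.refl T) fun x hx y hy => ?_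
    have : f x - f y = (f x - x₀) - (f y - x₀) := by abel
    rw [this]
    linarith [norm_sub_le (f x - x₀) (f y - x₀), hT x hx, hT y hy]
  | succ j ih =>
    set r := 2 ^ j * η with hr
    have hr0 : 0 < r := by positivity
    let sep : Finset (Finset α) := T.powerset.filter fun s => ∀ x ∈ s, ∀ y ∈ s, x ≠ y → r ≤ ‖f x - f y‖
    obtain ⟨s, hs, hmax⟩ := exists_max_image sep card ⟨∅, by simp [sep]⟩
    obtain ⟨hsT, hsep⟩ : s ⊆ T ∧ ∀ x ∈ s, ∀ y ∈ s, x ≠ y → r ≤ ‖f x - f y‖ := by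
      simpa [sep] using hs
    have hcov : ∀ x ∈ T, ∃ c ∈ s, ‖f x - f c‖ ≤ r := by
      intro x hx
      by_contra! hcon
      have hxs : x ∉ s := fun hxs => by
        have := hcon x hxs
        simp at this
        linarith
      have hmem : insert x s ∈ sep := by
        simp only [sep, mem_filter, mem_powerset]
        refine ⟨insert_subset hx hsT, fun y hy z hz hyz => ?_⟩
        rcases mem_insert.1 hy with rfl | hy'
        · rcases mem_insert.1 hz with rfl | hz'
          · exact absurd rfl hyz
          · exact (hcon z hz').le
        · rcases mem_insert.1 hz with rfl | hz'
          · rw [norm_sub_rev]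
            exact (hcon y hy').le
          · exact hsep y hy' z hz' hyz
      have := hmax _ hmem
      rw [card_insert_of_notMem hxs] at this
      omega
    have hnorm : ∀ x y, ‖r⁻¹ • (f x - x₀) - r⁻¹ • (f y - x₀)‖ = r⁻¹ * ‖f x - f y‖ := by
      intro x y
      rw [← smul_sub, sub_sub_sub_cancel_right, norm_smul, norm_inv, Real.norm_of_nonneg hr0.le]
    have hinj : Set.InjOn (fun x => r⁻¹ • (f x - x₀)) s := by
      intro x hx y hy hxy
      by_contra hne
      have h1 := hnorm x y
      simp only at hxy
      rw [hxy, sub_self, norm_zero] at h1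
      have h2 := hsep x hx y hy hne
      have : 0 < r⁻¹ * ‖f x - f y‖ := mul_pos (inv_pos.2 hr0) (hr0.trans_le h2)
      linarith
    have hscard : s.card ≤ 5 ^ Module.finrank ℝ E := by
      rw [← card_image_of_injOn hinj]
      refine Besicovitch.card_le_of_separated _ ?_ ?_
      · intro c hc
        obtain ⟨x, hx, rfl⟩ := mem_image.1 hc
        rw [norm_smul, norm_inv, Real.norm_of_nonneg hr0.le, inv_mul_le_iff₀ hr0]
        have := hT x (hsT hx)
        rw [pow_succ] at this
        linarith
      · intro c hc d hd hcd
        obtain ⟨x, hx, rfl⟩ := mem_image.1 hc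
        obtain ⟨y, hy, rfl⟩ := mem_image.1 hd
        rw [hnorm, le_inv_mul_iff₀ hr0, mul_one]
        exact hsep x hx y hy fun h => hcd (by rw [h])
    have hsub : T ⊆ s.biUnion fun c => T.filter fun x => ‖f x - f c‖ ≤ r := by
      intro x hx
      obtain ⟨c, hc, hxc⟩ := hcov x hx
      exact mem_biUnion.2 ⟨c, hc, mem_filter.2 ⟨hx, hxc⟩⟩
    calc T.card ≤ s.card * ((5 ^ Module.finrank ℝ E) ^ j * B) := by
          refine (card_le_card hsub).trans (card_biUnion_le_card_mul _ _ _ fun c _ => ?_)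
          refine ih (f c) _ (fun x hx => (mem_filter.1 hx).2) fun T' hT' h => ?_
          exact hB T' (hT'.trans (filter_subset _ _)) h
      _ ≤ 5 ^ Module.finrank ℝ E * ((5 ^ Module.finrank ℝ E) ^ j * B) := by gcongr
      _ = _ := by ring

/-- A set of families of vectors in a ball is bounded in terms of the number of families close to
each other. -/
theorem card_le_of_forall_norm_sub_le {E α ι : Type*} [Fintype ι] [NormedAddCommGroup E]
    [NormedSpace ℝ E] {V : Submodule ℝ E} [FiniteDimensional ℝ V] {ρ : ℕ}
    (hV : Module.finrank ℝ V ≤ ρ) {η : ℝ} (hη : 0 < η) (g : α → ι → E) {g₀ : ι → E}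
    (hg₀ : ∀ i, g₀ i ∈ V) {T : Finset α} (hgV : ∀ x ∈ T, ∀ i, g x i ∈ V) (j : ℕ)
    (hT : ∀ x ∈ T, ∀ i, ‖g x i - g₀ i‖ ≤ 2 ^ j * η) {B : ℕ}
    (hB : ∀ T' ⊆ T, (∀ x ∈ T', ∀ y ∈ T', ∀ i, ‖g x i - g y i‖ ≤ 2 * η) → T'.card ≤ B) :
    T.card ≤ (5 ^ (Fintype.card ι * j)) ^ ρ * B := by
  classical
  let f : α → ι → V := fun x i => if h : g x i ∈ V then ⟨g x i, h⟩ else 0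
  have hf : ∀ x ∈ T, ∀ i, ((f x i : V) : E) = g x i := fun x hx i => by
    simp only [f, dif_pos (hgV x hx i)]
  have h1 := card_le_of_norm_sub_le hη f (B := B) j (fun i => ⟨g₀ i, hg₀ i⟩) T ?_ ?_
  · refine h1.trans (Nat.mul_le_mul_right _ ?_)
    rw [← pow_mul, ← pow_mul]
    refine Nat.pow_le_pow_right (by norm_num) ?_
    rw [Module.finrank_pi_fintype, sum_const, card_univ, smul_eq_mul]
    calc Fintype.card ι * Module.finrank ℝ V * j ≤ Fintype.card ι * ρ * j := by gcongr
      _ = _ := by ring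
  · intro x hx
    refine (pi_norm_le_iff_of_nonneg (by positivity)).2 fun i => ?_
    rw [Submodule.coe_norm]
    simpa [hf x hx i] using hT x hx i
  · intro T' hT' h
    refine hB T' hT' fun x hx y hy i => ?_
    have := (norm_le_pi_norm (f x - f y) i).trans (h x hx y hy)
    rw [Submodule.coe_norm] at this
    simpa [hf x (hT' hx) i, hf y (hT' hy) i] using this

end Cover

section Rank

variable {K : Type*} [Field K]

/-- The elements of `A` are, up to finite index, contained in a group of rank at most `ρ`. -/
def RankLE (A : Set K) (ρ : ℕ) : Prop :=
  ∃ s : Finset K, s.card ≤ ρ ∧ (∀ g ∈ s, g ≠ 0) ∧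
    ∀ x ∈ A, ∃ N : ℕ, N ≠ 0 ∧ ∃ e : K → ℤ, x ^ N = ∏ g ∈ s, g ^ e g

namespace RankLE

variable {A B : Set K} {ρ ρ' : ℕ}

theorem mono (h : RankLE A ρ) (hBA : B ⊆ A) (hρ : ρ ≤ ρ') : RankLE B ρ' := by
  obtain ⟨s, hs, hs0, h⟩ := h
  exact ⟨s, hs.trans hρ, hs0, fun x hx => h x (hBA hx)⟩

/-- Products of the given elements and finitely many further elements. -/
theorem mul_finset (h : RankLE A ρ) (c : Finset K) (hc : ∀ g ∈ c, g ≠ 0)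
    (hB : ∀ y ∈ B, y ∈ c ∨ y ∈ A ∨ ∃ g ∈ c, ∃ x ∈ A, y = g * x) : RankLE B (ρ + c.card) := by
  classical
  obtain ⟨s, hs, hs0, h⟩ := h
  refine ⟨s ∪ c, (card_union_le _ _).trans (Nat.add_le_add_right hs _), fun g hg => ?_,
    fun y hy => ?_⟩
  · rcases mem_union.1 hg with hg | hg
    exacts [hs0 g hg, hc g hg]
  have hne : ∀ g ∈ s ∪ c, g ≠ 0 := fun g hg => (mem_union.1 hg).elim (hs0 g) (hc g)
  have key1 : ∀ e : K → ℤ, ∏ g ∈ s, g ^ e g = ∏ g ∈ s ∪ c, g ^ (if g ∈ s then e g else 0) := by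
    intro e
    rw [← prod_subset (s₁ := s) subset_union_left fun g _ hg => by rw [if_neg hg, zpow_zero]]
    exact prod_congr rfl fun g hg => by rw [if_pos hg]
  have key2 : ∀ g ∈ c, ∀ N : ℕ, g ^ N = ∏ g' ∈ s ∪ c, g' ^ (if g' = g then (N : ℤ) else 0) := by
    intro g hg N
    rw [prod_eq_single g (fun b _ hb => by rw [if_neg hb, zpow_zero])
      fun h => absurd (mem_union_right s hg) h, if_pos rfl, zpow_natCast]
  rcases hB y hy with h1 | h1 | ⟨g, hg, x, hx, rfl⟩
  · exact ⟨1, one_ne_zero, _, key2 y h1 1⟩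
  · obtain ⟨N, hN, e, he⟩ := h y h1
    exact ⟨N, hN, _, he.trans (key1 e)⟩
  · obtain ⟨N, hN, e, he⟩ := h x hx
    refine ⟨N, hN, fun g' => (if g' = g then (N : ℤ) else 0) + if g' ∈ s then e g' else 0, ?_⟩
    rw [mul_pow, he, key2 g hg N, key1 e, ← prod_mul_distrib]
    exact prod_congr rfl fun g' hg' => (zpow_add₀ (hne g' hg') _ _).symm

theorem exists_submodule {P : Type*} [Fintype P] (h : RankLE A ρ) (S : AbsSystem K P) :
    ∃ V : Submodule ℝ (PiLp 1 fun _ : P => ℝ), Module.finrank ℝ V ≤ ρ ∧ ∀ x ∈ A, S.L x ∈ V := by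
  classical
  obtain ⟨s, hs, hs0, h⟩ := h
  refine ⟨Submodule.span ℝ (s.image S.L : Finset (PiLp 1 fun _ : P => ℝ)), ?_, fun x hx => ?_⟩
  · exact (finrank_span_finset_le_card _).trans (card_image_le.trans hs)
  obtain ⟨N, hN, e, he⟩ := h x hx
  have h1 := congrArg S.L he
  rw [AbsSystem.L_pow, AbsSystem.L_prod _ _ fun g hg => zpow_ne_zero _ (hs0 g hg)] at h1
  have hN' : (N : ℝ) ≠ 0 := by exact_mod_cast hN
  rw [← inv_smul_smul₀ hN' (S.L x), h1]
  refine Submodule.smul_mem _ _ (Submodule.sum_mem _ fun g hg => ?_)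
  rw [AbsSystem.L_zpow]
  exact Submodule.smul_mem _ _ (Submodule.subset_span (mem_coe.2 (mem_image_of_mem _ hg)))

end RankLE

end Rank

theorem pow_mul_le_mul_pow_succ {a b : ℕ} (ha : 1 ≤ a) (ρ : ℕ) :
    a ^ ρ * b ≤ (a * b) ^ (ρ + 1) := by
  rw [mul_pow]
  exact Nat.mul_le_mul (Nat.pow_le_pow_right ha (Nat.le_succ ρ)) (Nat.le_self_pow (Nat.succ_ne_zero ρ) b)

namespace AbsSystem

section Config

variable {K P ι : Type} [Field K] [Fintype P] [Fintype ι]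

/-- Solutions in a group of bounded rank, such that few of them satisfy a common further linear
equation. -/
structure IsConfig (S : AbsSystem K P) (V : Submodule ℝ (PiLp 1 fun _ : P => ℝ)) (ρ : ℕ) (c : K)
    (B : ℕ) (T : Finset (ι → K)) : Prop where
  finrank_le : Module.finrank ℝ V ≤ ρ
  base_mem : S.L c ∈ V
  mem : ∀ x ∈ T, ∀ i, S.L (x i) ∈ V
  sol : ∀ x ∈ T, S.IsSol x
  card_le : ∀ T' ⊆ T, ∀ b : ι → K, (∃ i j, b i ≠ b j) → (∀ x ∈ T', ∑ i, b i * x i = 0) → T'.card ≤ B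

theorem IsConfig.mono {S : AbsSystem K P} {V : Submodule ℝ (PiLp 1 fun _ : P => ℝ)} {ρ : ℕ} {c : K}
    {B : ℕ} {T T' : Finset (ι → K)} (h : S.IsConfig V ρ c B T) (hT' : T' ⊆ T) :
    S.IsConfig V ρ c B T' where
  finrank_le := h.finrank_le
  base_mem := h.base_mem
  mem := fun x hx => h.mem x (hT' hx)
  sol := fun x hx => h.sol x (hT' hx)
  card_le := fun T₂ hT₂ => h.card_le T₂ (hT₂.trans hT')

end Config

/-- Solutions of small height. -/
theorem exists_card_le_of_small (n : ℕ) (hn : 3 ≤ n) (R : ℝ) : ∃ κ E : ℕ, 1 ≤ κ ∧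
    ∀ (K P ι : Type) [Field K] [Fintype P] [Fintype ι] [DecidableEq ι], Fintype.card ι = n →
    ∀ (S : AbsSystem K P) (V : Submodule ℝ (PiLp 1 fun _ : P => ℝ)) (ρ : ℕ) (c : K) (B : ℕ)
      (T : Finset (ι → K)), S.IsConfig V ρ c B T → S.HasNat E →
      (∀ x ∈ T, ∀ i, ‖S.L (x i) - S.L c‖ ≤ R * S.deg) → T.card ≤ κ ^ (ρ + 1) * B := by
  classical
  set N := n.factorial with hN
  set E := 1 + N.factorial * N with hE
  have hN0 : 0 < N := Nat.factorial_pos n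
  have hlog : 0 < Real.log (N + 1) - Real.log N := by
    rw [sub_pos]
    exact Real.log_lt_log (by exact_mod_cast hN0) (by linarith)
  set W : ℝ := E * (N * (2 * n)) with hW
  have hW0 : 0 < W := by
    have : 0 < n := by omega
    positivity
  set ε : ℝ := (Real.log (N + 1) - Real.log N) / (2 * W) with hε
  have hε0 : 0 < ε := by positivity
  have hε' : E * (N * (2 * n * ε)) < Real.log (N + 1) - Real.log N := by
    have : E * (N * (2 * n * ε)) = W * ε := by rw [hW]; ring
    rw [this, hε, mul_div_assoc', mul_comm, div_lt_iff₀ (by positivity)]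
    nlinarith
  obtain ⟨j, hj⟩ := pow_unbounded_of_one_lt (R / (ε / 2)) (one_lt_two)
  rw [div_lt_iff₀ (by positivity)] at hj
  have hN1 : 1 ≤ N ^ 2 * N.factorial := Nat.one_le_iff_ne_zero.2 (by positivity)
  refine ⟨5 ^ (n * j) * (N ^ 2 * N.factorial), E, ?_, ?_⟩
  · exact one_le_mul (Nat.one_le_pow _ _ (by norm_num)) hN1
  intro K P ι _ _ _ _ hcard S V ρ c B T hT hSE hsmall
  have hD := S.one_le_deg
  have key := card_le_of_forall_norm_sub_le hT.finrank_le
    (η := ε / 2 * S.deg) (by positivity) (fun (x : ι → K) i => S.L (x i)) (g₀ := fun _ => S.L c)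
    (fun _ => hT.base_mem) hT.mem j (fun x hx i => (hsmall x hx i).trans ?_)
    (B := N ^ 2 * N.factorial * B) ?_
  · refine key.trans ?_
    rw [hcard, ← mul_assoc]
    exact Nat.mul_le_mul_right _ (pow_mul_le_mul_pow_succ (Nat.one_le_pow _ _ (by norm_num)) ρ)
  · nlinarith
  · intro T' hT' hclose
    have hT'c := hT.mono hT'
    obtain ⟨Bs, hBs, hBne, hBcov⟩ := exists_relations_of_very_close (S := S) (T := (T' : Set (ι → K)))
      (fun y hy => hT'c.sol y hy) (by omega) (N := N) (E := E) (by rw [hcard]) (δ := ε)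
      (fun y hy y' hy' i => (hclose y hy y' hy' i).trans (by linarith)) (by rw [hcard]; exact hε')
      hSE le_rfl
    have hsub : T' ⊆ Bs.biUnion fun b => T'.filter fun x => ∑ i, b i * x i = 0 := by
      intro x hx
      obtain ⟨b, hb, hbx⟩ := hBcov x hx
      exact mem_biUnion.2 ⟨b, hb, mem_filter.2 ⟨hx, hbx⟩⟩
    refine (card_le_card hsub).trans ((card_biUnion_le_card_mul _ _ B fun b hb => ?_).trans
      (Nat.mul_le_mul_right _ hBs))
    exact hT'c.card_le _ (filter_subset _ _) b (hBne b hb) fun x hx => (mem_filter.1 hx).2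

/-- Solutions whose heights have a given order of magnitude. -/
theorem exists_card_le_of_window (n : ℕ) : ∃ (κ : ℕ) (R : ℝ), 1 ≤ κ ∧ 1 ≤ R ∧
    ∀ (K P ι : Type) [Field K] [Fintype P] [Fintype ι] [DecidableEq ι], Fintype.card ι = n →
    ∀ (S : AbsSystem K P) (V : Submodule ℝ (PiLp 1 fun _ : P => ℝ)) (ρ : ℕ) (c : K) (B : ℕ)
      (T : Finset (ι → K)), S.IsConfig V ρ c B T → ∀ t : ℝ, R * S.deg ≤ t →
      (∀ x ∈ T, ∀ i, ‖S.L (x i) - S.L c‖ ≤ 2 * t) →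
      (∀ x ∈ T, ∃ i i', t / 2 < ‖S.L (x i) - S.L (x i')‖) → T.card ≤ κ ^ ρ * B := by
  classical
  obtain ⟨j, hj⟩ := pow_unbounded_of_one_lt (64 * (n : ℝ) ^ 2) (one_lt_two)
  have hlog : 0 ≤ Real.log n.factorial := Real.log_natCast_nonneg _
  refine ⟨5 ^ (n * j), 8 * Real.log n.factorial + 1, Nat.one_le_pow _ _ (by norm_num), by linarith,
    ?_⟩
  intro K P ι _ _ _ _ hcard S V ρ c B T hT t ht h1 h2
  have hD := S.one_le_deg
  have ht0 : 0 < t := by nlinarith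
  have hj0 : (0 : ℝ) < 2 ^ j := by positivity
  have key := card_le_of_forall_norm_sub_le hT.finrank_le
    (η := 2 * t / 2 ^ j) (by positivity) (fun (x : ι → K) i => S.L (x i)) (g₀ := fun _ => S.L c)
    (fun _ => hT.base_mem) hT.mem j (fun x hx i => (h1 x hx i).trans_eq (by field_simp))
    (B := B) ?_
  · rwa [hcard] at key
  · intro T' hT' hclose
    have hT'c := hT.mono hT'
    rcases T'.eq_empty_or_nonempty with rfl | ⟨x, hx⟩
    · simp
    obtain ⟨i, i', hi⟩ := h2 x (hT' hx)
    obtain ⟨b, hb, hb0⟩ := exists_relation_of_close (S := S) (T := (T' : Set (ι → K)))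
      (fun y hy => hT'c.sol y hy) hclose (mem_coe.2 hx) (i₁ := i) (i₂ := i') (by
        refine lt_of_le_of_lt ?_ hi
        rw [hcard]
        have e1 : (n : ℝ) ^ 2 * (2 * (2 * t / 2 ^ j)) ≤ t / 16 := by
          rw [show (n : ℝ) ^ 2 * (2 * (2 * t / 2 ^ j)) = 4 * (n : ℝ) ^ 2 * t / 2 ^ j by ring,
            div_le_iff₀ hj0]
          nlinarith
        nlinarith)
    exact hT'c.card_le T' (Subset.refl _) b hb hb0

/-- The number of solutions of the unit equation in two unknowns. -/
theorem exists_card_le_three : ∃ κ E : ℕ, 1 ≤ κ ∧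
    ∀ (K P ι : Type) [Field K] [CharZero K] [Fintype P] [Fintype ι] [DecidableEq ι],
    Fintype.card ι = 3 →
    ∀ (S : AbsSystem K P) (V : Submodule ℝ (PiLp 1 fun _ : P => ℝ)) (ρ : ℕ) (c : K) (i₀ : ι)
      (T : Finset (ι → K)), Module.finrank ℝ V ≤ ρ → (∀ x ∈ T, ∀ i, S.L (x i) ∈ V) →
      (∀ x ∈ T, S.IsSol x) → (∀ x ∈ T, x i₀ = c) → S.HasNat E → T.card ≤ κ ^ (ρ + 1) := by
  classical
  obtain ⟨κw, Rw, hκw, hRw, hw⟩ := exists_card_le_of_window 3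
  obtain ⟨κs, E, hκs, hs⟩ := exists_card_le_of_small 3 le_rfl (max 1000 Rw)
  refine ⟨5 ^ 18 * (7 * κw) + κs, E, by omega, ?_⟩
  intro K P ι _ _ _ _ _ hcard S V ρ c i₀ T hV hmem hsol hc hSE
  rcases T.eq_empty_or_nonempty with rfl | ⟨x₀, hx₀⟩
  · simp
  have hcu : S.IsSUnit c := hc x₀ hx₀ ▸ (hsol x₀ hx₀).unit i₀
  have hcV : S.L c ∈ V := hc x₀ hx₀ ▸ hmem x₀ hx₀ i₀
  obtain ⟨i₁, i₂, hi12, huniv⟩ : ∃ i₁ i₂, i₁ ≠ i₂ ∧ univ.erase i₀ = {i₁, i₂} := by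
    rw [← card_eq_two, card_erase_of_mem (mem_univ _), card_univ, hcard]
  have hsum : ∀ f : ι → K, ∑ i, f i = f i₀ + (f i₁ + f i₂) := fun f => by
    rw [← add_sum_erase _ f (mem_univ i₀), huniv, sum_pair hi12]
  have hall : ∀ i, i = i₀ ∨ i = i₁ ∨ i = i₂ := fun i => by
    by_cases h : i = i₀
    · exact Or.inl h
    · have : i ∈ univ.erase i₀ := mem_erase.2 ⟨h, mem_univ _⟩
      rw [huniv] at this
      simpa using Or.inr this
  have hconf : S.IsConfig V ρ c 1 T := by
    refine ⟨hV, hcV, hmem, hsol, fun T' hT' b hb hb0 => card_le_one.2 fun x hx y hy => ?_⟩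
    have e1 := (hsol x (hT' hx)).sum
    have e2 := (hsol y (hT' hy)).sum
    have e3 := hb0 x hx
    have e4 := hb0 y hy
    have hx0 := hc x (hT' hx)
    have hy0 := hc y (hT' hy)
    rw [hsum] at e1 e2 e3 e4
    have hb12 : b i₁ ≠ b i₂ := by
      intro h12
      have h01 : (b i₀ - b i₁) * c = 0 := by
        rw [← h12] at e3
        rw [hx0] at e1 e3
        linear_combination e3 - b i₁ * e1
      have h01' : b i₀ = b i₁ := sub_eq_zero.1 ((mul_eq_zero.1 h01).resolve_right hcu.1)
      obtain ⟨i, j, hij⟩ := hb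
      refine hij ?_
      have hconst : ∀ l, b l = b i₁ := fun l => by
        rcases hall l with rfl | rfl | rfl
        exacts [h01', rfl, h12.symm]
      rw [hconst i, hconst j]
    rw [hx0] at e1 e3
    rw [hy0] at e2 e4
    have h1 : x i₁ = y i₁ := by
      have : (b i₁ - b i₂) * (x i₁ - y i₁) = 0 := by
        linear_combination e3 - e4 - b i₂ * (e1 - e2)
      exact sub_eq_zero.1 ((mul_eq_zero.1 this).resolve_left (sub_ne_zero.2 hb12))
    have h2 : x i₂ = y i₂ := by
      rw [h1] at e1
      linear_combination e1 - e2
    funext i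
    rcases hall i with rfl | rfl | rfl
    exacts [hx0.trans hy0.symm, h1, h2]
  have hD := S.one_le_deg
  set D := S.deg
  set R := max 1000 Rw with hR
  have hR1 : 1000 ≤ R := le_max_left _ _
  have hR2 : Rw ≤ R := le_max_right _ _
  let d : (ι → K) → ι → PiLp 1 fun _ : P => ℝ := fun x i => S.L (x i) - S.L c
  let h : (ι → K) → ℝ := fun x => max ‖d x i₁‖ ‖d x i₂‖
  have hd0 : ∀ x ∈ T, d x i₀ = 0 := fun x hx => by simp only [d, hc x hx, sub_self]
  have hdh : ∀ x ∈ T, ∀ i, ‖d x i‖ ≤ h x := by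
    intro x hx i
    rcases hall i with rfl | rfl | rfl
    · rw [hd0 x hx, norm_zero]
      exact (norm_nonneg _).trans (le_max_left _ _)
    · exact le_max_left _ _
    · exact le_max_right _ _
  set T₁ := T.filter fun x => R * D < h x with hT₁
  have hsmall : (T.filter fun x => ¬ R * D < h x).card ≤ κs ^ (ρ + 1) := by
    have := hs K P ι hcard S V ρ c 1 _
      (hconf.mono (filter_subset (fun x => ¬ R * D < h x) T)) hSE fun x hx i => by
      obtain ⟨hx, hx'⟩ := mem_filter.1 hx
      exact (hdh x hx i).trans (not_lt.1 hx')
    simpa using this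
  have hlarge : T₁.card ≤ (5 ^ 18) ^ ρ * (7 * κw ^ ρ) := by
    have hT₁T : T₁ ⊆ T := filter_subset _ _
    have hpos : ∀ x ∈ T₁, 0 < h x := fun x hx => by
      have := (mem_filter.1 hx).2
      nlinarith
    have key := card_le_of_forall_norm_sub_le hV (η := 1 / 40) (by norm_num)
      (fun (x : ι → K) i => (h x)⁻¹ • d x i) (g₀ := fun _ => 0) (fun _ => V.zero_mem) (T := T₁)
      (fun x hx i => V.smul_mem _ (V.sub_mem (hmem x (hT₁T hx) i) hcV)) 6 (fun x hx i => by
        rw [sub_zero, norm_smul, norm_inv, Real.norm_of_nonneg (hpos x hx).le,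
          inv_mul_le_iff₀ (hpos x hx)]
        have := hdh x (hT₁T hx) i
        nlinarith [hpos x hx]) (B := 7 * κw ^ ρ) ?_
    · rwa [hcard] at key
    intro T' hT' hclose
    rcases T'.eq_empty_or_nonempty with rfl | hne
    · simp
    obtain ⟨x, hx, hmin⟩ := exists_min_image T' h hne
    have hxT := hT₁T (hT' hx)
    have hx0 := hpos x (hT' hx)
    have hxR := (mem_filter.1 (hT' hx)).2
    have hprep : ∀ y ∈ T, S.IsSUnit (-y i₁ / c) ∧ 1 - (-y i₁ / c) = -y i₂ / c ∧
        S.IsSUnit (-y i₂ / c) ∧ S.L (-y i₁ / c) = d y i₁ ∧ S.L (-y i₂ / c) = d y i₂ := by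
      intro y hy
      have hu := (hsol y hy).unit
      have hs := (hsol y hy).sum
      rw [hsum, hc y hy] at hs
      refine ⟨(hu i₁).neg.div hcu, ?_, (hu i₂).neg.div hcu, ?_, ?_⟩
      · have := hcu.1
        field_simp
        linear_combination hs
      · rw [L_div (neg_ne_zero.2 (hu i₁).1) hcu.1, L_neg]
      · rw [L_div (neg_ne_zero.2 (hu i₂).1) hcu.1, L_neg]
    have hwin : ∀ y ∈ T', h y < 100 * h x := by
      intro y hy
      by_contra! hcon
      have hyT := hT₁T (hT' hy)
      have hy0 := hpos y (hT' hy)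
      obtain ⟨hx1, hx2, hx3, hx4, hx5⟩ := hprep x hxT
      obtain ⟨hy1, hy2, hy3, hy4, hy5⟩ := hprep y hyT
      have hdist : ∀ i, ‖d y i - (h y / h x) • d x i‖ ≤ (h y / h x) * h x / 20 := by
        intro i
        have e1 : d y i - (h y / h x) • d x i = h y • ((h y)⁻¹ • d y i - (h x)⁻¹ • d x i) := by
          rw [smul_sub (h y), smul_inv_smul₀ hy0.ne', smul_smul, div_eq_mul_inv]
        rw [e1, norm_smul, Real.norm_of_nonneg hy0.le, div_mul_cancel₀ _ hx0.ne']
        have := hclose y hy x hx i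
        nlinarith
      refine false_of_cone (S := S) (t := -x i₁ / c) (s := -y i₁ / c) (T := h x) (lam := h y / h x)
        hx1 (by rw [hx2]; exact hx3) hy1 (by rw [hy2]; exact hy3) ?_ ?_ ?_ ?_ ?_ ?_ ?_
      · change 1000 * D ≤ h x
        nlinarith
      · rw [le_div_iff₀ hx0]
        exact hcon
      · rw [hx2, hx4, hx5]
        exact le_max_iff.1 le_rfl
      · rw [hx4]; exact hdh x hxT i₁
      · rw [hx2, hx5]; exact hdh x hxT i₂
      · rw [hx4, hy4]; exact hdist i₁
      · rw [hx2, hy2, hx5, hy5]; exact hdist i₂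
    have hsub : T' ⊆ (range 7).biUnion fun k => T'.filter fun y =>
        2 ^ k * h x ≤ h y ∧ h y ≤ 2 * (2 ^ k * h x) := by
      intro y hy
      have h1 := hmin y hy
      have h2 := hwin y hy
      have : 1 ≤ h y / h x := by rwa [le_div_iff₀ hx0, one_mul]
      obtain ⟨k, hk1, hk2⟩ := exists_nat_pow_near this (one_lt_two (α := ℝ))
      rw [le_div_iff₀ hx0] at hk1
      rw [div_lt_iff₀ hx0, pow_succ] at hk2
      refine mem_biUnion.2 ⟨k, mem_range.2 ?_, mem_filter.2 ⟨hy, hk1, by linarith⟩⟩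
      by_contra! hk7
      have : (2 : ℝ) ^ 7 ≤ 2 ^ k := pow_le_pow_right₀ (by norm_num) hk7
      nlinarith
    refine (card_le_card hsub).trans ((card_biUnion_le_card_mul _ _ (κw ^ ρ) fun k _ => ?_).trans
      (by simp))
    have hsub' : (T'.filter fun y => 2 ^ k * h x ≤ h y ∧ h y ≤ 2 * (2 ^ k * h x)) ⊆ T :=
      (filter_subset _ _).trans (hT'.trans hT₁T)
    have h2k : (1 : ℝ) ≤ 2 ^ k := one_le_pow₀ (by norm_num)
    have := hw K P ι hcard S V ρ c 1 _ (hconf.mono hsub') (2 ^ k * h x) ?_ ?_ ?_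
    · simpa using this
    · change Rw * D ≤ _
      nlinarith
    · intro y hy i
      exact (hdh y (hsub' hy) i).trans (mem_filter.1 hy).2.2
    · intro y hy
      have h1 := (mem_filter.1 hy).2.1
      have h3 : 2 ^ k * h x / 2 < h y := by nlinarith
      have hyc := hc y (hsub' hy)
      rcases lt_max_iff.1 h3 with h4 | h4
      · exact ⟨i₁, i₀, by rw [hyc]; exact h4⟩
      · exact ⟨i₂, i₀, by rw [hyc]; exact h4⟩
  have hsplit : T.card = T₁.card + (T.filter fun x => ¬ R * D < h x).card :=
    by
    rw [hT₁, card_filter_add_card_filter_not]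
  rw [hsplit]
  calc T₁.card + (T.filter fun x => ¬ R * D < h x).card
      ≤ (5 ^ 18) ^ ρ * (7 * κw ^ ρ) + κs ^ (ρ + 1) := Nat.add_le_add hlarge hsmall
    _ ≤ (5 ^ 18 * (7 * κw)) ^ (ρ + 1) + κs ^ (ρ + 1) := by
        refine Nat.add_le_add_right ?_ _
        rw [mul_pow]
        refine Nat.mul_le_mul (Nat.pow_le_pow_right (by norm_num) (Nat.le_succ ρ)) ?_
        rw [mul_pow]
        refine Nat.mul_le_mul ?_ (Nat.pow_le_pow_right hκw (Nat.le_succ ρ))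
        exact Nat.le_self_pow (Nat.succ_ne_zero ρ) 7
    _ ≤ _ := pow_add_pow_le (Nat.zero_le _) (Nat.zero_le _) (Nat.succ_ne_zero ρ)

end AbsSystem

section Nondegenerate

variable {K ι : Type} [Field K] [Fintype ι] [DecidableEq ι]

/-- Vectors of nonzero numbers with sum zero and without vanishing proper subsums. -/
structure IsNondeg (x : ι → K) : Prop where
  ne_zero : ∀ i, x i ≠ 0
  sum : ∑ i, x i = 0
  eq_univ : ∀ s : Finset ι, s.Nonempty → ∑ i ∈ s, x i = 0 → s = univ

/-- Replace the coordinates in `J` by their sum. -/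
def mergeCoords (J : Finset ι) (x : ι → K) : Option {i // i ∉ J} → K :=
  fun o => o.elim (∑ i ∈ J, x i) fun i => x i

omit [Fintype ι] in
theorem sum_mergeCoords (J : Finset ι) (x : ι → K) (s : Finset (Option {i // i ∉ J})) :
    ∑ o ∈ s, mergeCoords J x o = ∑ i ∈ (if none ∈ s then J else ∅) ∪
      (eraseNone s).map (Function.Embedding.subtype _), x i := by
  classical
  have hdisj : Disjoint (if none ∈ s then J else ∅)
      ((eraseNone s).map (Function.Embedding.subtype fun i => i ∉ J)) := by
    rw [disjoint_left]
    intro i hi hi'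
    obtain ⟨a, -, rfl⟩ := mem_map.1 hi'
    split_ifs at hi
    · exact a.2 hi
    · exact notMem_empty _ hi
  have h1 : ∑ i ∈ (if none ∈ s then J else ∅), x i = if none ∈ s then ∑ i ∈ J, x i else 0 := by
    split_ifs <;> simp
  have h2 : ∑ i ∈ eraseNone s, x i = ∑ o ∈ s.erase none, mergeCoords J x o := by
    rw [← map_some_eraseNone, sum_map]
    rfl
  rw [sum_union hdisj, sum_map, h1]
  simp only [Function.Embedding.subtype_apply]
  rw [h2]
  split_ifs with h
  · exact (add_sum_erase _ _ h).symm
  · rw [erase_eq_of_notMem h, zero_add]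

theorem IsNondeg.mergeCoords {x : ι → K} (hx : IsNondeg x) {J : Finset ι} (hJ : J.Nonempty)
    (hJ' : J ≠ univ) : IsNondeg (mergeCoords J x) where
  ne_zero := by
    rintro (_ | i)
    · exact fun h => hJ' (hx.eq_univ J hJ h)
    · exact hx.ne_zero i
  sum := by
    rw [sum_mergeCoords, ← hx.sum]
    congr 1
    ext i
    by_cases hi : i ∈ J <;> simp [hi]
  eq_univ := by
    intro s hs h
    rw [sum_mergeCoords] at h
    have hu := hx.eq_univ _ ?_ h
    · obtain ⟨j, hj⟩ := hJ
      ext o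
      simp only [mem_univ, iff_true]
      rcases o with _ | i
      · by_contra hn
        have := mem_univ j
        rw [← hu, if_neg hn, empty_union] at this
        obtain ⟨a, -, ha⟩ := mem_map.1 this
        exact a.2 (by simpa [← ha] using hj)
      · have := mem_univ (i : ι)
        rw [← hu] at this
        rcases mem_union.1 this with h1 | h1
        · split_ifs at h1
          · exact absurd h1 i.2
          · exact absurd h1 (notMem_empty _)
        · obtain ⟨a, ha, hai⟩ := mem_map.1 h1
          rw [mem_eraseNone] at ha
          rwa [← Subtype.ext hai]
    · obtain ⟨o, ho⟩ := hs
      rcases o with _ | i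
      · rw [if_pos ho]
        exact hJ.inl
      · exact ⟨i, mem_union_right _ (mem_map.2 ⟨i, mem_eraseNone.2 ho, rfl⟩)⟩

/-- Nondegenerate vectors with coordinates in given finite sets and in a group of bounded rank. -/
structure IsFam (T : Finset (ι → K)) (A : ι → Finset K) (ρ : ℕ) : Prop where
  nondeg : ∀ x ∈ T, IsNondeg x
  mem : ∀ x ∈ T, ∀ i, x i ∈ A i
  rank : RankLE {y | ∃ x ∈ T, ∃ i, x i = y} ρ

omit [DecidableEq ι] in
theorem IsFam.mono {T T' : Finset (ι → K)} {A : ι → Finset K} {ρ : ℕ} (h : IsFam T A ρ)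
    (hT' : T' ⊆ T) : IsFam T' A ρ where
  nondeg := fun x hx => h.nondeg x (hT' hx)
  mem := fun x hx => h.mem x (hT' hx)
  rank := h.rank.mono (fun _ ⟨x, hx, i, hi⟩ => ⟨x, hT' hx, i, hi⟩) le_rfl

variable (K) in
/-- A bound for the number of nondegenerate vectors with one prescribed coordinate. -/
def BoundFixed (n κ : ℕ) : Prop :=
  ∀ (ι : Type) [Fintype ι] [DecidableEq ι], Fintype.card ι = n →
    ∀ (T : Finset (ι → K)) (A : ι → Finset K) (ρ : ℕ) (i₀ : ι) (c : K) (m : ℕ), IsFam T A ρ →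
      (∀ x ∈ T, x i₀ = c) → (∀ i, i ≠ i₀ → (A i).card ≤ m) →
      T.card ≤ κ ^ (ρ + 1) * m ^ ((n - 2) / 2)

theorem BoundFixed.mono {n κ κ' : ℕ} (h : BoundFixed K n κ) (hκ : κ ≤ κ') : BoundFixed K n κ' :=
  fun ι _ _ hι T A ρ i₀ c m hT hc hA => (h ι hι T A ρ i₀ c m hT hc hA).trans (by gcongr)

theorem card_mergeType (J : Finset ι) :
    Fintype.card (Option {i // i ∉ J}) = Fintype.card ι - J.card + 1 := by
  rw [Fintype.card_option, Fintype.card_subtype_compl, Fintype.card_coe]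

/-- The number of vectors with prescribed coordinates in `J`. -/
theorem IsFam.card_le_of_const {T : Finset (ι → K)} {A : ι → Finset K} {ρ κ m : ℕ}
    (h : IsFam T A ρ) {J : Finset ι} (hJ : J.Nonempty) (hJ' : J ≠ univ) {z : ι → K}
    (hz : ∀ x ∈ T, ∀ i ∈ J, x i = z i) (hκ : BoundFixed K (Fintype.card ι - J.card + 1) κ)
    (hA : ∀ i ∉ J, (A i).card ≤ m) :
    T.card ≤ κ ^ (ρ + 2) * m ^ ((Fintype.card ι - J.card - 1) / 2) := by
  classical
  rcases T.eq_empty_or_nonempty with rfl | ⟨x₀, hx₀⟩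
  · simp
  set d := ∑ i ∈ J, z i with hd
  have hsum : ∀ x ∈ T, ∑ i ∈ J, x i = d := fun x hx => sum_congr rfl (hz x hx)
  have hd0 : d ≠ 0 := by
    rw [← hsum x₀ hx₀]
    exact fun h0 => hJ' ((h.nondeg x₀ hx₀).eq_univ J hJ h0)
  have hinj : Set.InjOn (mergeCoords J) (T : Set (ι → K)) := by
    intro x hx y hy hxy
    funext i
    by_cases hi : i ∈ J
    · rw [hz x hx i hi, hz y hy i hi]
    · exact congrFun hxy (some ⟨i, hi⟩)
  rw [← card_image_of_injOn hinj]
  have hfam : IsFam (T.image (mergeCoords J))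
      (fun o => o.elim {d} fun i => A i) (ρ + 1) := by
    refine ⟨?_, ?_, ?_⟩
    · intro y hy
      obtain ⟨x, hx, rfl⟩ := mem_image.1 hy
      exact (h.nondeg x hx).mergeCoords hJ hJ'
    · intro y hy o
      obtain ⟨x, hx, rfl⟩ := mem_image.1 hy
      rcases o with _ | i
      · exact mem_singleton.2 (hsum x hx)
      · exact h.mem x hx i
    · refine h.rank.mul_finset {d} (by simpa using hd0) ?_
      rintro _ ⟨y, hy, o, rfl⟩
      obtain ⟨x, hx, rfl⟩ := mem_image.1 hy
      rcases o with _ | i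
      · exact Or.inl (mem_singleton.2 (hsum x hx))
      · exact Or.inr (Or.inl ⟨x, hx, i, rfl⟩)
  have := hκ _ (card_mergeType J) _ _ _ none d m hfam ?_ ?_
  · rwa [show Fintype.card ι - J.card + 1 - 2 = Fintype.card ι - J.card - 1 by omega] at this
  · intro y hy
    obtain ⟨x, hx, rfl⟩ := mem_image.1 hy
    exact hsum x hx
  · rintro (_ | i) hi
    · exact absurd rfl hi
    · exact hA i i.2

/-- The number of vectors with prescribed coordinates in `J`, and with a further coordinate in a
small set. -/
theorem IsFam.card_le_of_const_of_notMem {T : Finset (ι → K)} {A : ι → Finset K} {ρ κ m : ℕ}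
    (h : IsFam T A ρ) {J : Finset ι} {f : ι} (hf : f ∉ J) (hJ' : insert f J ≠ univ) {z : ι → K}
    (hz : ∀ x ∈ T, ∀ i ∈ J, x i = z i) (hκ : BoundFixed K (Fintype.card ι - J.card) κ)
    (hA : ∀ i ∉ J, (A i).card ≤ m) :
    T.card ≤ κ ^ (ρ + 2) * m ^ ((Fintype.card ι - J.card - 2) / 2) * (A f).card := by
  classical
  have hcard := card_insert_of_notMem hf
  have hlt : (insert f J).card < Fintype.card ι := (card_lt_iff_ne_univ _).2 hJ'
  refine card_le_mul_card_image_of_maps_to (f := fun x => x f) (fun x hx => h.mem x hx f) _ ?_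
  intro v _
  have := (h.mono (filter_subset (fun x => x f = v) T)).card_le_of_const (κ := κ) (m := m)
    (insert_nonempty f J) hJ' (z := Function.update z f v) ?_ ?_ ?_
  · rwa [hcard, show Fintype.card ι - (J.card + 1) - 1 = Fintype.card ι - J.card - 2 by omega]
      at this
  · intro x hx i hi
    obtain ⟨hxT, hxf⟩ := mem_filter.1 hx
    rcases mem_insert.1 hi with rfl | hi'
    · rw [Function.update_self, hxf]
    · rw [Function.update_of_ne (ne_of_mem_of_not_mem hi' hf), hz x hxT i hi']
  · rwa [show Fintype.card ι - (insert f J).card + 1 = Fintype.card ι - J.card by omega]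
  · exact fun i hi => hA i fun hi' => hi (mem_insert_of_mem hi')

end Nondegenerate

section Split

variable {K ι : Type} [Field K] [Fintype ι] [DecidableEq ι]

/-- The coordinates in `J`, multiplied by the given coefficients. -/
def scaleRestrict (J : Finset ι) (b x : ι → K) : J → K := fun i => b i * x i

omit [Fintype ι] [DecidableEq ι] in
theorem sum_scaleRestrict (J : Finset ι) (b x : ι → K) (s : Finset J) :
    ∑ i ∈ s, scaleRestrict J b x i = ∑ i ∈ s.map (Function.Embedding.subtype _), b i * x i := by
  rw [sum_map]
  rfl

/-- A vanishing linear combination of the coordinates of a nondegenerate vector decomposes into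
nondegenerate parts. -/
theorem exists_isNondeg_scaleRestrict {x b : ι → K} (hx : IsNondeg x) {i₀ : ι} (hi₀ : b i₀ ≠ 0)
    (h : ∑ i, b i * x i = 0) : ∃ J : Finset ι, i₀ ∈ J ∧ (∀ i ∈ J, b i ≠ 0) ∧
      IsNondeg (scaleRestrict J b x) := by
  classical
  let F : Finset (Finset ι) :=
    univ.filter fun J => i₀ ∈ J ∧ (∀ i ∈ J, b i ≠ 0) ∧ ∑ i ∈ J, b i * x i = 0
  have hF : F.Nonempty := by
    refine ⟨univ.filter fun i => b i ≠ 0, ?_⟩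
    simp only [F, mem_filter, mem_univ, true_and]
    refine ⟨hi₀, fun i hi => hi, ?_⟩
    refine (sum_subset (subset_univ _) fun i _ hi => ?_).trans h
    have : b i = 0 := by simpa only [mem_filter, mem_univ, true_and, not_not] using hi
    rw [this, zero_mul]
  obtain ⟨J, hJ, hmin⟩ := exists_min_image F card hF
  simp only [F, mem_filter, mem_univ, true_and] at hJ hmin
  obtain ⟨h0, hb, hsum⟩ := hJ
  refine ⟨J, h0, hb, ⟨fun i => mul_ne_zero (hb i i.2) (hx.ne_zero i), ?_, ?_⟩⟩
  · rw [sum_scaleRestrict, ← hsum]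
    congr 1
    ext i
    simp
  · intro s hs hss
    rw [sum_scaleRestrict] at hss
    set s' := s.map (Function.Embedding.subtype fun i => i ∈ J) with hs'
    have hsJ : s' ⊆ J := fun i hi => by
      obtain ⟨a, -, rfl⟩ := mem_map.1 hi
      exact a.2
    have hcard : s'.card = s.card := card_map _
    rw [← card_eq_iff_eq_univ, Fintype.card_coe]
    refine le_antisymm (hcard ▸ card_le_card hsJ) ?_
    by_cases hi : i₀ ∈ s'
    · rw [← hcard]
      exact hmin s' ⟨hi, fun i hi => hb i (hsJ hi), hss⟩
    · exfalso
      have h1 := hmin (J \ s') ⟨mem_sdiff.2 ⟨h0, hi⟩, fun i hi => hb i (mem_sdiff.1 hi).1, by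
        rw [← sum_sdiff hsJ, hss, add_zero] at hsum
        exact hsum⟩
      rw [card_sdiff_of_subset hsJ] at h1
      have h2 := card_le_card hsJ
      have h3 := hs.card_pos
      omega

omit [DecidableEq ι] in
theorem IsFam.image_scaleRestrict {T : Finset (ι → K)} {A : ι → Finset K} {ρ : ℕ} (h : IsFam T A ρ)
    [DecidableEq K] {J : Finset ι} {b : ι → K} (hb : ∀ i ∈ J, b i ≠ 0)
    (hJ : ∀ x ∈ T, IsNondeg (scaleRestrict J b x)) :
    IsFam (T.image (scaleRestrict J b)) (fun i => (A i).image (b i * ·)) (ρ + Fintype.card ι) := by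
  refine ⟨?_, ?_, ?_⟩
  · intro y hy
    obtain ⟨x, hx, rfl⟩ := mem_image.1 hy
    exact hJ x hx
  · intro y hy i
    obtain ⟨x, hx, rfl⟩ := mem_image.1 hy
    exact mem_image_of_mem _ (h.mem x hx i)
  · refine (h.rank.mul_finset (J.image b) ?_ ?_).mono (Set.Subset.refl _)
      (Nat.add_le_add_left (card_image_le.trans (card_le_univ J)) ρ)
    · intro g hg
      obtain ⟨i, hi, rfl⟩ := mem_image.1 hg
      exact hb i hi
    · rintro _ ⟨y, hy, i, rfl⟩
      obtain ⟨x, hx, rfl⟩ := mem_image.1 hy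
      exact Or.inr (Or.inr ⟨b i, mem_image_of_mem _ i.2, x i, ⟨x, hx, i, rfl⟩, rfl⟩)

/-- Reduction of a linear relation to the case of a nondegenerate relation. -/
theorem IsFam.card_le_of_relation {T : Finset (ι → K)} {A : ι → Finset K} {ρ : ℕ}
    (h : IsFam T A ρ) {M : ℕ} {i₀ : ι}
    (hM : ∀ J : Finset ι, i₀ ∈ J → 2 ≤ J.card → J ≠ univ → ∀ T' ⊆ T, ∀ b : ι → K,
      (∀ i ∈ J, b i ≠ 0) → (∀ x ∈ T', IsNondeg (scaleRestrict J b x)) → T'.card ≤ M)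
    {b : ι → K} (hb : ∃ i j, b i ≠ b j) (hbT : ∀ x ∈ T, ∑ i, b i * x i = 0) :
    T.card ≤ 2 ^ Fintype.card ι * M := by
  classical
  obtain ⟨i₁, hi₁⟩ : ∃ i₁, b i₀ ≠ b i₁ := by
    by_contra! hcon
    obtain ⟨i, j, hij⟩ := hb
    exact hij ((hcon i).symm.trans (hcon j))
  let b' : ι → K := fun i => b i - b i₁
  have hb'₀ : b' i₀ ≠ 0 := sub_ne_zero.2 hi₁
  have hb'₁ : b' i₁ = 0 := sub_self _
  have hb'T : ∀ x ∈ T, ∑ i, b' i * x i = 0 := by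
    intro x hx
    simp only [b', sub_mul, sum_sub_distrib, ← mul_sum]
    rw [hbT x hx, (h.nondeg x hx).sum, mul_zero, sub_zero]
  let TJ : Finset ι → Finset (ι → K) := fun J => T.filter fun x => i₀ ∈ J ∧ (∀ i ∈ J, b' i ≠ 0) ∧
    IsNondeg (scaleRestrict J b' x)
  have hsub : T ⊆ univ.biUnion TJ := by
    intro x hx
    obtain ⟨J, h0, h1, h2⟩ := exists_isNondeg_scaleRestrict (h.nondeg x hx) hb'₀ (hb'T x hx)
    exact mem_biUnion.2 ⟨J, mem_univ _, mem_filter.2 ⟨hx, h0, h1, h2⟩⟩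
  calc T.card ≤ (univ.biUnion TJ).card := card_le_card hsub
    _ ≤ (univ : Finset (Finset ι)).card * M := card_biUnion_le_card_mul _ _ _ fun J _ => ?_
    _ = _ := by rw [card_univ, Fintype.card_finset]
  rcases (TJ J).eq_empty_or_nonempty with h0 | ⟨x, hx⟩
  · simp [h0]
  obtain ⟨hxT, h0, hbJ, hnd⟩ := mem_filter.1 hx
  refine hM J h0 ?_ ?_ (TJ J) (filter_subset _ _) b' hbJ fun y hy => (mem_filter.1 hy).2.2.2
  · by_contra! hlt
    have hJ : J = {i₀} := by
      have := card_pos.2 ⟨i₀, h0⟩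
      obtain ⟨a, rfl⟩ := card_eq_one.1 (show J.card = 1 by omega)
      rw [mem_singleton.1 h0]
    refine hnd.ne_zero ⟨i₀, h0⟩ ?_
    rw [← hnd.sum]
    symm
    refine sum_eq_single _ (fun i _ hi => absurd (Subtype.ext ?_) hi) (by simp)
    exact mem_singleton.1 (hJ ▸ i.2)
  · rintro rfl
    exact hbJ i₁ (mem_univ _) hb'₁

/-- The number of vectors having a given nondegenerate relation, in terms of the fibres. -/
theorem IsFam.card_le_mul_of_scaleRestrict {T : Finset (ι → K)} {A : ι → Finset K} {ρ κ m : ℕ}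
    (h : IsFam T A ρ) {i₀ : ι} {c : K} (hc : ∀ x ∈ T, x i₀ = c) {J : Finset ι} (hi₀ : i₀ ∈ J)
    {b : ι → K} (hb : ∀ i ∈ J, b i ≠ 0) (hJ : ∀ x ∈ T, IsNondeg (scaleRestrict J b x))
    (hA : ∀ i, i ≠ i₀ → (A i).card ≤ m) (hκ : BoundFixed K J.card κ) {M : ℕ}
    (hM : ∀ T' ⊆ T, ∀ z : ι → K, (∀ x ∈ T', ∀ i ∈ J, x i = z i) → T'.card ≤ M) :
    T.card ≤ M * (κ ^ (ρ + Fintype.card ι + 1) * m ^ ((J.card - 2) / 2)) := by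
  classical
  refine (card_le_mul_card_image (f := scaleRestrict J b) _ M ?_).trans
    (Nat.mul_le_mul_left _ ?_)
  · intro y _
    refine hM _ (filter_subset _ _) (fun i => if hi : i ∈ J then (b i)⁻¹ * y ⟨i, hi⟩ else 0) ?_
    intro x hx i hi
    rw [dif_pos hi, ← (mem_filter.1 hx).2]
    exact (inv_mul_cancel_left₀ (hb i hi) _).symm
  · refine hκ J (Fintype.card_coe J) _ _ _ ⟨i₀, hi₀⟩ (b i₀ * c) m (h.image_scaleRestrict hb hJ) ?_ ?_
    · intro y hy
      obtain ⟨x, hx, rfl⟩ := mem_image.1 hy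
      exact congrArg (b i₀ * ·) (hc x hx)
    · intro i hi
      exact card_image_le.trans (hA i fun h => hi (Subtype.ext h))

/-- Vectors satisfying an additional relation. -/
theorem IsFam.card_le_of_relation_of_even {T : Finset (ι → K)} {A : ι → Finset K} {ρ κ m : ℕ}
    (h : IsFam T A ρ) (hn : Even (Fintype.card ι)) {i₀ : ι} {c : K} (hc : ∀ x ∈ T, x i₀ = c)
    (hA : ∀ i, i ≠ i₀ → (A i).card ≤ m)
    (hκ : ∀ j, 2 ≤ j → j < Fintype.card ι → BoundFixed K j κ)
    {b : ι → K} (hb : ∃ i j, b i ≠ b j) (hbT : ∀ x ∈ T, ∑ i, b i * x i = 0) :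
    T.card ≤ 2 ^ Fintype.card ι *
      (κ ^ (2 * ρ + Fintype.card ι + 3) * m ^ ((Fintype.card ι - 4) / 2)) := by
  refine h.card_le_of_relation (i₀ := i₀) ?_ hb hbT
  intro J hi₀ hJ2 hJu T' hT' b' hb' hJ
  have hlt : J.card < Fintype.card ι := (card_lt_iff_ne_univ _).2 hJu
  refine ((h.mono hT').card_le_mul_of_scaleRestrict (fun x hx => hc x (hT' hx)) hi₀ hb' hJ hA
    (hκ _ hJ2 hlt) (M := κ ^ (ρ + 2) * m ^ ((Fintype.card ι - J.card - 1) / 2)) ?_).trans_eq ?_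
  · intro T₂ hT₂ z hz
    exact (h.mono (hT₂.trans hT')).card_le_of_const ⟨i₀, hi₀⟩ hJu hz (hκ _ (by omega) (by omega))
      fun i hi => hA i fun h => hi (h ▸ hi₀)
  · obtain ⟨k, hk⟩ := hn
    have e : (Fintype.card ι - 4) / 2 =
        (Fintype.card ι - J.card - 1) / 2 + (J.card - 2) / 2 := by omega
    rw [e, pow_add m, show 2 * ρ + Fintype.card ι + 3 = (ρ + 2) + (ρ + Fintype.card ι + 1) by ring,
      pow_add κ]
    ring

/-- Vectors satisfying an additional relation, where some coordinates are in small sets. -/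
theorem IsFam.card_le_of_relation_of_odd {T : Finset (ι → K)} {A : ι → Finset K} {ρ κ m μ : ℕ}
    (h : IsFam T A ρ) (hn : Odd (Fintype.card ι)) (hn5 : 5 ≤ Fintype.card ι) (hκ1 : 1 ≤ κ)
    {i₀ : ι} {c : K} (hc : ∀ x ∈ T, x i₀ = c) (hA : ∀ i, i ≠ i₀ → (A i).card ≤ m)
    {F : Finset ι} (hF₀ : i₀ ∉ F) (hF2 : 2 ≤ F.card) (hF : ∀ i ∈ F, (A i).card ≤ μ)
    (hκ : ∀ j, 2 ≤ j → j < Fintype.card ι → BoundFixed K j κ)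
    {b : ι → K} (hb : ∃ i j, b i ≠ b j) (hbT : ∀ x ∈ T, ∑ i, b i * x i = 0) :
    T.card ≤ 2 ^ Fintype.card ι *
      (κ ^ (2 * ρ + Fintype.card ι + 4) * m ^ ((Fintype.card ι - 5) / 2) * μ) := by
  classical
  refine h.card_le_of_relation (i₀ := i₀) ?_ hb hbT
  intro J hi₀ hJ2 hJu T' hT' b' hb' hJ
  have hlt : J.card < Fintype.card ι := (card_lt_iff_ne_univ _).2 hJu
  have hT'f := h.mono hT'
  have hc' : ∀ x ∈ T', x i₀ = c := fun x hx => hc x (hT' hx)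
  have hAJ : ∀ i ∉ J, (A i).card ≤ m := fun i hi => hA i fun h => hi (h ▸ hi₀)
  rcases T'.eq_empty_or_nonempty with rfl | ⟨x₀, hx₀⟩
  · simp
  have hμ : 1 ≤ μ := by
    obtain ⟨f, hf⟩ : F.Nonempty := card_pos.1 (by omega)
    exact (card_pos.2 ⟨_, hT'f.mem x₀ hx₀ f⟩).trans_le (hF f hf)
  obtain ⟨k, hk⟩ := hn
  set n := Fintype.card ι with hn
  have hplain : ∀ T₂ ⊆ T', ∀ z : ι → K, (∀ x ∈ T₂, ∀ i ∈ J, x i = z i) →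
      T₂.card ≤ κ ^ (ρ + 2) * m ^ ((n - J.card - 1) / 2) := fun T₂ hT₂ z hz =>
    (hT'f.mono hT₂).card_le_of_const ⟨i₀, hi₀⟩ hJu hz (hκ _ (by omega) (by omega)) hAJ
  by_cases hpar : Odd J.card
  · obtain ⟨l, hl⟩ := hpar
    refine (hT'f.card_le_mul_of_scaleRestrict hc' hi₀ hb' hJ hA (hκ _ hJ2 hlt) hplain).trans ?_
    have e : (n - 5) / 2 = (n - J.card - 1) / 2 + (J.card - 2) / 2 := by omega
    calc _ = κ ^ (2 * ρ + n + 3) * m ^ ((n - 5) / 2) * 1 := by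
          rw [e, pow_add m, show 2 * ρ + n + 3 = (ρ + 2) + (ρ + n + 1) by ring, pow_add κ]
          ring
      _ ≤ _ := by gcongr; omega
  obtain ⟨l, hl⟩ := Nat.not_odd_iff_even.1 hpar
  by_cases hFJ : 4 ≤ J.card ∧ ∃ f ∈ F, f ∈ J
  · obtain ⟨hJ4, f, hfF, hfJ⟩ := hFJ
    have hf₀ : f ≠ i₀ := fun h => hF₀ (h ▸ hfF)
    have hcard : T'.card ≤ κ ^ (ρ + 2) * m ^ ((n - J.card - 1) / 2) *
        (T'.image (scaleRestrict J b')).card := by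
      refine card_le_mul_card_image _ _ fun y _ => ?_
      refine hplain _ (filter_subset _ _)
        (fun i => if hi : i ∈ J then (b' i)⁻¹ * y ⟨i, hi⟩ else 0) fun x hx i hi => ?_
      rw [dif_pos hi, ← (mem_filter.1 hx).2]
      exact (inv_mul_cancel_left₀ (hb' i hi) _).symm
    have himg := (hT'f.image_scaleRestrict hb' hJ).card_le_of_const_of_notMem (κ := κ) (m := m)
      (J := {⟨i₀, hi₀⟩}) (f := ⟨f, hfJ⟩) (by simpa using hf₀) ?_
      (z := fun _ => b' i₀ * c) ?_ ?_ ?_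
    · rw [Fintype.card_coe, card_singleton] at himg
      have h1 : ((A f).image (b' f * ·)).card ≤ μ := card_image_le.trans (hF f hfF)
      have e : (n - 5) / 2 = (n - J.card - 1) / 2 + (J.card - 1 - 2) / 2 := by omega
      calc T'.card ≤ κ ^ (ρ + 2) * m ^ ((n - J.card - 1) / 2) *
            (κ ^ (ρ + n + 2) * m ^ ((J.card - 1 - 2) / 2) * μ) :=
            hcard.trans (Nat.mul_le_mul_left _ (himg.trans (Nat.mul_le_mul_left _ h1)))
        _ = κ ^ (2 * ρ + n + 4) * m ^ ((n - 5) / 2) * μ := by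
          rw [e, pow_add m, show 2 * ρ + n + 4 = (ρ + 2) + (ρ + n + 2) by ring, pow_add κ]
          ring
        _ ≤ _ := by gcongr
    · intro hu
      have := congrArg card hu
      rw [card_univ, Fintype.card_coe, card_insert_of_notMem (by simpa using hf₀),
        card_singleton] at this
      omega
    · intro y hy i hi
      obtain ⟨x, hx, rfl⟩ := mem_image.1 hy
      rw [mem_singleton.1 hi]
      exact congrArg (b' i₀ * ·) (hc' x hx)
    · rw [Fintype.card_coe, card_singleton]
      exact hκ _ (by omega) (by omega)
    · intro i hi
      exact card_image_le.trans (hA i fun h => hi (mem_singleton.2 (Subtype.ext h)))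
  · obtain ⟨f, hfF, hfJ, hJn⟩ : ∃ f ∈ F, f ∉ J ∧ J.card + 3 ≤ n := by
      by_cases hJ4 : 4 ≤ J.card
      · have hdisj : ∀ f ∈ F, f ∉ J := fun f hf hfJ => hFJ ⟨hJ4, f, hf, hfJ⟩
        obtain ⟨f, hf⟩ : F.Nonempty := card_pos.1 (by omega)
        have h1 : F.card ≤ Jᶜ.card := card_le_card fun i hi => mem_compl.2 (hdisj i hi)
        rw [card_compl] at h1
        exact ⟨f, hf, hdisj f hf, by omega⟩
      · have h1 : (J.erase i₀).card < F.card := by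
          rw [card_erase_of_mem hi₀]
          omega
        obtain ⟨f, hf, hfJ⟩ := exists_mem_notMem_of_card_lt_card h1
        exact ⟨f, hf, fun h => hfJ (mem_erase.2 ⟨fun h => hF₀ (h ▸ hf), h⟩), by omega⟩
    refine (hT'f.card_le_mul_of_scaleRestrict hc' hi₀ hb' hJ hA (hκ _ hJ2 hlt)
      (M := κ ^ (ρ + 2) * m ^ ((n - J.card - 2) / 2) * μ) fun T₂ hT₂ z hz => ?_).trans ?_
    · refine ((hT'f.mono hT₂).card_le_of_const_of_notMem hfJ ?_ hz
        (hκ _ (by omega) (by omega)) hAJ).trans (Nat.mul_le_mul_left _ (hF f hfF))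
      intro hu
      have := congrArg card hu
      rw [card_univ, card_insert_of_notMem hfJ] at this
      omega
    · have e : (n - 5) / 2 = (n - J.card - 2) / 2 + (J.card - 2) / 2 := by omega
      calc _ = κ ^ (2 * ρ + n + 3) * m ^ ((n - 5) / 2) * μ := by
            rw [e, pow_add m, show 2 * ρ + n + 3 = (ρ + 2) + (ρ + n + 1) by ring, pow_add κ]
            ring
        _ ≤ _ := by gcongr; omega

end Split

namespace AbsSystem

/-- A coordinate of a solution is close to a point if all others are. -/
theorem IsSol.norm_sub_le_of_forall_ne {K P ι : Type} [Field K] [Fintype P] [Fintype ι]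
    {S : AbsSystem K P} {x : ι → K} (hx : S.IsSol x) {c : K} (hc : S.IsSUnit c) {θ : ℝ} (hθ : 0 ≤ θ)
    {i : ι} (h : ∀ l, l ≠ i → ‖S.L (x l) - S.L c‖ ≤ θ) :
    ‖S.L (x i) - S.L c‖ ≤ 2 * (S.deg * Real.log (Fintype.card ι) + Fintype.card ι * θ) := by
  classical
  have hι : 0 < Fintype.card ι := Fintype.card_pos_iff.2 ⟨i⟩
  have hι1 : (1 : ℝ) ≤ Fintype.card ι := by exact_mod_cast hι
  have hlog : 0 ≤ Real.log (Fintype.card ι) := Real.log_nonneg hι1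
  set g : P → ℝ := fun p => ∑ l ∈ univ.erase i, |(S.L (x l) - S.L c) p| with hg
  have hg0 : ∀ p, 0 ≤ g p := fun p => sum_nonneg fun l _ => abs_nonneg _
  have hle : ∀ p, (S.L (x i) - S.L c) p ≤ S.archConst (Real.log (Fintype.card ι)) p + g p := by
    intro p
    have hxi : x i = -∑ l ∈ univ.erase i, x l := by
      have := hx.sum
      rw [← add_sum_erase _ _ (mem_univ i)] at this
      exact eq_neg_of_add_eq_zero_left this
    have := v_sum_le (S := S) (s := univ.erase i) x p (M := S.L c p + g p)
      (N := Fintype.card ι) ?_ ?_ hι1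
    · rw [← AbsoluteValue.map_neg, ← hxi, ← S.exp_L (hx.unit i).1, Real.exp_le_exp] at this
      rw [PiLp.sub_apply]
      linarith
    · intro l hl
      rw [← S.exp_L (hx.unit l).1, Real.exp_le_exp]
      have h1 : |(S.L (x l) - S.L c) p| ≤ g p :=
        single_le_sum (f := fun l => |(S.L (x l) - S.L c) p|) (fun l _ => abs_nonneg _) hl
      have h2 := (le_abs_self _).trans h1
      rw [PiLp.sub_apply] at h2
      linarith
    · exact_mod_cast card_le_univ _
  have harch : ∀ p, 0 ≤ S.archConst (Real.log (Fintype.card ι)) p := fun p => by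
    rw [archConst]
    split_ifs
    exacts [hlog, le_rfl]
  have hsum0 : ∑ p, (S.L (x i) - S.L c) p = 0 := by
    simp only [PiLp.sub_apply]
    rw [sum_sub_distrib, (hx.unit i).sum_L, hc.sum_L, sub_zero]
  have hgsum : ∑ p, g p ≤ Fintype.card ι * θ := by
    simp only [hg]
    rw [sum_comm]
    calc ∑ l ∈ univ.erase i, ∑ p, |(S.L (x l) - S.L c) p| ≤ ∑ l ∈ univ.erase i, θ :=
          sum_le_sum fun l hl => by
            rw [← norm_eq_sum]
            exact h l (ne_of_mem_erase hl)
      _ = (univ.erase i).card * θ := by rw [sum_const, nsmul_eq_mul]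
      _ ≤ Fintype.card ι * θ := by
          gcongr
          exact card_le_univ _
  have : ∀ p, |(S.L (x i) - S.L c) p| ≤
      2 * (S.archConst (Real.log (Fintype.card ι)) p + g p) - (S.L (x i) - S.L c) p := by
    intro p
    rw [abs_le]
    have := hle p
    have := harch p
    have := hg0 p
    constructor <;> linarith
  rw [norm_eq_sum]
  refine (sum_le_sum fun p _ => this p).trans ?_
  rw [sum_sub_distrib, hsum0, ← mul_sum, sum_add_distrib, sum_archConst]
  linarith

end AbsSystem

section Setup

variable {K ι : Type} [Field K] [Fintype ι] [DecidableEq ι]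

omit [DecidableEq ι] in
theorem IsFam.exists_absSystem [NumberField K] {T : Finset (ι → K)} {A : ι → Finset K} {ρ : ℕ}
    (h : IsFam T A ρ) (E : ℕ) : ∃ (P : Type) (_ : Fintype P) (S : AbsSystem K P)
      (V : Submodule ℝ (PiLp 1 fun _ : P => ℝ)), Module.finrank ℝ V ≤ ρ ∧ (∀ x ∈ T, S.IsSol x) ∧
      (∀ x ∈ T, ∀ i, S.L (x i) ∈ V) ∧ S.HasNat E := by
  classical
  obtain ⟨P, _, S, hS⟩ := AbsSystem.exists_of_numberField K
    ((T.biUnion fun x => univ.image x) ∪ (Icc 1 E).image fun k : ℕ => (k : K)) (by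
      intro y hy
      rcases mem_union.1 hy with hy | hy
      · obtain ⟨x, hx, hy⟩ := mem_biUnion.1 hy
        obtain ⟨i, -, rfl⟩ := mem_image.1 hy
        exact (h.nondeg x hx).ne_zero i
      · obtain ⟨k, hk, rfl⟩ := mem_image.1 hy
        have := (mem_Icc.1 hk).1
        exact Nat.cast_ne_zero.2 (by omega))
  obtain ⟨V, hV, hVT⟩ := h.rank.exists_submodule S
  refine ⟨P, _, S, V, hV, fun x hx => ⟨fun i => ?_, (h.nondeg x hx).sum⟩,
    fun x hx i => hVT _ ⟨x, hx, i, rfl⟩, fun k h1 h2 => ?_⟩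
  · exact hS _ (mem_union_left _ (mem_biUnion.2 ⟨x, hx, mem_image_of_mem _ (mem_univ i)⟩))
  · exact hS _ (mem_union_right _ (mem_image_of_mem _ (mem_Icc.2 ⟨h1, h2⟩)))

theorem boundFixed_two : BoundFixed K 2 1 := by
  intro ι _ _ hι T A ρ i₀ c m hT hc _
  simp only [one_pow, le_refl, tsub_eq_zero_of_le, Nat.zero_div, pow_zero, mul_one]
  refine card_le_one.2 fun x hx y hy => funext fun i => ?_
  by_cases hi : i = i₀
  · rw [hi, hc x hx, hc y hy]
  · have hu : ({i₀, i} : Finset ι) = univ := by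
      rw [← card_eq_iff_eq_univ, hι, card_pair (Ne.symm hi)]
    have h1 := (hT.nondeg x hx).sum
    have h2 := (hT.nondeg y hy).sum
    rw [← hu, sum_pair (Ne.symm hi), hc x hx] at h1
    rw [← hu, sum_pair (Ne.symm hi), hc y hy] at h2
    linear_combination h1 - h2

theorem exists_boundFixed_three : ∃ κ : ℕ, 1 ≤ κ ∧
    ∀ (K : Type) [Field K] [NumberField K], BoundFixed K 3 κ := by
  obtain ⟨κ, E, hκ, h⟩ := AbsSystem.exists_card_le_three
  refine ⟨κ, hκ, fun K _ _ ι _ _ hι T A ρ i₀ c m hT hc _ => ?_⟩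
  obtain ⟨P, _, S, V, hV, hsol, hmem, hE⟩ := hT.exists_absSystem E
  simpa using h K P ι hι S V ρ c i₀ T hV hmem hsol hc hE

theorem boundFixed_of_even {n κ : ℕ} (hn : 4 ≤ n) (hn2 : Even n) (hκ1 : 1 ≤ κ)
    (hκ : BoundFixed K (n - 1) κ) : BoundFixed K n (κ ^ 2) := by
  classical
  intro ι _ _ hι T A ρ i₀ c m hT hc hA
  obtain ⟨f, hf⟩ : ∃ f, f ≠ i₀ :=
    @exists_ne ι (Fintype.one_lt_card_iff_nontrivial.1 (by omega)) i₀
  have := hT.card_le_of_const_of_notMem (κ := κ) (m := m) (J := {i₀}) (f := f) (by simpa using hf)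
    ?_ (z := fun _ => c) ?_ ?_ ?_
  · obtain ⟨k, hk⟩ := hn2
    rw [hι, card_singleton] at this
    calc T.card ≤ κ ^ (ρ + 2) * m ^ ((n - 1 - 2) / 2) * m :=
          this.trans (Nat.mul_le_mul_left _ (hA f hf))
      _ = κ ^ (ρ + 2) * m ^ ((n - 2) / 2) := by
          rw [mul_assoc, ← pow_succ, show (n - 1 - 2) / 2 + 1 = (n - 2) / 2 by omega]
      _ ≤ (κ ^ 2) ^ (ρ + 1) * m ^ ((n - 2) / 2) := by
          rw [← pow_mul]
          gcongr
          omega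
  · intro hu
    have := congrArg card hu
    rw [card_univ, card_insert_of_notMem (by simpa using hf), card_singleton] at this
    omega
  · intro x hx i hi
    rw [mem_singleton.1 hi, hc x hx]
  · rwa [hι, card_singleton]
  · exact fun i hi => hA i (by simpa using hi)

end Setup

theorem exists_two_pow_mul_le {t₀ d : ℝ} (ht₀ : 0 < t₀) (hd : t₀ ≤ d) :
    ∃ j : ℕ, 2 ^ j * t₀ ≤ d ∧ d ≤ 2 * (2 ^ j * t₀) := by
  obtain ⟨j, h1, h2⟩ := exists_nat_pow_near ((one_le_div ht₀).2 hd) (one_lt_two (α := ℝ))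
  refine ⟨j, (le_div_iff₀ ht₀).1 h1, ?_⟩
  rw [div_lt_iff₀ ht₀, pow_succ] at h2
  linarith

/-- A real number is comparable to few terms of a geometric progression. -/
theorem card_filter_two_pow_le {t₀ : ℝ} (ht₀ : 0 < t₀) (q : ℕ) (d : ℝ) (J : Finset ℕ) :
    (J.filter fun j => 2 ^ j * t₀ ≤ q * d ∧ d ≤ 2 * (2 ^ j * t₀)).card ≤ 2 * q + 1 := by
  rcases (J.filter fun j => 2 ^ j * t₀ ≤ q * d ∧ d ≤ 2 * (2 ^ j * t₀)).eq_empty_or_nonempty with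
    h0 | hne
  · simp [h0]
  obtain ⟨j₁, hj₁, hmin⟩ := exists_min_image _ id hne
  have h1 := (mem_filter.1 hj₁).2.2
  refine (card_le_card (t := Ico j₁ (j₁ + (2 * q + 1))) fun j hj => ?_).trans (by simp)
  refine mem_Ico.2 ⟨hmin j hj, ?_⟩
  by_contra! hcon
  have h2 := (mem_filter.1 hj).2.1
  have h3 : (2 : ℝ) ^ j ≤ 2 * q * 2 ^ j₁ := by
    have : (q : ℝ) * d ≤ q * (2 * (2 ^ j₁ * t₀)) := by gcongr
    refine le_of_mul_le_mul_right ?_ ht₀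
    linarith
  have h4 : (2 : ℝ) ^ (j₁ + (2 * q + 1)) ≤ 2 ^ j := pow_le_pow_right₀ one_le_two hcon
  have h5 : ((2 * q + 1 : ℕ) : ℝ) < 2 ^ (2 * q + 1) := by
    exact_mod_cast Nat.lt_two_pow_self
  rw [pow_add] at h4
  have h6 : (0 : ℝ) < 2 ^ j₁ := by positivity
  push_cast at h5
  nlinarith

theorem pow_succ_add_mul_pow_le (a b c ρ : ℕ) (hb : 1 ≤ b) :
    a ^ (ρ + 1) + b * c ^ ρ ≤ (a + b * c + b) ^ (ρ + 1) := by
  rw [pow_succ, pow_succ]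
  have h1 : a ≤ a + b * c + b := by omega
  have h2 : c ≤ a + b * c + b := by nlinarith
  have h3 := Nat.pow_le_pow_left h1 ρ
  have h4 := Nat.pow_le_pow_left h2 ρ
  calc a ^ ρ * a + b * c ^ ρ ≤ (a + b * c + b) ^ ρ * a + b * (a + b * c + b) ^ ρ := by gcongr
    _ ≤ (a + b * c + b) ^ ρ * (a + b * c + b) := by
        rw [mul_comm b (_ ^ ρ), ← mul_add]
        gcongr
        omega

theorem exists_boundFixed_of_odd {n : ℕ} (hn : Odd n) (hn5 : 5 ≤ n) {κ : ℕ} (hκ1 : 1 ≤ κ)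
    (hκ : ∀ (K : Type) [Field K] [NumberField K], ∀ j, 2 ≤ j → j < n → BoundFixed K j κ) :
    ∃ κ' : ℕ, 1 ≤ κ' ∧ ∀ (K : Type) [Field K] [NumberField K], BoundFixed K n κ' := by
  classical
  obtain ⟨κw, Rw, hκw1, hRw1, hw⟩ := AbsSystem.exists_card_le_of_window n
  set R := max Rw (8 * Real.log n) with hR
  obtain ⟨κs, E, hκs1, hs⟩ := AbsSystem.exists_card_le_of_small n (by omega) R
  have hRRw : Rw ≤ R := le_max_left _ _
  have hRlog : 8 * Real.log n ≤ R := le_max_right _ _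
  have hR1 : 1 ≤ R := hRw1.trans hRRw
  set b := 2 ^ n * (n * (2 * (8 * n) + 1)) with hb
  have hb1 : 1 ≤ b := by
    have : 0 < n := by omega
    have : 0 < b := by positivity
    omega
  refine ⟨2 ^ n * κ ^ (n + 4) * (κs + b * κw + b), ?_, ?_⟩
  · have : 0 < 2 ^ n * κ ^ (n + 4) * (κs + b * κw + b) := by positivity
    omega
  intro K _ _ ι _ _ hι T A ρ i₀ c m hT hc hA
  rcases T.eq_empty_or_nonempty with rfl | ⟨x₀, hx₀⟩
  · simp
  obtain ⟨P, _, S, V, hV, hsol, hmem, hE⟩ := hT.exists_absSystem E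
  have hcu : S.IsSUnit c := hc x₀ hx₀ ▸ (hsol x₀ hx₀).unit i₀
  have hcV : S.L c ∈ V := hc x₀ hx₀ ▸ hmem x₀ hx₀ i₀
  have hD := S.one_le_deg
  set B₀ := 2 ^ n * (κ ^ (2 * ρ + n + 4) * m ^ ((n - 5) / 2)) with hB₀
  have hrel : ∀ (T' : Finset (ι → K)) (A' : ι → Finset K) (F : Finset ι) (μ : ℕ), T' ⊆ T →
      (∀ x ∈ T', ∀ i, x i ∈ A' i) → (∀ i, i ≠ i₀ → (A' i).card ≤ m) → i₀ ∉ F → 2 ≤ F.card →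
      (∀ i ∈ F, (A' i).card ≤ μ) → ∀ T₂ ⊆ T', ∀ b : ι → K, (∃ i j, b i ≠ b j) →
      (∀ x ∈ T₂, ∑ i, b i * x i = 0) → T₂.card ≤ B₀ * μ := by
    intro T' A' F μ hT' hmem' hA' hF₀ hF2 hF T₂ hT₂ b hb hbT
    have hfam : IsFam T₂ A' ρ := ⟨fun x hx => hT.nondeg x (hT' (hT₂ hx)),
      fun x hx => hmem' x (hT₂ hx), (hT.mono (hT₂.trans hT')).rank⟩
    have := hfam.card_le_of_relation_of_odd (κ := κ) (by rwa [hι]) (by rwa [hι]) hκ1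
      (fun x hx => hc x (hT' (hT₂ hx))) hA' hF₀ hF2 hF (by rw [hι]; exact hκ K) hb hbT
    rw [hι] at this
    refine this.trans_eq ?_
    rw [hB₀]
    ring
  let small : (ι → K) → Prop := fun x => ∀ i, ‖S.L (x i) - S.L c‖ ≤ R * S.deg
  have hsmall : (T.filter small).card ≤ κs ^ (ρ + 1) * (B₀ * m) := by
    refine hs K P ι hι S V ρ c _ _ ?_ hE fun x hx => (mem_filter.1 hx).2
    have hsub := filter_subset small T
    refine ⟨hV, hcV, fun x hx => hmem x (hsub hx), fun x hx => hsol x (hsub hx), ?_⟩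
    refine hrel _ A (univ.erase i₀) m hsub (fun x hx => hT.mem x (hsub hx)) hA
      (notMem_erase _ _) ?_ (fun i hi => hA i (ne_of_mem_erase hi))
    rw [card_erase_of_mem (mem_univ _), card_univ, hι]
    omega
  set t₀ := R * S.deg with ht₀
  have ht₀0 : 0 < t₀ := by positivity
  have hscale : ∀ x, ¬ small x → ∃ j : ℕ, (∀ i, ‖S.L (x i) - S.L c‖ ≤ 2 * (2 ^ j * t₀)) ∧
      ∃ i, 2 ^ j * t₀ ≤ ‖S.L (x i) - S.L c‖ := by
    intro x hx
    obtain ⟨i, -, hi⟩ := exists_max_image univ (fun i => ‖S.L (x i) - S.L c‖) ⟨i₀, mem_univ _⟩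
    have : t₀ ≤ ‖S.L (x i) - S.L c‖ := by
      by_contra! hlt
      exact hx fun l => (hi l (mem_univ l)).trans hlt.le
    obtain ⟨j, h1, h2⟩ := exists_two_pow_mul_le ht₀0 this
    exact ⟨j, fun l => (hi l (mem_univ l)).trans h2, i, h1⟩
  choose! jm hjm1 hjm2 using hscale
  set T₁ := T.filter fun x => ¬ small x with hT₁
  have hT₁T : T₁ ⊆ T := filter_subset _ _
  let far : ℕ → K → Prop := fun j z => 2 ^ j * t₀ ≤ (8 * n : ℕ) * ‖S.L z - S.L c‖ ∧
    ‖S.L z - S.L c‖ ≤ 2 * (2 ^ j * t₀)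
  let μ : ℕ → ℕ := fun j => ∑ i ∈ univ.erase i₀, ((A i).filter (far j)).card
  let Fx : (ι → K) → Finset ι := fun x => univ.filter fun i =>
    2 ^ jm x * t₀ ≤ (8 * n : ℕ) * ‖S.L (x i) - S.L c‖
  have hclass : ∀ j F, (T₁.filter fun x => jm x = j ∧ Fx x = F).card ≤
      κw ^ ρ * (B₀ * μ j) := by
    intro j F
    set T₂ := T₁.filter fun x => jm x = j ∧ Fx x = F with hT₂
    rcases T₂.eq_empty_or_nonempty with h0 | ⟨x₂, hx₂⟩
    · simp [h0]
    have hT₂T : T₂ ⊆ T := (filter_subset _ _).trans hT₁T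
    have hpos : 0 < 2 ^ j * t₀ := by positivity
    have hle : t₀ ≤ 2 ^ j * t₀ := le_mul_of_one_le_left ht₀0.le (one_le_pow₀ one_le_two)
    have hns : ∀ x ∈ T₂, ¬ small x := fun x hx => (mem_filter.1 (mem_filter.1 hx).1).2
    have hj : ∀ x ∈ T₂, jm x = j := fun x hx => (mem_filter.1 hx).2.1
    have hFx : ∀ x ∈ T₂, ∀ i, i ∈ F ↔ 2 ^ j * t₀ ≤ (8 * n : ℕ) * ‖S.L (x i) - S.L c‖ := by
      intro x hx i
      rw [← (mem_filter.1 hx).2.2, mem_filter, hj x hx]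
      simp
    have hup : ∀ x ∈ T₂, ∀ i, ‖S.L (x i) - S.L c‖ ≤ 2 * (2 ^ j * t₀) := fun x hx i => by
      rw [← hj x hx]
      exact hjm1 x (hns x hx) i
    have hlow : ∀ x ∈ T₂, ∃ i, 2 ^ j * t₀ ≤ ‖S.L (x i) - S.L c‖ := fun x hx => by
      rw [← hj x hx]
      exact hjm2 x (hns x hx)
    have hF₀ : i₀ ∉ F := by
      rw [hFx x₂ hx₂, hc x₂ (hT₂T hx₂), sub_self, norm_zero, mul_zero, not_le]
      exact hpos
    refine hw K P ι hι S V ρ c _ T₂ ?_ (2 ^ j * t₀) ?_ hup ?_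
    · refine ⟨hV, hcV, fun x hx => hmem x (hT₂T hx), fun x hx => hsol x (hT₂T hx), ?_⟩
      refine hrel T₂ (fun i => if i ∈ F then (A i).filter (far j) else A i) F (μ j) hT₂T ?_ ?_
        hF₀ ?_ ?_
      · intro x hx i
        split_ifs with hi
        · exact mem_filter.2 ⟨hT.mem x (hT₂T hx) i, (hFx x hx i).1 hi, hup x hx i⟩
        · exact hT.mem x (hT₂T hx) i
      · intro i hi
        split_ifs
        · exact (card_le_card (filter_subset _ _)).trans (hA i hi)
        · exact hA i hi
      · by_contra! hlt
        obtain ⟨i, hi⟩ := hlow x₂ hx₂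
        have hn1 : (1 : ℝ) ≤ n := by exact_mod_cast (show 1 ≤ n by omega)
        have hiF : i ∈ F := by
          rw [hFx x₂ hx₂]
          push_cast
          nlinarith [norm_nonneg (S.L (x₂ i) - S.L c)]
        have hFi : ∀ l ∈ F, l = i := fun l hl => card_le_one.1 (by omega) l hl i hiF
        have := (hsol x₂ (hT₂T hx₂)).norm_sub_le_of_forall_ne hcu
          (θ := 2 ^ j * t₀ / (8 * n)) (by positivity) (i := i) fun l hl => by
            rw [le_div_iff₀ (by positivity)]
            by_contra! hcon
            refine hl (hFi l ((hFx x₂ hx₂ l).2 ?_))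
            push_cast
            linarith
        rw [hι] at this
        have e : (n : ℝ) * (2 ^ j * t₀ / (8 * n)) = 2 ^ j * t₀ / 8 := by field_simp
        rw [e] at this
        have h3 : S.deg * Real.log n ≤ t₀ / 8 := by
          rw [ht₀]
          nlinarith
        linarith
      · intro i hi
        rw [if_pos hi]
        exact single_le_sum (f := fun i => ((A i).filter (far j)).card) (fun _ _ => Nat.zero_le _)
          (mem_erase.2 ⟨fun h => hF₀ (h ▸ hi), mem_univ i⟩)
    · refine le_trans ?_ hle
      rw [ht₀]
      gcongr
    · intro x hx
      obtain ⟨i, hi⟩ := hlow x hx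
      refine ⟨i, i₀, ?_⟩
      rw [hc x (hT₂T hx)]
      linarith
  have hμ : ∑ j ∈ T₁.image jm, μ j ≤ n * (2 * (8 * n) + 1) * m := by
    have h1 : ∀ i, i ≠ i₀ → ∑ j ∈ T₁.image jm, ((A i).filter (far j)).card ≤
        m * (2 * (8 * n) + 1) := by
      intro i hi
      calc ∑ j ∈ T₁.image jm, ((A i).filter (far j)).card
          = ∑ z ∈ A i, ((T₁.image jm).filter fun j => far j z).card :=
            sum_card_bipartiteAbove_eq_sum_card_bipartiteBelow (fun j z => far j z)
        _ ≤ ∑ z ∈ A i, (2 * (8 * n) + 1) :=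
            sum_le_sum fun z _ => card_filter_two_pow_le ht₀0 (8 * n) _ _
        _ = (A i).card * (2 * (8 * n) + 1) := by rw [sum_const, smul_eq_mul]
        _ ≤ _ := Nat.mul_le_mul_right _ (hA i hi)
    simp only [μ]
    rw [sum_comm]
    calc _ ≤ ∑ i ∈ univ.erase i₀, m * (2 * (8 * n) + 1) :=
          sum_le_sum fun i hi => h1 i (ne_of_mem_erase hi)
      _ = (univ.erase i₀).card * (m * (2 * (8 * n) + 1)) := by rw [sum_const, smul_eq_mul]
      _ ≤ n * (m * (2 * (8 * n) + 1)) := Nat.mul_le_mul_right _ (hι ▸ card_le_univ _)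
      _ = _ := by ring
  have hlarge : T₁.card ≤ b * κw ^ ρ * (B₀ * m) := by
    have hsub : T₁ ⊆ (T₁.image jm).biUnion fun j => univ.biUnion fun F =>
        T₁.filter fun x => jm x = j ∧ Fx x = F := fun x hx =>
      mem_biUnion.2 ⟨jm x, mem_image_of_mem _ hx, mem_biUnion.2 ⟨Fx x, mem_univ _,
        mem_filter.2 ⟨hx, rfl, rfl⟩⟩⟩
    calc T₁.card ≤ ∑ j ∈ T₁.image jm, 2 ^ n * (κw ^ ρ * (B₀ * μ j)) := by
          refine (card_le_card hsub).trans (card_biUnion_le.trans (sum_le_sum fun j _ => ?_))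
          refine (card_biUnion_le_card_mul _ _ _ fun F _ => hclass j F).trans_eq ?_
          rw [card_univ, Fintype.card_finset, hι]
      _ = 2 ^ n * κw ^ ρ * B₀ * ∑ j ∈ T₁.image jm, μ j := by
          rw [mul_sum]
          exact sum_congr rfl fun j _ => by ring
      _ ≤ 2 ^ n * κw ^ ρ * B₀ * (n * (2 * (8 * n) + 1) * m) := Nat.mul_le_mul_left _ hμ
      _ = _ := by rw [hb]; ring
  calc T.card = (T.filter small).card + T₁.card := (card_filter_add_card_filter_not small).symm
    _ ≤ κs ^ (ρ + 1) * (B₀ * m) + b * κw ^ ρ * (B₀ * m) := Nat.add_le_add hsmall hlarge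
    _ = (2 ^ n * κ ^ (2 * ρ + n + 4)) * (κs ^ (ρ + 1) + b * κw ^ ρ) * (m ^ ((n - 5) / 2) * m) := by
        rw [hB₀]
        ring
    _ ≤ (2 ^ n * κ ^ (n + 4)) ^ (ρ + 1) * (κs + b * κw + b) ^ (ρ + 1) *
        (m ^ ((n - 5) / 2) * m) := by
        gcongr ?_ * ?_ * _
        · rw [mul_pow, ← pow_mul, ← pow_mul]
          gcongr
          · norm_num
          · nlinarith
          · nlinarith
        · exact pow_succ_add_mul_pow_le _ _ _ _ hb1
    _ = _ := by
        obtain ⟨k, hk⟩ := hn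
        rw [← mul_pow, ← pow_succ, show (n - 5) / 2 + 1 = (n - 2) / 2 by omega]

/-- The bound for the number of nondegenerate vectors with one prescribed coordinate. -/
theorem exists_boundFixed {n : ℕ} (hn : 2 ≤ n) : ∃ κ : ℕ, 1 ≤ κ ∧
    ∀ (K : Type) [Field K] [NumberField K], BoundFixed K n κ := by
  induction n using Nat.strong_induction_on with
  | _ n ih =>
  choose! κ hκ1 hκ using ih
  set κ₀ := 1 + ∑ j ∈ range n, κ j with hκ₀
  have hκ₀' : ∀ (K : Type) [Field K] [NumberField K], ∀ j, 2 ≤ j → j < n → BoundFixed K j κ₀ := by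
    intro K _ _ j h2 hj
    refine (hκ j hj h2 K).mono ?_
    have := single_le_sum (f := κ) (fun _ _ => Nat.zero_le _) (mem_range.2 hj)
    omega
  obtain rfl | rfl | hn4 : n = 2 ∨ n = 3 ∨ 4 ≤ n := by omega
  · exact ⟨1, le_rfl, fun K _ _ => boundFixed_two⟩
  · exact exists_boundFixed_three
  · rcases Nat.even_or_odd n with he | ho
    · exact ⟨κ₀ ^ 2, Nat.one_le_pow _ _ (by omega), fun K _ _ =>
        boundFixed_of_even hn4 he (by omega) (hκ₀' K (n - 1) (by omega) (by omega))⟩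
    · refine exists_boundFixed_of_odd ho ?_ (κ := κ₀) (by omega) hκ₀'
      obtain ⟨k, hk⟩ := ho
      omega

/-- A bounded monotone sequence doubles rarely. -/
theorem sq_card_filter_two_mul_le {N : ℕ → ℕ} (hN : Monotone N) {M : ℕ} (h1 : ∀ j, 1 ≤ N j)
    (hM : ∀ j, N j ≤ M) (J : Finset ℕ) :
    (J.filter fun j => 2 * N j ≤ N (j + 4)).card ^ 2 ≤ 64 * M := by
  set g := (J.filter fun j => 2 * N j ≤ N (j + 4)).card with hg
  let Ψ : ℕ → ℕ := fun j => N j * N (j + 1) * N (j + 2) * N (j + 3)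
  have hΨ : ∀ j, 2 ^ ((range j).filter fun j => 2 * N j ≤ N (j + 4)).card ≤ Ψ j := by
    intro j
    induction j with
    | zero =>
      have := Nat.mul_pos (Nat.mul_pos (Nat.mul_pos (h1 0) (h1 1)) (h1 2)) (h1 3)
      simp only [range_zero, filter_empty, card_empty, pow_zero]
      exact this
    | succ j ih =>
      rw [range_add_one, filter_insert]
      have e : Ψ (j + 1) = N (j + 4) * (N (j + 1) * N (j + 2) * N (j + 3)) := by
        simp only [Ψ]
        ring
      have e' : Ψ j = N j * (N (j + 1) * N (j + 2) * N (j + 3)) := by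
        simp only [Ψ]
        ring
      rw [e'] at ih
      rw [e]
      split_ifs with h
      · rw [card_insert_of_notMem (by simp), pow_succ]
        calc _ ≤ N j * (N (j + 1) * N (j + 2) * N (j + 3)) * 2 := Nat.mul_le_mul_right _ ih
          _ = 2 * N j * (N (j + 1) * N (j + 2) * N (j + 3)) := by ring
          _ ≤ _ := Nat.mul_le_mul_right _ h
      · exact ih.trans (Nat.mul_le_mul_right _ (hN (by omega)))
  have h2 : 2 ^ g ≤ M ^ 4 := by
    have hsub : J ⊆ range (J.sup id + 1) := fun j hj => mem_range.2
      (Nat.lt_succ_of_le (le_sup (f := id) hj))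
    calc 2 ^ g ≤ Ψ (J.sup id + 1) := (Nat.pow_le_pow_right two_pos
          (card_le_card (filter_subset_filter _ hsub))).trans (hΨ _)
      _ ≤ M * M * M * M := Nat.mul_le_mul (Nat.mul_le_mul (Nat.mul_le_mul (hM _) (hM _)) (hM _))
          (hM _)
      _ = M ^ 4 := by ring
  have h3 : g ≤ 8 * 2 ^ (g / 8) := by
    have := Nat.lt_two_pow_self (n := g / 8)
    omega
  refine (Nat.pow_le_pow_iff_left (n := 4) (by norm_num)).1 ?_
  calc (g ^ 2) ^ 4 = g ^ 8 := by ring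
    _ ≤ (8 * 2 ^ (g / 8)) ^ 8 := Nat.pow_le_pow_left h3 8
    _ = 8 ^ 8 * 2 ^ (g / 8 * 8) := by rw [mul_pow, ← pow_mul]
    _ ≤ 8 ^ 8 * M ^ 4 := Nat.mul_le_mul_left _
        ((Nat.pow_le_pow_right two_pos (Nat.div_mul_le_self g 8)).trans h2)
    _ = (64 * M) ^ 4 := by ring

variable (n : ℕ) in
/-- A bound for the number of nondegenerate vectors. -/
def HasNondegBound (C κ : ℕ) : Prop :=
  ∀ (K : Type) [Field K] [NumberField K] (ι : Type) [Fintype ι] [DecidableEq ι],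
    Fintype.card ι = n → ∀ (T : Finset (ι → K)) (A : ι → Finset K) (ρ m : ℕ), IsFam T A ρ →
      (∀ i, (A i).card ≤ m) → T.card ≤ C * (m ^ (n / 2) + κ ^ (ρ + 1) * m ^ ((n - 1) / 2))

theorem hasNondegBound_aux {n t κs κw ρ m X Y G : ℕ} (hn4 : 4 ≤ n) (hn : Even n)
    (ht : t ≤ κs ^ (ρ + 1) * (X * m ^ ((n - 4) / 2)) * m +
      n * (m * (G * (κw ^ ρ * (X * m ^ ((n - 4) / 2))))))
    (hκw1 : 1 ≤ κw) (hXY : X ≤ Y ^ (ρ + 1)) (hG : G ^ 2 ≤ 64 * (n * m)) :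
    t ≤ (64 * n ^ 3 + 1) * (m ^ (n / 2) +
      (κs * Y + (κw * Y) ^ 2) ^ (ρ + 1) * m ^ ((n - 1) / 2)) := by
  obtain ⟨k, hk⟩ := hn
  have hGm : (n * G) ^ 2 ≤ 64 * n ^ 3 * m := by
    calc (n * G) ^ 2 = n ^ 2 * G ^ 2 := by ring
      _ ≤ n ^ 2 * (64 * (n * m)) := Nat.mul_le_mul_left _ hG
      _ = _ := by ring
  set Z := κw ^ ρ * X with hZ
  have hZ' : Z ≤ (κw * Y) ^ (ρ + 1) := by
    rw [mul_pow]
    exact Nat.mul_le_mul (Nat.pow_le_pow_right hκw1 (Nat.le_succ ρ)) hXY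
  have hZG : n * G * Z ≤ 64 * n ^ 3 * m + ((κw * Y) ^ 2) ^ (ρ + 1) := by
    have h1 : Z ^ 2 ≤ ((κw * Y) ^ 2) ^ (ρ + 1) := by
      rw [← pow_mul, mul_comm 2, pow_mul]
      exact Nat.pow_le_pow_left hZ' 2
    have h2 := two_mul_le_add_sq (n * G) Z
    rw [mul_assoc] at h2
    omega
  have e1 : (n - 1) / 2 = (n - 4) / 2 + 1 := by omega
  have e2 : n / 2 = (n - 4) / 2 + 2 := by omega
  have hpow : κs ^ (ρ + 1) * X + ((κw * Y) ^ 2) ^ (ρ + 1) ≤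
      (κs * Y + (κw * Y) ^ 2) ^ (ρ + 1) := by
    refine le_trans ?_ (pow_add_pow_le (Nat.zero_le _) (Nat.zero_le _) (Nat.succ_ne_zero ρ))
    rw [mul_pow κs]
    gcongr
  set W := (κs * Y + (κw * Y) ^ 2) ^ (ρ + 1) with hW
  set w := m ^ ((n - 4) / 2) with hw
  calc t ≤ (κs ^ (ρ + 1) * X + n * G * Z) * (w * m) := ht.trans_eq (by rw [hZ]; ring)
    _ ≤ (κs ^ (ρ + 1) * X + (64 * n ^ 3 * m + ((κw * Y) ^ 2) ^ (ρ + 1))) * (w * m) := by gcongr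
    _ = 64 * n ^ 3 * (w * m ^ 2) + (κs ^ (ρ + 1) * X + ((κw * Y) ^ 2) ^ (ρ + 1)) * (w * m) := by
        ring
    _ ≤ 64 * n ^ 3 * (w * m ^ 2) + W * (w * m) := by gcongr
    _ ≤ 64 * n ^ 3 * (w * m ^ 2) + W * (w * m) + (w * m ^ 2 + 64 * n ^ 3 * (W * (w * m))) :=
        Nat.le_add_right _ _
    _ = _ := by
        rw [e1, e2, pow_add m, pow_succ m, ← hw]
        ring

theorem exists_hasNondegBound_of_even {n : ℕ} (hn4 : 4 ≤ n) (hn : Even n) :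
    ∃ C κ : ℕ, HasNondegBound n C κ := by
  classical
  have hbf : ∀ j, ∃ κ : ℕ, 2 ≤ j → (1 ≤ κ ∧
      ∀ (K : Type) [Field K] [NumberField K], BoundFixed K j κ) := fun j => by
    by_cases hj : 2 ≤ j
    · obtain ⟨κ, hκ⟩ := exists_boundFixed hj
      exact ⟨κ, fun _ => hκ⟩
    · exact ⟨0, fun h => absurd h hj⟩
  choose κ₁ hκ₁ using hbf
  set κ := 1 + ∑ j ∈ range n, κ₁ j with hκdef
  have hκ1 : 1 ≤ κ := by omega
  have hκ : ∀ (K : Type) [Field K] [NumberField K], ∀ j, 2 ≤ j → j < n → BoundFixed K j κ := by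
    intro K _ _ j h2 hj
    refine ((hκ₁ j h2).2 K).mono ?_
    have := single_le_sum (f := κ₁) (fun _ _ => Nat.zero_le _) (mem_range.2 hj)
    omega
  obtain ⟨κw, R, hκw1, hR1, hw⟩ := AbsSystem.exists_card_le_of_window n
  obtain ⟨κs, E, hκs1, hs⟩ := AbsSystem.exists_card_le_of_small n (by omega) R
  set Y := 2 ^ n * κ ^ (n + 3) with hY
  have hY1 : 1 ≤ Y := by
    have : 0 < Y := by positivity
    omega
  refine ⟨64 * n ^ 3 + 1, κs * Y + (κw * Y) ^ 2, ?_⟩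
  intro K _ _ ι _ _ hι T A ρ m hT hA
  rcases T.eq_empty_or_nonempty with rfl | ⟨x₀, hx₀⟩
  · simp
  obtain ⟨i₀⟩ : Nonempty ι := Fintype.card_pos_iff.1 (by omega)
  obtain ⟨P, _, S, V, hV, hsol, hmem, hE⟩ := hT.exists_absSystem E
  have hD := S.one_le_deg
  set X := 2 ^ n * κ ^ (2 * ρ + n + 3) with hX
  have hXY : X ≤ Y ^ (ρ + 1) := by
    rw [hX, hY, mul_pow, ← pow_mul, ← pow_mul]
    gcongr
    · norm_num
    · nlinarith
    · nlinarith
  have hconf : ∀ T' ⊆ T, ∀ i c, (∀ x ∈ T', x i = c) → T'.Nonempty →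
      S.IsConfig V ρ c (X * m ^ ((n - 4) / 2)) T' := by
    intro T' hT' i c hc ⟨x, hx⟩
    refine ⟨hV, hc x hx ▸ hmem x (hT' hx) i, fun x hx => hmem x (hT' hx),
      fun x hx => hsol x (hT' hx), fun T₂ hT₂ b hb hbT => ?_⟩
    have := (hT.mono (hT₂.trans hT')).card_le_of_relation_of_even (κ := κ) (m := m)
      (by rwa [hι]) (fun x hx => hc x (hT₂ hx)) (fun i _ => hA i) (by rw [hι]; exact hκ K) hb hbT
    rw [hι] at this
    rwa [hX, mul_assoc]
  set t₀ := R * S.deg with ht₀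
  have ht₀0 : 0 < t₀ := by positivity
  let small : (ι → K) → Prop := fun x => ∀ i l, ‖S.L (x i) - S.L (x l)‖ ≤ t₀
  have hsmall : (T.filter small).card ≤ κs ^ (ρ + 1) * (X * m ^ ((n - 4) / 2)) * m := by
    refine (card_le_mul_card_image_of_maps_to (f := fun x : ι → K => x i₀) (t := A i₀)
      (fun x hx => hT.mem x (mem_filter.1 hx).1 i₀) _ fun c _ => ?_).trans
      (Nat.mul_le_mul_left _ (hA i₀))
    set T' := (T.filter small).filter fun x => x i₀ = c with hT'
    rcases T'.eq_empty_or_nonempty with h0 | hne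
    · simp [h0]
    refine hs K P ι hι S V ρ c _ T' (hconf T' ((filter_subset _ _).trans (filter_subset _ _)) i₀ c
      (fun x hx => (mem_filter.1 hx).2) hne) hE fun x hx i => ?_
    rw [← (mem_filter.1 hx).2]
    exact (mem_filter.1 (mem_filter.1 hx).1).2 i i₀
  set 𝒜 := univ.biUnion A with h𝒜
  have h𝒜card : 𝒜.card ≤ n * m := by
    refine (card_biUnion_le_card_mul _ _ m fun i _ => hA i).trans_eq ?_
    rw [card_univ, hι]
  let near : K → ℕ → Finset K := fun z j => 𝒜.filter fun y => ‖S.L y - S.L z‖ ≤ 2 ^ j * t₀ / 4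
  have hnear : ∀ z, Monotone (near z) := fun z j j' hj => by
    intro y hy
    obtain ⟨h1, h2⟩ := mem_filter.1 hy
    refine mem_filter.2 ⟨h1, h2.trans ?_⟩
    have : (2 : ℝ) ^ j ≤ 2 ^ j' := pow_le_pow_right₀ one_le_two hj
    gcongr
  let cls : ι → K → ℕ → Finset (ι → K) := fun i c j => T.filter fun x => x i = c ∧
    (∀ a b, ‖S.L (x a) - S.L (x b)‖ ≤ 2 * (2 ^ j * t₀)) ∧
    ∃ a b, 2 ^ j * t₀ ≤ ‖S.L (x a) - S.L (x b)‖
  have hcls : ∀ i c j, (cls i c j).card ≤ κw ^ ρ * (X * m ^ ((n - 4) / 2)) := by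
    intro i c j
    have hle : t₀ ≤ 2 ^ j * t₀ := le_mul_of_one_le_left ht₀0.le (one_le_pow₀ one_le_two)
    rcases (cls i c j).eq_empty_or_nonempty with h0 | hne
    · simp [h0]
    refine hw K P ι hι S V ρ c _ _ (hconf _ (filter_subset _ _) i c
      (fun x hx => (mem_filter.1 hx).2.1) hne) (2 ^ j * t₀) hle (fun x hx l => ?_)
      fun x hx => ?_
    · obtain ⟨-, hxi, h, -⟩ := mem_filter.1 hx
      rw [← hxi]
      exact h l i
    · obtain ⟨-, -, -, a, b, h⟩ := mem_filter.1 hx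
      exact ⟨a, b, by linarith⟩
  have hscale : ∀ x, ¬ small x → ∃ j : ℕ,
      (∀ a b, ‖S.L (x a) - S.L (x b)‖ ≤ 2 * (2 ^ j * t₀)) ∧
      ∃ a b, 2 ^ j * t₀ ≤ ‖S.L (x a) - S.L (x b)‖ := by
    intro x hx
    obtain ⟨p, -, hp⟩ := exists_max_image univ (fun p : ι × ι => ‖S.L (x p.1) - S.L (x p.2)‖)
      ⟨(i₀, i₀), mem_univ _⟩
    have : t₀ ≤ ‖S.L (x p.1) - S.L (x p.2)‖ := by
      by_contra! hlt
      exact hx fun a b => (hp (a, b) (mem_univ _)).trans hlt.le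
    obtain ⟨j, h1, h2⟩ := exists_two_pow_mul_le ht₀0 this
    exact ⟨j, fun a b => (hp (a, b) (mem_univ _)).trans h2, p.1, p.2, h1⟩
  choose! jm hjm1 hjm2 using hscale
  set T₁ := T.filter fun x => ¬ small x with hT₁
  set G := Nat.sqrt (64 * (n * m)) with hG
  let good : K → Finset ℕ := fun c =>
    (T₁.image jm).filter fun j => 2 * (near c j).card ≤ (near c (j + 4)).card
  have hgood : ∀ c ∈ 𝒜, (good c).card ≤ G := by
    intro c hc
    rw [hG, Nat.le_sqrt']
    refine sq_card_filter_two_mul_le (N := fun j => (near c j).card)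
      (fun j j' hj => card_le_card (hnear c hj)) (fun j => card_pos.2 ⟨c, mem_filter.2 ⟨hc, ?_⟩⟩)
      (fun j => (card_le_card (filter_subset _ _)).trans h𝒜card) _
    rw [sub_self, norm_zero]
    positivity
  have hcover : T₁ ⊆ univ.biUnion fun i => (A i).biUnion fun c => (good c).biUnion fun j =>
      cls i c j := by
    intro x hx
    obtain ⟨hxT, hns⟩ := mem_filter.1 hx
    have h1 := hjm1 x hns
    obtain ⟨a, b, hab⟩ := hjm2 x hns
    set j := jm x with hj
    have hpos : 0 < 2 ^ j * t₀ := by positivity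
    obtain ⟨i, -, hi⟩ := exists_min_image univ (fun i => (near (x i) j).card) ⟨i₀, mem_univ _⟩
    refine mem_biUnion.2 ⟨i, mem_univ _, mem_biUnion.2 ⟨x i, hT.mem x hxT i, mem_biUnion.2
      ⟨j, mem_filter.2 ⟨mem_image_of_mem _ hx, ?_⟩, mem_filter.2 ⟨hxT, rfl, h1, a, b, hab⟩⟩⟩⟩
    have hdisj : Disjoint (near (x a) j) (near (x b) j) := by
      rw [disjoint_left]
      intro y hya hyb
      have ha := (mem_filter.1 hya).2
      have hb := (mem_filter.1 hyb).2
      have e : S.L (x a) - S.L (x b) = (S.L y - S.L (x b)) - (S.L y - S.L (x a)) := by abel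
      rw [e] at hab
      linarith [norm_sub_le (S.L y - S.L (x b)) (S.L y - S.L (x a))]
    have hsub : ∀ a, near (x a) j ⊆ near (x i) (j + 4) := by
      intro a y hy
      obtain ⟨hy𝒜, hya⟩ := mem_filter.1 hy
      refine mem_filter.2 ⟨hy𝒜, ?_⟩
      have e : S.L y - S.L (x i) = (S.L y - S.L (x a)) + (S.L (x a) - S.L (x i)) := by abel
      rw [e, pow_add]
      linarith [norm_add_le (S.L y - S.L (x a)) (S.L (x a) - S.L (x i)), h1 a i]
    calc 2 * (near (x i) j).card ≤ (near (x a) j).card + (near (x b) j).card := by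
          have := hi a (mem_univ _)
          have := hi b (mem_univ _)
          omega
      _ = (near (x a) j ∪ near (x b) j).card := (card_union_of_disjoint hdisj).symm
      _ ≤ _ := card_le_card (union_subset (hsub a) (hsub b))
  have hlarge : T₁.card ≤ n * (m * (G * (κw ^ ρ * (X * m ^ ((n - 4) / 2))))) := by
    refine (card_le_card hcover).trans ?_
    have hu : (univ : Finset ι).card = n := by rw [card_univ, hι]
    rw [← hu]
    refine card_biUnion_le_card_mul _ _ _ fun i _ => ?_
    rw [hu]
    refine (card_biUnion_le_card_mul _ _ _ fun c hc => ?_).trans (Nat.mul_le_mul_right _ (hA i))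
    exact (card_biUnion_le_card_mul _ _ _ fun j _ => hcls i c j).trans (Nat.mul_le_mul_right _ (hgood c (mem_biUnion.2 ⟨i, mem_univ _, hc⟩)))
  refine hasNondegBound_aux hn4 hn (?_ : T.card ≤ κs ^ (ρ + 1) * (X * m ^ ((n - 4) / 2)) * m +
    n * (m * (G * (κw ^ ρ * (X * m ^ ((n - 4) / 2)))))) hκw1 hXY (Nat.sqrt_le' _)
  calc T.card = (T.filter small).card + T₁.card := (card_filter_add_card_filter_not small).symm
    _ ≤ _ := Nat.add_le_add hsmall hlarge

theorem exists_hasNondegBound (n : ℕ) (hn : 1 ≤ n) : ∃ C κ : ℕ, HasNondegBound n C κ := by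
  classical
  rcases Nat.even_or_odd n with he | ho
  · obtain rfl | hn4 : n = 2 ∨ 4 ≤ n := by
      obtain ⟨k, hk⟩ := he
      omega
    · refine ⟨1, 1, fun K _ _ ι _ _ hι T A ρ m hT hA => ?_⟩
      obtain ⟨i₀⟩ : Nonempty ι := Fintype.card_pos_iff.1 (by omega)
      have := card_le_mul_card_image_of_maps_to (f := fun x : ι → K => x i₀) (t := A i₀)
        (fun x hx => hT.mem x hx i₀) 1 fun c _ => by
          simpa using boundFixed_two ι hι _ A ρ i₀ c m (hT.mono (filter_subset (fun x => x i₀ = c) T))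
            (fun x hx => (mem_filter.1 hx).2) fun i _ => hA i
      have := hA i₀
      norm_num
      omega
    · exact exists_hasNondegBound_of_even hn4 he
  · obtain rfl | hn3 : n = 1 ∨ 3 ≤ n := by
      obtain ⟨k, hk⟩ := ho
      omega
    · refine ⟨1, 1, fun K _ _ ι _ _ hι T A ρ m hT hA => ?_⟩
      have : T = ∅ := eq_empty_of_forall_notMem fun x hx => by
        obtain ⟨i₀, hi₀⟩ := Fintype.card_eq_one_iff.1 hι
        have h := (hT.nondeg x hx).sum
        rw [sum_eq_single i₀ (fun b _ hb => absurd (hi₀ b) hb) (by simp)] at h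
        exact (hT.nondeg x hx).ne_zero i₀ h
      simp [this]
    · obtain ⟨κ, hκ1, hκ⟩ := exists_boundFixed (n := n) (by omega)
      refine ⟨1, κ, fun K _ _ ι _ _ hι T A ρ m hT hA => ?_⟩
      obtain ⟨i₀⟩ : Nonempty ι := Fintype.card_pos_iff.1 (by omega)
      have := card_le_mul_card_image_of_maps_to (f := fun x : ι → K => x i₀) (t := A i₀)
        (fun x hx => hT.mem x hx i₀) _ fun c _ => hκ K ι hι _ A ρ i₀ c m
          (hT.mono (filter_subset (fun x => x i₀ = c) T)) (fun x hx => (mem_filter.1 hx).2)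
          fun i _ => hA i
      have h2 := this.trans (Nat.mul_le_mul_left _ (hA i₀))
      obtain ⟨k, hk⟩ := ho
      rw [mul_assoc, ← pow_succ, show (n - 2) / 2 + 1 = (n - 1) / 2 by omega] at h2
      omega

section Counting

variable {K ι : Type} [Field K] [Fintype ι]

open scoped Classical in
/-- Solutions of a homogeneous linear equation with unknowns in `B`. -/
noncomputable def linearSolutions (B : Finset K) (a : ι → K) :
    Finset (ι → K) :=
  (Fintype.piFinset fun _ => B).filter fun x => ∑ i, a i * x i = 0

open scoped Classical in
/-- Solutions of a homogeneous linear equation without proper vanishing subsums. -/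
noncomputable def minimalSolutions (B : Finset K) (a : ι → K) :
    Finset (ι → K) :=
  (linearSolutions B a).filter fun x =>
    ∀ s : Finset ι, s.Nonempty → ∑ i ∈ s, a i * x i = 0 → s = univ

variable {B : Finset K} {a : ι → K}

theorem mem_linearSolutions {x : ι → K} :
    x ∈ linearSolutions B a ↔ (∀ i, x i ∈ B) ∧ ∑ i, a i * x i = 0 := by
  classical simp [linearSolutions]

theorem mem_minimalSolutions {x : ι → K} :
    x ∈ minimalSolutions B a ↔ ((∀ i, x i ∈ B) ∧ ∑ i, a i * x i = 0) ∧
      ∀ s : Finset ι, s.Nonempty → ∑ i ∈ s, a i * x i = 0 → s = univ := by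
  classical simp [minimalSolutions, mem_linearSolutions]

theorem card_linearSolutions_le_sum [DecidableEq ι] (i₀ : ι) :
    (linearSolutions B a).card ≤ ∑ J ∈ (univ : Finset (Finset ι)).filter (i₀ ∈ ·),
      (minimalSolutions B fun i : {i // i ∈ J} => a i).card *
        (linearSolutions B fun i : {i // i ∉ J} => a i).card := by
  classical
  let F : Finset ι → Finset (ι → K) := fun J => (linearSolutions B a).filter fun x =>
    (fun i : {i // i ∈ J} => x i) ∈ minimalSolutions B (fun i : {i // i ∈ J} => a i) ∧
    (fun i : {i // i ∉ J} => x i) ∈ linearSolutions B (fun i : {i // i ∉ J} => a i)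
  have hsub : linearSolutions B a ⊆ ((univ : Finset (Finset ι)).filter (i₀ ∈ ·)).biUnion F := by
    intro x hx
    obtain ⟨h1, h2⟩ := mem_linearSolutions.1 hx
    obtain ⟨J, hJ, hmin⟩ := exists_min_image
      ((univ : Finset (Finset ι)).filter fun J => i₀ ∈ J ∧ ∑ i ∈ J, a i * x i = 0) card
      ⟨univ, by simp [h2]⟩
    obtain ⟨-, hi, hs⟩ := mem_filter.1 hJ
    refine mem_biUnion.2 ⟨J, by simp [hi], mem_filter.2 ⟨hx, ?_, ?_⟩⟩
    · refine mem_minimalSolutions.2 ⟨⟨fun i => h1 i, ?_⟩, ?_⟩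
      · rw [← hs]; exact (sum_coe_sort J fun i => a i * x i)
      · intro s hsne h0
        have hm : ∑ i ∈ s.map (Function.Embedding.subtype _), a i * x i = 0 := by
          rw [sum_map]; exact h0
        have hsJ : s.map (Function.Embedding.subtype _) ⊆ J := by
          intro i hi
          obtain ⟨j, -, rfl⟩ := Finset.mem_map.1 hi
          exact j.2
        by_cases hin : i₀ ∈ s.map (Function.Embedding.subtype _)
        · have := hmin _ (mem_filter.2 ⟨mem_univ _, hin, hm⟩)
          have he := eq_of_subset_of_card_le hsJ this
          refine eq_univ_iff_forall.2 fun j => ?_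
          have : (j : ι) ∈ s.map (Function.Embedding.subtype _) := by rw [he]; exact j.2
          simpa using this
        · exfalso
          have hd : ∑ i ∈ J \ s.map (Function.Embedding.subtype _), a i * x i = 0 := by
            have := sum_sdiff (f := fun i => a i * x i) hsJ
            rw [hm, hs, add_zero] at this
            exact this
          have := hmin (J \ s.map (Function.Embedding.subtype _))
            (mem_filter.2 ⟨mem_univ _, mem_sdiff.2 ⟨hi, hin⟩, hd⟩)
          rw [card_sdiff_of_subset hsJ, card_map] at this
          have h5 := hsne.card_pos
          have h6 := card_le_card hsJ
          rw [card_map] at h6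
          omega
    · refine mem_linearSolutions.2 ⟨fun i => h1 i, ?_⟩
      have h7 : ∑ i : {i // i ∉ J}, a i * x i = ∑ i ∈ Jᶜ, a i * x i :=
        (sum_subtype Jᶜ (fun i => mem_compl) fun i => a i * x i).symm
      have h8 := sum_add_sum_compl J fun i => a i * x i
      rw [h2, hs, zero_add] at h8
      exact h7.trans h8
  refine (card_le_card hsub).trans (card_biUnion_le.trans (sum_le_sum fun J _ => ?_))
  rw [← card_product]
  refine card_le_card_of_injOn
    (fun x => (fun i : {i // i ∈ J} => x i, fun i : {i // i ∉ J} => x i)) ?_ ?_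
  · intro x hx
    exact mem_coe.2 (mem_product.2 (mem_filter.1 hx).2)
  · intro x _ y _ hxy
    obtain ⟨h1, h2⟩ := Prod.mk.inj hxy
    funext i
    by_cases hi : i ∈ J
    · exact congrFun h1 ⟨i, hi⟩
    · exact congrFun h2 ⟨i, hi⟩

theorem card_minimalSolutions_le [NumberField K] [DecidableEq ι] {C κ ρ : ℕ}
    (h : HasNondegBound (Fintype.card ι) C κ) (hB : ∀ z ∈ B, z ≠ 0) (hρ : RankLE (B : Set K) ρ)
    (ha : ∀ i, a i ≠ 0) :
    (minimalSolutions B a).card ≤ C * (B.card ^ (Fintype.card ι / 2) +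
      κ ^ (ρ + Fintype.card ι + 1) * B.card ^ ((Fintype.card ι - 1) / 2)) := by
  classical
  have hinj : Function.Injective fun (x : ι → K) i => a i * x i := fun x y hxy =>
    funext fun i => mul_left_cancel₀ (ha i) (congrFun hxy i)
  rw [← card_image_of_injective _ hinj]
  refine h K ι rfl _ (fun i => B.image (a i * ·)) _ _ ⟨?_, ?_, ?_⟩ fun i => card_image_le
  · intro y hy
    obtain ⟨x, hx, rfl⟩ := mem_image.1 hy
    obtain ⟨⟨h1, h2⟩, h3⟩ := mem_minimalSolutions.1 hx
    exact ⟨fun i => mul_ne_zero (ha i) (hB _ (h1 i)), h2, h3⟩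
  · intro y hy i
    obtain ⟨x, hx, rfl⟩ := mem_image.1 hy
    exact mem_image_of_mem _ ((mem_minimalSolutions.1 hx).1.1 i)
  · refine (hρ.mul_finset (univ.image a) ?_ ?_).mono (Set.Subset.refl _)
      (Nat.add_le_add_left card_image_le _)
    · intro g hg
      obtain ⟨i, -, rfl⟩ := mem_image.1 hg
      exact ha i
    · rintro y ⟨z, hz, i, rfl⟩
      obtain ⟨x, hx, rfl⟩ := mem_image.1 hz
      exact Or.inr (Or.inr ⟨a i, mem_image_of_mem _ (mem_univ i), x i,
        mem_coe.2 ((mem_minimalSolutions.1 hx).1.1 i), rfl⟩)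

theorem split_bound {m Q j l : ℕ} (hm : 1 ≤ m) (hQ : 1 ≤ Q) (hj : 1 ≤ j) :
    (m ^ (j / 2) + Q ^ j * m ^ ((j - 1) / 2)) * (m ^ (l / 2) + Q ^ l * m ^ ((l - 1) / 2)) ≤
      4 * (m ^ ((j + l) / 2) + Q ^ (j + l) * m ^ ((j + l - 1) / 2)) := by
  have hmp : ∀ {s t : ℕ}, s ≤ t → m ^ s ≤ m ^ t := fun h => Nat.pow_le_pow_right hm h
  have hQp : ∀ {s t : ℕ}, s ≤ t → Q ^ s ≤ Q ^ t := fun h => Nat.pow_le_pow_right hQ h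
  rcases Nat.eq_zero_or_pos l with rfl | hl
  · simp only [Nat.zero_div, pow_zero, one_mul, Nat.zero_sub, add_zero]
    omega
  · have h1 : m ^ (j / 2 + l / 2) ≤ m ^ ((j + l) / 2) := hmp (by omega)
    have h2 : Q ^ l * m ^ (j / 2 + (l - 1) / 2) ≤ Q ^ (j + l) * m ^ ((j + l - 1) / 2) :=
      Nat.mul_le_mul (hQp (by omega)) (hmp (by omega))
    have h3 : Q ^ j * m ^ ((j - 1) / 2 + l / 2) ≤ Q ^ (j + l) * m ^ ((j + l - 1) / 2) :=
      Nat.mul_le_mul (hQp (by omega)) (hmp (by omega))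
    have h4 : Q ^ (j + l) * m ^ ((j - 1) / 2 + (l - 1) / 2) ≤
        Q ^ (j + l) * m ^ ((j + l - 1) / 2) :=
      Nat.mul_le_mul le_rfl (hmp (by omega))
    calc _ = m ^ (j / 2 + l / 2) + Q ^ l * m ^ (j / 2 + (l - 1) / 2) +
          Q ^ j * m ^ ((j - 1) / 2 + l / 2) +
          Q ^ (j + l) * m ^ ((j - 1) / 2 + (l - 1) / 2) := by ring
      _ ≤ _ := by omega

theorem exists_card_linearSolutions_le (n : ℕ) :
    ∃ C κ : ℕ, 1 ≤ κ ∧ ∀ (K : Type) [Field K] [NumberField K] (B : Finset K) (ρ : ℕ),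
      (∀ z ∈ B, z ≠ 0) → RankLE (B : Set K) ρ → 1 ≤ B.card → ∀ N, n ≤ N →
      ∀ (ι : Type) [Fintype ι], Fintype.card ι = n → ∀ a : ι → K, (∀ i, a i ≠ 0) →
        (linearSolutions B a).card ≤
          C * (B.card ^ (n / 2) + (κ ^ (ρ + N + 1)) ^ n * B.card ^ ((n - 1) / 2)) := by
  classical
  induction n using Nat.strong_induction_on with
  | _ n ih =>
  choose! C κ hκ hb using ih
  rcases Nat.eq_zero_or_pos n with rfl | hn
  · refine ⟨1, 1, le_rfl, fun K _ _ B ρ _ _ _ N _ ι _ hι a _ => ?_⟩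
    have : IsEmpty ι := Fintype.card_eq_zero_iff.1 hι
    have h : (linearSolutions B a).card ≤ 1 := card_le_one.2 fun x _ y _ => Subsingleton.elim x y
    simp
    omega
  choose! C' κ' hb' using exists_hasNondegBound
  let D : ℕ := ∑ i ∈ range n, C i
  let D' : ℕ := ∑ i ∈ range (n + 1), C' i
  let k : ℕ := 1 + (∑ i ∈ range n, κ i + ∑ i ∈ range (n + 1), κ' i)
  have hD : ∀ i < n, C i ≤ D := fun i hi =>
    single_le_sum (f := C) (fun _ _ => Nat.zero_le _) (mem_range.2 hi)
  have hD' : ∀ i ≤ n, C' i ≤ D' := fun i hi =>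
    single_le_sum (f := C') (fun _ _ => Nat.zero_le _) (mem_range.2 (by omega))
  have hk : ∀ i < n, κ i ≤ k := fun i hi => by
    have := single_le_sum (f := κ) (fun _ _ => Nat.zero_le _) (mem_range.2 hi)
    simp only [k]; omega
  have hk' : ∀ i ≤ n, κ' i ≤ k := fun i hi => by
    have := single_le_sum (f := κ') (s := range (n + 1)) (fun _ _ => Nat.zero_le _)
      (mem_range.2 (Nat.lt_succ_of_le hi))
    simp only [k]; omega
  have hk1 : 1 ≤ k := Nat.le_add_right _ _
  refine ⟨2 ^ n * (D' * D * 4), k, hk1, fun K _ _ B ρ hB hρ hm N hN ι _ hι a ha => ?_⟩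
  obtain ⟨i₀⟩ : Nonempty ι := Fintype.card_pos_iff.1 (by omega)
  set m := B.card
  set Q := k ^ (ρ + N + 1) with hQ
  have hQ1 : 1 ≤ Q := Nat.one_le_pow _ _ hk1
  set R := m ^ (n / 2) + Q ^ n * m ^ ((n - 1) / 2) with hR
  have hterm : ∀ J ∈ (univ : Finset (Finset ι)).filter (i₀ ∈ ·),
      (minimalSolutions B fun i : {i // i ∈ J} => a i).card *
        (linearSolutions B fun i : {i // i ∉ J} => a i).card ≤ D' * D * (4 * R) := by
    intro J hJ
    have hi : i₀ ∈ J := (mem_filter.1 hJ).2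
    have hJ1 : 1 ≤ J.card := card_pos.2 ⟨i₀, hi⟩
    have hJn : J.card ≤ n := hι ▸ card_le_univ J
    have hcJ : Fintype.card {i // i ∈ J} = J.card := Fintype.card_coe J
    have hcJ' : Fintype.card {i // i ∉ J} = n - J.card := by
      rw [Fintype.card_subtype_compl, hι, hcJ]
    have hA := card_minimalSolutions_le (a := fun i : {i // i ∈ J} => a i)
      (hcJ.symm ▸ hb' J.card hJ1) hB hρ fun i => ha i
    rw [hcJ] at hA
    have hA' : (minimalSolutions B fun i : {i // i ∈ J} => a i).card ≤
        D' * (m ^ (J.card / 2) + Q ^ J.card * m ^ ((J.card - 1) / 2)) := by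
      have hq : κ' J.card ^ (ρ + J.card + 1) ≤ Q ^ J.card := calc
        κ' J.card ^ (ρ + J.card + 1) ≤ k ^ (ρ + J.card + 1) := Nat.pow_le_pow_left (hk' _ hJn) _
        _ ≤ Q := Nat.pow_le_pow_right hk1 (by omega)
        _ ≤ Q ^ J.card := Nat.le_self_pow (by omega) _
      refine hA.trans (Nat.mul_le_mul (hD' _ hJn) ?_)
      gcongr
    have hE := hb (n - J.card) (by omega) K B ρ hB hρ hm N (by omega) _ hcJ'
      (fun i : {i // i ∉ J} => a i) fun i => ha i
    have hE' : (linearSolutions B fun i : {i // i ∉ J} => a i).card ≤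
        D * (m ^ ((n - J.card) / 2) + Q ^ (n - J.card) * m ^ ((n - J.card - 1) / 2)) := by
      refine hE.trans (Nat.mul_le_mul (hD _ (by omega)) ?_)
      have := hk (n - J.card) (by omega)
      simp only [hQ]
      gcongr
    have hS := split_bound (l := n - J.card) hm hQ1 hJ1
    rw [Nat.add_sub_cancel' hJn] at hS
    calc _ ≤ _ := Nat.mul_le_mul hA' hE'
      _ = D' * D * ((m ^ (J.card / 2) + Q ^ J.card * m ^ ((J.card - 1) / 2)) *
          (m ^ ((n - J.card) / 2) + Q ^ (n - J.card) * m ^ ((n - J.card - 1) / 2))) := by ring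
      _ ≤ _ := Nat.mul_le_mul le_rfl hS
  calc (linearSolutions B a).card
      ≤ ∑ J ∈ (univ : Finset (Finset ι)).filter (i₀ ∈ ·),
        (minimalSolutions B fun i : {i // i ∈ J} => a i).card *
          (linearSolutions B fun i : {i // i ∉ J} => a i).card := card_linearSolutions_le_sum i₀
    _ ≤ ((univ : Finset (Finset ι)).filter (i₀ ∈ ·)).card • (D' * D * (4 * R)) :=
        sum_le_card_nsmul _ _ _ hterm
    _ ≤ 2 ^ n * (D' * D * (4 * R)) := by
        rw [smul_eq_mul]
        refine Nat.mul_le_mul ((card_filter_le _ _).trans ?_) le_rfl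
        simp [hι]
    _ = _ := by ring

end Counting

section Specialization

theorem exists_ringHom_numberField (F : Finset ℂ) :
    ∃ (K : Type) (_ : Field K) (_ : NumberField K),
      Nonempty (Algebra.adjoin ℚ (F : Set ℂ) →+* K) := by
  let R := Algebra.adjoin ℚ (F : Set ℂ)
  have hR : Algebra.FiniteType ℚ R := R.fg_iff_finiteType.1 (Subalgebra.fg_adjoin_finset F)
  obtain ⟨M, hM⟩ := Ideal.exists_maximal R
  let _ : Field (R ⧸ M) := Ideal.Quotient.field M
  have hfin : Module.Finite ℚ (R ⧸ M) := finite_of_finite_type_of_isJacobsonRing ℚ (R ⧸ M)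
  have hchar : CharZero (R ⧸ M) := algebraRat.charZero _
  exact ⟨R ⧸ M, inferInstance,
    { to_charZero := hchar, to_finiteDimensional := by convert hfin; exact Subsingleton.elim _ _ }, ⟨Ideal.Quotient.mk M⟩⟩

theorem zpow_sum_of_ne_zero {K ι : Type*} [Field K] {g : K} (hg : g ≠ 0) (s : Finset ι)
    (e : ι → ℤ) : g ^ ∑ i ∈ s, e i = ∏ i ∈ s, g ^ e i := by
  classical
  induction s using Finset.induction_on with
  | empty => simp
  | insert i s hi ih => rw [sum_insert hi, prod_insert hi, zpow_add₀ hg, ih]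

/-- Finitely many multiplicative relations between complex numbers can be realized in a number
field. -/
theorem exists_specialization {r : ℕ} (B : Finset ℂ) (hB : ∀ x ∈ B, x ≠ 0) (z : Fin r → ℂ)
    (hz : ∀ i, z i ≠ 0)
    (hBz : ∀ x ∈ B, ∃ N : ℕ, N ≠ 0 ∧ ∃ e : Fin r → ℤ, x ^ N = ∏ i, z i ^ e i) :
    ∃ (K : Type) (_ : Field K) (_ : NumberField K) (f : ℂ → K), Set.InjOn f B ∧
      (∀ x ∈ B, f x ≠ 0) ∧ RankLE (Set.image f (B : Set ℂ)) r ∧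
      ∀ (ι : Type) [Fintype ι] (a : ι → ℤ) (x : ι → ℂ), (∀ i, x i ∈ B) →
        ∑ i, (a i : ℂ) * x i = 0 → ∑ i, (a i : K) * f (x i) = 0 := by
  classical
  let F : Finset ℂ := (B ∪ univ.image z) ∪ (B ∪ univ.image z).image (·⁻¹) ∪
    (B ×ˢ B).image fun p => (p.1 - p.2)⁻¹
  obtain ⟨K, hK, hNF, ⟨φ⟩⟩ := exists_ringHom_numberField F
  let R := Algebra.adjoin ℚ (F : Set ℂ)
  have hF : ∀ x ∈ F, x ∈ R := fun x hx => Algebra.subset_adjoin hx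
  have hBR : ∀ x ∈ B, x ∈ R := fun x hx => hF x (by simp [F, hx])
  have hBR' : ∀ x ∈ B, x⁻¹ ∈ R := fun x hx => hF _ (by simp [F, hx])
  have hzR : ∀ i, z i ∈ R := fun i => hF _ (by simp [F])
  have hzR' : ∀ i, (z i)⁻¹ ∈ R := fun i => hF _ (by simp [F])
  have hdR : ∀ x ∈ B, ∀ y ∈ B, (x - y)⁻¹ ∈ R := fun x hx y hy => hF _ <|
    mem_union_right _ (mem_image.2 ⟨(x, y), mem_product.2 ⟨hx, hy⟩, rfl⟩)
  let f : ℂ → K := fun x => if hx : x ∈ R then φ ⟨x, hx⟩ else 0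
  have hf : ∀ x : R, f x = φ x := fun x => by simp [f]
  have hmul : ∀ x ∈ R, ∀ y ∈ R, f (x * y) = f x * f y := fun x hx y hy => by
    have := map_mul φ ⟨x, hx⟩ ⟨y, hy⟩
    rwa [← hf, ← hf, ← hf] at this
  have hone : f 1 = 1 := (hf 1).trans (map_one φ)
  have hne : ∀ x ∈ R, x⁻¹ ∈ R → x ≠ 0 → f x ≠ 0 := fun x hx hx' h0 h => by
    have := hmul x hx _ hx'
    rw [mul_inv_cancel₀ h0, hone, h, zero_mul] at this
    exact one_ne_zero this
  have hpow : ∀ x ∈ R, ∀ k : ℕ, f (x ^ k) = f x ^ k := fun x hx k => by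
    have := map_pow φ ⟨x, hx⟩ k
    rwa [← hf, ← hf] at this
  have hinv : ∀ x ∈ R, x⁻¹ ∈ R → x ≠ 0 → f x⁻¹ = (f x)⁻¹ := fun x hx hx' h0 => by
    refine eq_inv_of_mul_eq_one_right ?_
    rw [← hmul x hx _ hx', mul_inv_cancel₀ h0, hone]
  have hzpow : ∀ x ∈ R, x⁻¹ ∈ R → x ≠ 0 → ∀ k : ℤ, x ^ k ∈ R ∧ f (x ^ k) = f x ^ k := by
    intro x hx hx' h0 k
    obtain ⟨k, rfl | rfl⟩ := k.eq_nat_or_neg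
    · simp only [zpow_natCast]
      exact ⟨pow_mem hx k, hpow x hx k⟩
    · simp only [zpow_neg, zpow_natCast, ← inv_pow]
      exact ⟨pow_mem hx' k, by rw [hpow _ hx', hinv x hx hx' h0]⟩
  have hprod : ∀ (e : Fin r → ℤ) (s : Finset (Fin r)),
      ∏ i ∈ s, z i ^ e i ∈ R ∧ f (∏ i ∈ s, z i ^ e i) = ∏ i ∈ s, f (z i) ^ e i := by
    intro e s
    have hi := fun i => hzpow (z i) (hzR i) (hzR' i) (hz i) (e i)
    induction s using Finset.induction_on with
    | empty => exact ⟨by simp, by simpa using hone⟩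
    | insert i s his ih =>
      rw [prod_insert his, prod_insert his]
      exact ⟨mul_mem (hi i).1 ih.1, by rw [hmul _ (hi i).1 _ ih.1, (hi i).2, ih.2]⟩
  have hz0 : ∀ i, f (z i) ≠ 0 := fun i => hne _ (hzR i) (hzR' i) (hz i)
  refine ⟨K, hK, hNF, f, ?_, fun x hx => hne x (hBR x hx) (hBR' x hx) (hB x hx), ?_, ?_⟩
  · intro x hx y hy hxy
    by_contra hxy'
    refine hne _ (sub_mem (hBR x hx) (hBR y hy)) (hdR x hx y hy) (sub_ne_zero.2 hxy') ?_
    have := map_sub φ ⟨x, hBR x hx⟩ ⟨y, hBR y hy⟩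
    rw [← hf, ← hf, ← hf, sub_eq_zero.2 hxy] at this
    exact this
  · refine ⟨univ.image fun i => f (z i), card_image_le.trans (by simp), ?_, ?_⟩
    · intro g hg
      obtain ⟨i, -, rfl⟩ := mem_image.1 hg
      exact hz0 i
    · rintro _ ⟨x, hx, rfl⟩
      obtain ⟨N, hN, e, he⟩ := hBz x hx
      refine ⟨N, hN, fun g => ∑ i with f (z i) = g, e i, ?_⟩
      rw [← hpow x (hBR x hx), he, (hprod e univ).2,
        ← prod_fiberwise_of_maps_to (g := fun i => f (z i)) (t := univ.image fun i => f (z i))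
          fun i hi => mem_image_of_mem _ hi]
      refine prod_congr rfl fun g hg => ?_
      obtain ⟨j, -, rfl⟩ := mem_image.1 hg
      rw [zpow_sum_of_ne_zero (hz0 j)]
      exact prod_congr rfl fun i hi => by rw [(mem_filter.1 hi).2]
  · intro ι _ a x hx h
    have h1 : ∑ i, (a i : R) * (⟨x i, hBR _ (hx i)⟩ : R) = 0 := by
      apply Subtype.ext
      push_cast
      exact h
    have h2 := congrArg φ h1
    rw [map_sum, map_zero] at h2
    rw [← h2]
    refine sum_congr rfl fun i _ => ?_
    rw [map_mul, map_intCast, ← hf]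

/-- Elements of an abelian group depend on a maximal independent tuple. -/
theorem exists_pow_eq_prod {G : Type*} [CommGroup G] {Γ : Subgroup G} {r : ℕ}
    (hr : IsGreatest {k : ℕ | ∃ z : Fin k → G, (∀ i, z i ∈ Γ) ∧
      (∀ e : Fin k → ℤ, (∏ i, z i ^ e i) = 1 → ∀ i, e i = 0)} r) :
    ∃ z : Fin r → G, ∀ x ∈ Γ, ∃ N : ℕ, N ≠ 0 ∧ ∃ e : Fin r → ℤ, x ^ N = ∏ i, z i ^ e i := by
  obtain ⟨⟨z, hzΓ, hz⟩, hmax⟩ := hr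
  refine ⟨z, fun x hx => ?_⟩
  by_contra! hcon
  have := hmax (a := r + 1) ⟨Fin.snoc z x, fun i => ?_, fun e he => ?_⟩
  · omega
  · refine Fin.lastCases ?_ (fun i => ?_) i
    · simpa using hx
    · simpa using hzΓ i
  · rw [Fin.prod_univ_castSucc] at he
    simp only [Fin.snoc_castSucc, Fin.snoc_last] at he
    have hl : e (Fin.last r) = 0 := by
      by_contra hne
      obtain ⟨k, hk⟩ := (e (Fin.last r)).eq_nat_or_neg
      rcases hk with hk | hk
      · refine hcon k (by omega) (fun i => -e i.castSucc) ?_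
        rw [hk, zpow_natCast] at he
        simp only [zpow_neg, prod_inv_distrib]
        exact eq_inv_of_mul_eq_one_right he
      · refine hcon k (by omega) (fun i => e i.castSucc) ?_
        rw [hk, zpow_neg, zpow_natCast, mul_inv_eq_one] at he
        exact he.symm
    rw [hl, zpow_zero, mul_one] at he
    refine fun i => Fin.lastCases hl (fun i => ?_) i
    exact hz _ he i

end Specialization

end Auxiliary

/-- For fixed `n ≥ 1` there are `C(n), c(n) > 0` such that for every finitely
generated subgroup `Γ ⊆ ℂ*` of rank `r` (the rank being the maximal number of multiplicatively
independent elements of `Γ`), every finite `A ⊆ ℂ` with `#A = m` and all nonzero integers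
`a₁, …, a_n`, the number of solutions of `a₁x₁ + ⋯ + a_nx_n = 0` with `xᵢ ∈ Γ ∩ A` is at most
`C(n)·(m^⌊n/2⌋ + exp(c(n)·r)·m^⌊(n−1)/2⌋)`. -/
theorem stmt14 (n : ℕ) (hn : 1 ≤ n) :
    ∃ C c : ℝ, 0 < C ∧ 0 < c ∧
      ∀ Γ : Subgroup ℂˣ, Group.FG Γ → ∀ r : ℕ,
        IsGreatest {k : ℕ | ∃ z : Fin k → ℂˣ, (∀ i, z i ∈ Γ) ∧
            (∀ e : Fin k → ℤ, (∏ i, z i ^ e i) = 1 → ∀ i, e i = 0)} r →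
        ∀ (A : Finset ℂ) (a : Fin n → ℤ), (∀ i, a i ≠ 0) →
          (Set.ncard {x : Fin n → ℂ |
              (∀ i, x i ∈ A ∧ ∃ u : ℂˣ, u ∈ Γ ∧ (u : ℂ) = x i) ∧
              (∑ i, (a i : ℂ) * x i) = 0} : ℝ)
            ≤ C * ((A.card : ℝ) ^ (n / 2) +
                Real.exp (c * r) * (A.card : ℝ) ^ ((n - 1) / 2)) := by
  classical
  obtain ⟨C, κ, hκ, hcount⟩ := exists_card_linearSolutions_le n
  let d : ℝ := Real.log κ + 1
  have hd0 : 0 < d := by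
    have := Real.log_natCast_nonneg κ
    simp only [d]
    linarith
  have hκd : (κ : ℝ) ≤ Real.exp d := by
    have h1 : (0 : ℝ) < κ := by exact_mod_cast hκ
    calc (κ : ℝ) = Real.exp (Real.log κ) := (Real.exp_log h1).symm
      _ ≤ _ := Real.exp_le_exp.2 (by simp [d])
  have hn0 : (0 : ℝ) < n := by exact_mod_cast hn
  refine ⟨(C + 1) * Real.exp (n * d * (n + 1)), n * d, by positivity, by positivity, ?_⟩
  intro Γ hΓ r hr A a ha
  let B : Finset ℂ := A.filter fun z => ∃ u : ℂˣ, u ∈ Γ ∧ (u : ℂ) = z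
  have hset : {x : Fin n → ℂ | (∀ i, x i ∈ A ∧ ∃ u : ℂˣ, u ∈ Γ ∧ (u : ℂ) = x i) ∧
      (∑ i, (a i : ℂ) * x i) = 0} = linearSolutions B fun i => (a i : ℂ) := by
    ext x
    simp [mem_linearSolutions, B]
  rw [hset, Set.ncard_coe_finset]
  rcases Nat.eq_zero_or_pos B.card with h0 | hpos
  · have : linearSolutions B (fun i => (a i : ℂ)) = ∅ := by
      refine Finset.eq_empty_of_forall_notMem fun x hx => ?_
      have := (mem_linearSolutions.1 hx).1 ⟨0, hn⟩
      rw [Finset.card_eq_zero.1 h0] at this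
      simp at this
    rw [this]
    simp only [Finset.card_empty, Nat.cast_zero]
    positivity
  obtain ⟨z, hz⟩ := exists_pow_eq_prod hr
  have hB0 : ∀ x ∈ B, x ≠ 0 := fun x hx => by
    obtain ⟨u, -, rfl⟩ := (Finset.mem_filter.1 hx).2
    exact u.ne_zero
  have hBz : ∀ x ∈ B, ∃ N : ℕ, N ≠ 0 ∧ ∃ e : Fin r → ℤ, x ^ N = ∏ i, (z i : ℂ) ^ e i := by
    intro x hx
    obtain ⟨u, hu, rfl⟩ := (Finset.mem_filter.1 hx).2
    obtain ⟨N, hN, e, he⟩ := hz u hu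
    refine ⟨N, hN, e, ?_⟩
    have := congrArg Units.val he
    push_cast at this
    exact this
  obtain ⟨K, _, _, f, hinj, hf0, hrank, hf⟩ :=
    exists_specialization B hB0 (fun i => (z i : ℂ)) (fun i => (z i).ne_zero) hBz
  have h1 : (linearSolutions B fun i => (a i : ℂ)).card ≤
      (linearSolutions (B.image f) fun i => (a i : K)).card := by
    refine Finset.card_le_card_of_injOn (fun x i => f (x i)) (fun x hx => ?_) ?_
    · obtain ⟨h1, h2⟩ := mem_linearSolutions.1 hx
      exact mem_linearSolutions.2
        ⟨fun i => Finset.mem_image_of_mem _ (h1 i), hf _ a x h1 h2⟩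
    · intro x hx y hy hxy
      exact funext fun i => hinj ((mem_linearSolutions.1 hx).1 i)
        ((mem_linearSolutions.1 hy).1 i) (congrFun hxy i)
  have hcard : (B.image f).card = B.card := Finset.card_image_of_injOn hinj
  have h2 := hcount K (B.image f) r ?_ (by rwa [Finset.coe_image]) (by omega) n le_rfl (Fin n)
    (Fintype.card_fin n) (fun i => (a i : K)) fun i => Int.cast_ne_zero.2 (ha i)
  · rw [hcard] at h2
    have h3 : ((linearSolutions B fun i => (a i : ℂ)).card : ℝ) ≤
        C * ((B.card : ℝ) ^ (n / 2) +
          ((κ : ℝ) ^ (r + n + 1)) ^ n * (B.card : ℝ) ^ ((n - 1) / 2)) := by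
      exact_mod_cast h1.trans h2
    have hBA : (B.card : ℝ) ≤ A.card := by exact_mod_cast Finset.card_filter_le _ _
    have he : ((κ : ℝ) ^ (r + n + 1)) ^ n ≤
        Real.exp (n * d * (n + 1)) * Real.exp (n * d * r) := by
      calc ((κ : ℝ) ^ (r + n + 1)) ^ n ≤ (Real.exp d ^ (r + n + 1)) ^ n := by gcongr
        _ = _ := by
          rw [← Real.exp_nat_mul, ← Real.exp_nat_mul, ← Real.exp_add]
          congr 1
          push_cast
          ring
    have h4 : 1 ≤ Real.exp (n * d * (n + 1)) := Real.one_le_exp (by positivity)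
    calc _ ≤ _ := h3
      _ ≤ (C + 1) * (Real.exp (n * d * (n + 1)) * (A.card : ℝ) ^ (n / 2) +
          (Real.exp (n * d * (n + 1)) * Real.exp (n * d * r)) *
            (A.card : ℝ) ^ ((n - 1) / 2)) := by
        gcongr
        · linarith
        · calc (B.card : ℝ) ^ (n / 2) ≤ (A.card : ℝ) ^ (n / 2) := by gcongr
            _ ≤ _ := le_mul_of_one_le_left (by positivity) h4
      _ = _ := by ring
  · intro y hy
    obtain ⟨x, hx, rfl⟩ := Finset.mem_image.1 hy
    exact hf0 x hx
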